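/- arXiv:2602.06658 — 3 statements merged into one kernel-verified Lean document; each statement's English description precedes it below -/
import Mathlib

section
/- Let X be a compact metric space and c : X × X → ℝ a continuous, symmetric, nonnegative cost function. Then the Sinkhorn divergence S_ε(α,β) is nonnegative for every ε > 0 and every pair of Borel probability measures α, β on X if and only if c is conditionally negative definite, i.e. for every finite family of points x_1,…,x_n ∈ X and real numbers a_1,…,a_n with Σ a_i = 0 one has Σ_{i,j} a_i a_j c(x_i,x_j) ≤ 0. -/
open MeasureTheory Classical

/-- Kullback–Leibler divergence, with value `⊤` when `π` is not absolutely continuous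
with respect to `μ` or the log-likelihood ratio is not integrable. -/
noncomputable def klE {Z : Type*} [MeasurableSpace Z] (π μ : Measure Z) : EReal :=
  if π ≪ μ ∧ Integrable (llr π μ) π then ((∫ z, llr π μ z ∂π : ℝ) : EReal) else ⊤

/-- Entropic optimal transport cost for a cost `c`, temperature `ε`. -/
noncomputable def otE {X Y : Type*} [MeasurableSpace X] [MeasurableSpace Y]
    (c : X → Y → ℝ) (ε : ℝ) (α : Measure X) (β : Measure Y) [SFinite β] : EReal :=
  ⨅ π ∈ {π : Measure (X × Y) | π.map Prod.fst = α ∧ π.map Prod.snd = β},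
    ((∫ p, c p.1 p.2 ∂π : ℝ) : EReal) + (ε : EReal) * klE π (α.prod β)

/-- Sinkhorn divergence for a symmetric cost `c` on `X`. -/
noncomputable def sinkhornE {X : Type*} [MeasurableSpace X]
    (c : X → X → ℝ) (ε : ℝ) (α β : Measure X) [SFinite α] [SFinite β] : EReal :=
  otE c ε α β - (((1 : ℝ) / 2 : ℝ) : EReal) * (otE c ε α α + otE c ε β β)

/-- Gibbs' variational inequality, in the linearised form `log z ≤ z - 1`. -/
lemma integral_add_one_sub_integral_exp_le_integral_llr {Z : Type*} [MeasurableSpace Z]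
    {π μ : Measure Z} [IsProbabilityMeasure π] [IsProbabilityMeasure μ] (hπμ : π ≪ μ)
    (h_int : Integrable (llr π μ) π) {f : Z → ℝ} (hfπ : Integrable f π)
    (hfμ : Integrable (fun z ↦ Real.exp (f z)) μ) :
    ∫ z, f z ∂π + 1 - ∫ z, Real.exp (f z) ∂μ ≤ ∫ z, llr π μ z ∂π := by
  have := isProbabilityMeasure_tilted hfμ
  have hac : π ≪ μ.tilted f := hπμ.trans (absolutelyContinuous_tilted hfμ)
  have hint := integrable_llr_tilted_right hπμ hfπ h_int hfμ
  have h := InformationTheory.integral_llr_add_sub_measure_univ_nonneg hac hint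
  rw [integral_llr_tilted_right hπμ hfπ hfμ h_int] at h
  simp only [probReal_univ] at h
  have hlog := Real.log_le_sub_one_of_pos (integral_exp_pos hfμ)
  linarith

lemma Continuous.integrable_of_compactSpace {Z : Type*} [TopologicalSpace Z] [CompactSpace Z]
    [MeasurableSpace Z] [OpensMeasurableSpace Z] {μ : Measure Z} [IsFiniteMeasure μ] {f : Z → ℝ}
    (hf : Continuous f) : Integrable f μ :=
  hf.integrable_of_hasCompactSupport (HasCompactSupport.of_compactSpace f)

section Coupling

variable {X : Type*} [MetricSpace X] [CompactSpace X] [MeasurableSpace X] [BorelSpace X]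
  {c : X → X → ℝ} {α β : Measure X} [IsProbabilityMeasure α] [IsProbabilityMeasure β]

/-- Weak duality for entropic optimal transport. -/
lemma le_otE (hc : Continuous fun p : X × X ↦ c p.1 p.2) {ε : ℝ} (hε : 0 < ε) {u v : X → ℝ}
    (hu : Continuous u) (hv : Continuous v) :
    ((ε * (∫ x, u x ∂α + ∫ y, v y ∂β + 1
      - ∫ p, Real.exp (u p.1 + v p.2 - c p.1 p.2 / ε) ∂(α.prod β)) : ℝ) : EReal)
      ≤ otE c ε α β := by
  refine le_iInf₂ fun π ⟨h1, h2⟩ ↦ ?_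
  have hπ : IsProbabilityMeasure π := by
    constructor
    rw [← Set.preimage_univ (f := Prod.fst), ← Measure.map_apply measurable_fst .univ, h1]
    exact measure_univ
  unfold klE
  split_ifs with h
  · norm_cast
    have hu' : Continuous fun p : X × X ↦ u p.1 := hu.comp continuous_fst
    have hv' : Continuous fun p : X × X ↦ v p.2 := hv.comp continuous_snd
    have hf : Continuous fun p : X × X ↦ u p.1 + v p.2 - c p.1 p.2 / ε := by fun_prop
    have hG := integral_add_one_sub_integral_exp_le_integral_llr h.1 h.2
      hf.integrable_of_compactSpace (Real.continuous_exp.comp hf).integrable_of_compactSpace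
    have huπ : ∫ p, u p.1 ∂π = ∫ x, u x ∂α := by
      rw [← h1, integral_map measurable_fst.aemeasurable hu.aestronglyMeasurable]
    have hvπ : ∫ p, v p.2 ∂π = ∫ x, v x ∂β := by
      rw [← h2, integral_map measurable_snd.aemeasurable hv.aestronglyMeasurable]
    have hsum : Continuous fun p : X × X ↦ u p.1 + v p.2 := hu'.add hv'
    rw [integral_sub hsum.integrable_of_compactSpace
        (hc.div_const ε).integrable_of_compactSpace,
      integral_add hu'.integrable_of_compactSpace hv'.integrable_of_compactSpace,
      integral_div, huπ, hvπ] at hG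
    have := mul_le_mul_of_nonneg_left hG hε.le
    have e : ε * ((∫ p, c p.1 p.2 ∂π) / ε) = ∫ p, c p.1 p.2 ∂π := by field_simp
    linarith
  · rw [EReal.coe_mul_top_of_pos hε, EReal.coe_add_top]
    exact le_top

/-- The cost of the coupling with Gibbs density `exp f` bounds the entropic transport cost. -/
lemma otE_le_of_tilted (hc : Continuous fun p : X × X ↦ c p.1 p.2) (ε : ℝ) {f : X × X → ℝ}
    (hf : Continuous f) (hf1 : ∫ p, Real.exp (f p) ∂(α.prod β) = 1)
    (h1 : ((α.prod β).tilted f).map Prod.fst = α) (h2 : ((α.prod β).tilted f).map Prod.snd = β) :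
    otE c ε α β ≤ ((∫ p, (c p.1 p.2 + ε * f p) ∂((α.prod β).tilted f) : ℝ) : EReal) := by
  refine (iInf₂_le ((α.prod β).tilted f) ⟨h1, h2⟩).trans ?_
  have hexp : Integrable (fun p ↦ Real.exp (f p)) (α.prod β) :=
    (Real.continuous_exp.comp hf).integrable_of_compactSpace
  have := isProbabilityMeasure_tilted hexp
  have hac := tilted_absolutelyContinuous (α.prod β) f
  have hllr : llr ((α.prod β).tilted f) (α.prod β) =ᵐ[(α.prod β).tilted f] f := by
    filter_upwards [hac.ae_le (log_rnDeriv_tilted_left_self hexp)] with p hp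
    simpa [llr, hf1] using hp
  have hfi : Integrable f ((α.prod β).tilted f) := hf.integrable_of_compactSpace
  rw [klE, if_pos ⟨hac, (integrable_congr hllr).2 hfi⟩, integral_congr_ae hllr,
    integral_add hc.integrable_of_compactSpace (hfi.const_mul ε), integral_const_mul]
  norm_cast

lemma otE_le_integral_prod (hc : Continuous fun p : X × X ↦ c p.1 p.2) (ε : ℝ) :
    otE c ε α β ≤ ((∫ p, c p.1 p.2 ∂(α.prod β) : ℝ) : EReal) := by
  simpa using otE_le_of_tilted (α := α) (β := β) hc ε (f := fun _ ↦ 0) continuous_const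
    (by simp) (by simp) (by simp)

lemma map_fst_tilted_prod {f : X × X → ℝ} (hf : Continuous f)
    (h : ∀ᵐ x ∂α, ∫ y, Real.exp (f (x, y)) ∂β = 1) :
    ((α.prod β).tilted f).map Prod.fst = α := by
  have hexp : Integrable (fun p ↦ Real.exp (f p)) (α.prod β) :=
    (Real.continuous_exp.comp hf).integrable_of_compactSpace
  have h1 : ∫ p, Real.exp (f p) ∂(α.prod β) = 1 := by
    rw [integral_prod _ hexp, integral_congr_ae h]
    simp
  ext s hs
  rw [Measure.map_apply measurable_fst hs, tilted_apply_eq_ofReal_integral, h1,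
    ← Set.prod_univ]
  simp only [div_one]
  rw [setIntegral_prod _ hexp.integrableOn, setIntegral_congr_ae (g := fun _ ↦ 1) hs]
  · simp
  · filter_upwards [h] with x hx _
    simpa using hx

lemma map_snd_tilted_prod {f : X × X → ℝ} (hf : Continuous f)
    (h : ∀ᵐ y ∂β, ∫ x, Real.exp (f (x, y)) ∂α = 1) :
    ((α.prod β).tilted f).map Prod.snd = β := by
  have hexp : Integrable (fun p ↦ Real.exp (f p)) (α.prod β) :=
    (Real.continuous_exp.comp hf).integrable_of_compactSpace
  have h1 : ∫ p, Real.exp (f p) ∂(α.prod β) = 1 := by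
    rw [integral_prod_symm _ hexp, integral_congr_ae h]
    simp
  ext s hs
  rw [Measure.map_apply measurable_snd hs, tilted_apply_eq_ofReal_integral, h1,
    ← Set.univ_prod]
  simp only [div_one]
  have hswap : Integrable (fun p : X × X ↦ Real.exp (f p.swap)) (β.prod α) := hexp.swap
  rw [← setIntegral_prod_swap, setIntegral_prod _ hswap.integrableOn,
    setIntegral_congr_ae (g := fun _ ↦ 1) hs]
  · simp
  · filter_upwards [h] with x hx _
    simpa using hx

end Coupling

section SymmetricPotential

variable {X : Type*} [MetricSpace X] [CompactSpace X] [MeasurableSpace X] [BorelSpace X]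
  {d : X → X → ℝ} {α : Measure X}

/-- The Sinkhorn map `u ↦ -log ∫ exp (u y - d x y) dα(y)`. -/
noncomputable def sinkhornMap (d : X → X → ℝ) (α : Measure X) (u : X → ℝ) (x : X) : ℝ :=
  -Real.log (∫ y, Real.exp (u y - d x y) ∂α)

lemma exp_neg_sinkhornMap [IsProbabilityMeasure α] (hd : Continuous fun p : X × X ↦ d p.1 p.2)
    {u : X → ℝ} (hu : Continuous u) (x : X) :
    Real.exp (-sinkhornMap d α u x) = ∫ y, Real.exp (u y - d x y) ∂α := by
  rw [sinkhornMap, neg_neg, Real.exp_log]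
  have : Continuous fun y ↦ u y - d x y := hu.sub (hd.comp (Continuous.prodMk_right x))
  exact integral_exp_pos (Real.continuous_exp.comp this).integrable_of_compactSpace

/-- A pointwise bound on the exponents of the integrands transfers to the Sinkhorn map. -/
lemma exp_neg_sinkhornMap_le [IsProbabilityMeasure α]
    (hd : Continuous fun p : X × X ↦ d p.1 p.2) {u v : X → ℝ} (hu : Continuous u)
    (hv : Continuous v) {x x' : X} {r : ℝ} (h : ∀ y, u y - d x y ≤ r + (v y - d x' y)) :
    sinkhornMap d α v x' ≤ sinkhornMap d α u x + r := by
  have hi : ∀ {w : X → ℝ} (_ : Continuous w) (z : X),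
      Integrable (fun y ↦ Real.exp (w y - d z y)) α := fun hw z ↦
    (Real.continuous_exp.comp
      (hw.sub (hd.comp (Continuous.prodMk_right z)))).integrable_of_compactSpace
  have key : Real.exp (-sinkhornMap d α u x) ≤ Real.exp (r - sinkhornMap d α v x') := by
    rw [sub_eq_add_neg, Real.exp_add, exp_neg_sinkhornMap hd hu, exp_neg_sinkhornMap hd hv,
      ← integral_const_mul]
    refine integral_mono (hi hu x) ((hi hv x').const_mul _) fun y ↦ ?_
    rw [← Real.exp_add]
    exact Real.exp_le_exp.2 (h y)
  have := Real.exp_le_exp.1 key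
  linarith

/-- For a symmetric cost, some potential satisfies the Schrödinger equation almost everywhere. -/
lemma exists_symmetric_potential [IsProbabilityMeasure α]
    (hd : Continuous fun p : X × X ↦ d p.1 p.2) (hsymm : ∀ x x', d x x' = d x' x)
    (hnonneg : ∀ x x', 0 ≤ d x x') :
    ∃ u : X → ℝ, Continuous u ∧ ∀ᵐ x ∂α, ∫ y, Real.exp (u x + u y - d x y) ∂α = 1 := by
  obtain ⟨C, hC⟩ : ∃ C, ∀ x y, d x y ≤ C := by
    obtain ⟨C, hC⟩ := (isCompact_range hd).bddAbove
    exact ⟨C, fun x y ↦ hC ⟨(x, y), rfl⟩⟩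
  let F : C(X, C(X, ℝ)) := ContinuousMap.curry ⟨fun p : X × X ↦ d p.1 p.2, hd⟩
  have hF : ∀ x y z, |d x z - d y z| ≤ dist (F x) (F y) := fun x y z ↦
    ContinuousMap.dist_apply_le_dist (f := F x) (g := F y) z
  have hFC : ∀ x y, dist (F x) (F y) ≤ C := fun x y ↦
    (ContinuousMap.dist_le ((hnonneg x x).trans (hC x x))).2 fun z ↦ by
      change |d x z - d y z| ≤ C
      have := hC x z; have := hC y z; have := hnonneg x z; have := hnonneg y z
      exact abs_le.2 ⟨by linarith, by linarith⟩
  have hcont : ∀ w : X → ℝ, (∀ x y, |w x - w y| ≤ dist (F x) (F y)) → Continuous w := by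
    intro w hw
    rw [continuous_iff_continuousAt]
    intro x
    refine tendsto_iff_dist_tendsto_zero.2 (squeeze_zero (fun _ ↦ dist_nonneg) (fun y ↦ hw y x) ?_)
    exact tendsto_iff_dist_tendsto_zero.1 (F.continuous.tendsto x)
  have hT : ∀ u : X → ℝ, Continuous u → ∀ x y,
      |sinkhornMap d α u x - sinkhornMap d α u y| ≤ dist (F x) (F y) := by
    intro u hu x y
    have h1 := exp_neg_sinkhornMap_le (α := α) hd hu hu (x := x) (x' := y) (r := dist (F x) (F y))
      fun z ↦ by linarith [(abs_le.1 (hF x y z)).1]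
    have h2 := exp_neg_sinkhornMap_le (α := α) hd hu hu (x := y) (x' := x) (r := dist (F x) (F y))
      fun z ↦ by linarith [(abs_le.1 (hF x y z)).2]
    exact abs_le.2 ⟨by linarith, by linarith⟩
  let K : Set (BoundedContinuousFunction X ℝ) :=
    {u | (∀ x y, |u x - u y| ≤ dist (F x) (F y)) ∧ ∀ x, |u x| ≤ C}
  have hev : ∀ x : X, Continuous fun u : BoundedContinuousFunction X ℝ ↦ u x := fun x ↦
    continuous_eval_const x
  have hKclosed : IsClosed K := by
    have : K = (⋂ x, ⋂ y, {u | |u x - u y| ≤ dist (F x) (F y)}) ∩ ⋂ x, {u | |u x| ≤ C} := by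
      ext u; simp [K]
    rw [this]
    exact (isClosed_iInter fun x ↦ isClosed_iInter fun y ↦
      isClosed_le ((hev x).sub (hev y)).abs continuous_const).inter
      (isClosed_iInter fun x ↦ isClosed_le (hev x).abs continuous_const)
  have hKcompact : IsCompact K := by
    refine BoundedContinuousFunction.arzela_ascoli₂ (Set.Icc (-C) C) isCompact_Icc K hKclosed
      (fun u x hu ↦ abs_le.1 (hu.2 x)) ?_
    intro x
    rw [Metric.equicontinuousAt_iff]
    intro e he
    obtain ⟨δ, hδ, h⟩ := Metric.continuous_iff.1 F.continuous x e he
    refine ⟨δ, hδ, fun y hy u ↦ ?_⟩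
    rw [dist_comm (α := ℝ)]
    exact (u.2.1 y x).trans_lt (h y hy)
  let D : BoundedContinuousFunction X ℝ → ℝ := fun u ↦
    2 * ∫ x, u x ∂α - ∫ p, Real.exp (u p.1 + u p.2 - d p.1 p.2) ∂(α.prod α)
  have hDcont : ContinuousOn D K := by
    refine ContinuousOn.sub (continuousOn_const.mul ?_) ?_
    · exact continuousOn_of_dominated (bound := fun _ ↦ C)
        (fun u _ ↦ u.continuous.aestronglyMeasurable)
        (fun u hu ↦ .of_forall fun x ↦ hu.2 x) (integrable_const _)
        (.of_forall fun x ↦ (hev x).continuousOn)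
    · refine continuousOn_of_dominated (bound := fun _ ↦ Real.exp (2 * C))
        (fun u _ ↦ Continuous.aestronglyMeasurable (by fun_prop))
        (fun u hu ↦ .of_forall fun p ↦ ?_) (integrable_const _)
        (.of_forall fun p ↦ Continuous.continuousOn ?_)
      · rw [Real.norm_eq_abs, Real.abs_exp, Real.exp_le_exp]
        have h1 := (abs_le.1 (hu.2 p.1)).2
        have h2 := (abs_le.1 (hu.2 p.2)).2
        have := hnonneg p.1 p.2
        linarith
      · exact Real.continuous_exp.comp (((hev _).add (hev _)).sub continuous_const)
  have hK0 : (0 : BoundedContinuousFunction X ℝ) ∈ K :=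
    ⟨fun x y ↦ by simp, fun x ↦ by simpa using (hnonneg x x).trans (hC x x)⟩
  obtain ⟨u, huK, humax⟩ := hKcompact.exists_isMaxOn ⟨0, hK0⟩ hDcont
  have hu := u.continuous
  set v : X → ℝ := sinkhornMap d α u with hv_def
  have hv : Continuous v := hcont v (hT u hu)
  let w : BoundedContinuousFunction X ℝ :=
    BoundedContinuousFunction.mkOfCompact ⟨fun x ↦ (u x + v x) / 2, by fun_prop⟩
  have hw : ∀ x, w x = (u x + v x) / 2 := fun x ↦ rfl
  have hwK : w ∈ K := by
    refine ⟨fun x y ↦ ?_, fun x ↦ ?_⟩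
    · have h1 := abs_le.1 (huK.1 x y)
      have h2 := abs_le.1 (hT u hu x y)
      rw [hw, hw]
      exact abs_le.2 ⟨by linarith, by linarith⟩
    · have hlog : ∀ y, |u y - u x| ≤ C := fun y ↦ (huK.1 y x).trans (hFC y x)
      have hint : Integrable (fun y ↦ Real.exp (u y - d x y)) α :=
        (Real.continuous_exp.comp
          (hu.sub (hd.comp (Continuous.prodMk_right x)))).integrable_of_compactSpace
      have hexp := exp_neg_sinkhornMap (α := α) hd hu x
      have h1 : Real.exp (-v x) ≤ Real.exp (u x + C) := by
        rw [hexp]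
        refine (integral_mono hint (integrable_const (Real.exp (u x + C))) fun y ↦ ?_).trans
          (by simp)
        exact Real.exp_le_exp.2 (by linarith [(abs_le.1 (hlog y)).2, hnonneg x y])
      have h2 : Real.exp (u x - 2 * C) ≤ Real.exp (-v x) := by
        rw [hexp]
        refine le_trans (by simp) (integral_mono (integrable_const (Real.exp (u x - 2 * C))) hint
          fun y ↦ ?_)
        exact Real.exp_le_exp.2 (by linarith [(abs_le.1 (hlog y)).1, hC x y])
      rw [Real.exp_le_exp] at h1 h2
      have := (hnonneg x x).trans (hC x x)
      rw [hw]
      exact abs_le.2 ⟨by linarith, by linarith⟩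
  have hprod : ∀ g : X → ℝ, Continuous g →
      ∫ p, Real.exp (g p.1 + u p.2 - d p.1 p.2) ∂(α.prod α) = ∫ x, Real.exp (g x - v x) ∂α := by
    intro g hg
    rw [integral_prod _ (Continuous.integrable_of_compactSpace (by fun_prop))]
    refine integral_congr_ae (.of_forall fun x ↦ ?_)
    simp only [add_sub_assoc, Real.exp_add, integral_const_mul]
    rw [sub_eq_add_neg, Real.exp_add, exp_neg_sinkhornMap hd hu]
  have hDw : ∫ x, u x ∂α + ∫ x, v x ∂α - 1 ≤ D w := by
    have hle : ∫ p, Real.exp (w p.1 + w p.2 - d p.1 p.2) ∂(α.prod α) ≤ 1 := by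
      have hvu : ∫ p, Real.exp (v p.1 + u p.2 - d p.1 p.2) ∂(α.prod α) = 1 := by
        rw [hprod v hv]; simp
      have huv : ∫ p, Real.exp (u p.1 + v p.2 - d p.1 p.2) ∂(α.prod α) = 1 := by
        rw [← hvu, ← integral_prod_swap]
        refine integral_congr_ae (.of_forall fun p ↦ ?_)
        simp only [Prod.fst_swap, Prod.snd_swap]
        rw [hsymm, add_comm (u p.2)]
      have hi1 : Integrable (fun p : X × X ↦ Real.exp (v p.1 + u p.2 - d p.1 p.2)) (α.prod α) :=
        Continuous.integrable_of_compactSpace (by fun_prop)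
      have hi2 : Integrable (fun p : X × X ↦ Real.exp (u p.1 + v p.2 - d p.1 p.2)) (α.prod α) :=
        Continuous.integrable_of_compactSpace (by fun_prop)
      calc _ ≤ ∫ p : X × X, (Real.exp (v p.1 + u p.2 - d p.1 p.2)
              + Real.exp (u p.1 + v p.2 - d p.1 p.2)) / 2 ∂(α.prod α) := by
            refine integral_mono (Continuous.integrable_of_compactSpace (by fun_prop))
              ((hi1.add hi2).div_const 2) fun p ↦ ?_
            have h1 : Real.exp (v p.1 + u p.2 - d p.1 p.2)
                = Real.exp ((v p.1 + u p.2 - d p.1 p.2) / 2) ^ 2 := by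
              rw [← Real.exp_nat_mul]; congr 1; push_cast; ring
            have h2 : Real.exp (u p.1 + v p.2 - d p.1 p.2)
                = Real.exp ((u p.1 + v p.2 - d p.1 p.2) / 2) ^ 2 := by
              rw [← Real.exp_nat_mul]; congr 1; push_cast; ring
            have h3 : Real.exp (w p.1 + w p.2 - d p.1 p.2)
                = Real.exp ((v p.1 + u p.2 - d p.1 p.2) / 2)
                  * Real.exp ((u p.1 + v p.2 - d p.1 p.2) / 2) := by
              rw [← Real.exp_add, hw, hw]; congr 1; ring
            change Real.exp (w p.1 + w p.2 - d p.1 p.2) ≤ (_ + _) / 2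
            rw [h1, h2, h3]
            nlinarith [sq_nonneg (Real.exp ((v p.1 + u p.2 - d p.1 p.2) / 2)
                - Real.exp ((u p.1 + v p.2 - d p.1 p.2) / 2))]
        _ = 1 := by rw [integral_div, integral_add hi1 hi2, hvu, huv]; norm_num
    have hwint : ∫ x, w x ∂α = (∫ x, u x ∂α + ∫ x, v x ∂α) / 2 := by
      simp only [hw]
      rw [integral_div, integral_add hu.integrable_of_compactSpace hv.integrable_of_compactSpace]
    change _ ≤ 2 * ∫ x, w x ∂α - _
    rw [hwint]
    linarith
  have hDu : D u = 2 * ∫ x, u x ∂α - ∫ x, Real.exp (u x - v x) ∂α := by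
    change 2 * ∫ x, u x ∂α - _ = _
    rw [hprod u hu]
  have hmax : D w ≤ D u := humax hwK
  have hgap_cont : Continuous fun x ↦ Real.exp (u x - v x) - (u x - v x + 1) := by fun_prop
  have hgap_nonneg : ∀ x, 0 ≤ Real.exp (u x - v x) - (u x - v x + 1) := fun x ↦
    sub_nonneg.2 (Real.add_one_le_exp _)
  have hgap : ∫ x, (Real.exp (u x - v x) - (u x - v x + 1)) ∂α = 0 := by
    refine le_antisymm ?_ (integral_nonneg hgap_nonneg)
    have hi1 : Integrable (fun x ↦ Real.exp (u x - v x)) α :=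
      Continuous.integrable_of_compactSpace (by fun_prop)
    have hi2 : Integrable (fun x ↦ u x - v x) α :=
      Continuous.integrable_of_compactSpace (by fun_prop)
    have hi3 : Integrable (fun x ↦ u x - v x + 1) α := hi2.add (integrable_const 1)
    rw [integral_sub hi1 hi3, integral_add hi2 (integrable_const 1),
      integral_sub hu.integrable_of_compactSpace hv.integrable_of_compactSpace]
    simp only [integral_const, probReal_univ, one_smul]
    linarith
  rw [integral_eq_zero_iff_of_nonneg hgap_nonneg hgap_cont.integrable_of_compactSpace] at hgap
  refine ⟨u, hu, ?_⟩
  filter_upwards [hgap] with x hx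
  have hx0 : u x - v x = 0 := by
    by_contra hne
    have := Real.add_one_lt_exp hne
    simp only [Pi.zero_apply] at hx
    linarith
  simp only [add_sub_assoc, Real.exp_add, integral_const_mul]
  rw [← exp_neg_sinkhornMap hd hu, ← Real.exp_add, ← sub_eq_add_neg, ← hv_def, hx0, Real.exp_zero]

/-- Strong duality for the symmetric entropic transport problem. -/
lemma exists_otE_self_le [IsProbabilityMeasure α] {c : X → X → ℝ}
    (hc : Continuous fun p : X × X ↦ c p.1 p.2) (hsymm : ∀ x x', c x x' = c x' x)
    (hnonneg : ∀ x x', 0 ≤ c x x') {ε : ℝ} (hε : 0 < ε) :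
    ∃ u : X → ℝ, Continuous u ∧
      ∫ p, Real.exp (u p.1 + u p.2 - c p.1 p.2 / ε) ∂(α.prod α) = 1 ∧
      otE c ε α α ≤ ((ε * (2 * ∫ x, u x ∂α) : ℝ) : EReal) := by
  obtain ⟨u, hu, h⟩ := exists_symmetric_potential (d := fun x y ↦ c x y / ε) (α := α)
    (hc.div_const ε) (fun x y ↦ by rw [hsymm]) (fun x y ↦ div_nonneg (hnonneg x y) hε.le)
  have hf : Continuous fun p : X × X ↦ u p.1 + u p.2 - c p.1 p.2 / ε := by fun_prop
  have h1 := map_fst_tilted_prod (β := α) hf h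
  have h2 := map_snd_tilted_prod (α := α) (β := α) hf (by
    filter_upwards [h] with x hx
    rw [← hx]
    refine integral_congr_ae (.of_forall fun y ↦ ?_)
    simp only
    rw [hsymm, add_comm (u x)])
  have hexp : Integrable (fun p : X × X ↦ Real.exp (u p.1 + u p.2 - c p.1 p.2 / ε))
      (α.prod α) := (Real.continuous_exp.comp hf).integrable_of_compactSpace
  have hone : ∫ p, Real.exp (u p.1 + u p.2 - c p.1 p.2 / ε) ∂(α.prod α) = 1 := by
    rw [integral_prod _ hexp, integral_congr_ae h]
    simp
  refine ⟨u, hu, hone, (otE_le_of_tilted hc ε hf hone h1 h2).trans (le_of_eq ?_)⟩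
  congr 1
  set π := (α.prod α).tilted fun p : X × X ↦ u p.1 + u p.2 - c p.1 p.2 / ε
  have := isProbabilityMeasure_tilted hexp
  have e1 : ∫ p, u p.1 ∂π = ∫ x, u x ∂α := by
    conv_rhs => rw [← h1]
    rw [integral_map measurable_fst.aemeasurable hu.aestronglyMeasurable]
  have e2 : ∫ p, u p.2 ∂π = ∫ x, u x ∂α := by
    conv_rhs => rw [← h2]
    rw [integral_map measurable_snd.aemeasurable hu.aestronglyMeasurable]
  have e3 : ∀ p : X × X, c p.1 p.2 + ε * (u p.1 + u p.2 - c p.1 p.2 / ε)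
      = ε * (u p.1 + u p.2) := fun p ↦ by field_simp; ring
  simp only [e3]
  have hu1 : Continuous fun p : X × X ↦ u p.1 := hu.comp continuous_fst
  have hu2 : Continuous fun p : X × X ↦ u p.2 := hu.comp continuous_snd
  rw [integral_const_mul, integral_add hu1.integrable_of_compactSpace
    hu2.integrable_of_compactSpace, e1, e2, two_mul]

end SymmetricPotential

section PositiveDefinite

/-- The entrywise exponential of a positive semidefinite matrix has nonnegative quadratic form. -/
lemma Matrix.PosSemidef.sum_mul_exp_nonneg {ι : Type*} [Fintype ι] {M : Matrix ι ι ℝ}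
    (hM : M.PosSemidef) (a : ι → ℝ) : 0 ≤ ∑ i, ∑ j, a i * a j * Real.exp (M i j) := by
  have hpow : ∀ k : ℕ, (Matrix.of fun i j ↦ M i j ^ k).PosSemidef := by
    intro k
    induction k with
    | zero =>
      have := Matrix.posSemidef_vecMulVec_self_star (fun _ : ι ↦ (1 : ℝ))
      convert! this using 1
      ext i j
      simp [Matrix.vecMulVec_apply]
    | succ k ih =>
      convert! ih.hadamard hM using 1
  have hterm : ∀ k : ℕ, 0 ≤ ∑ i, ∑ j, a i * a j * (M i j ^ k / k.factorial) := by
    intro k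
    have h := (hpow k).dotProduct_mulVec_nonneg a
    have e : ∑ i, ∑ j, a i * a j * (M i j ^ k / k.factorial)
        = (dotProduct (star a) ((Matrix.of fun i j ↦ M i j ^ k).mulVec a)) / k.factorial := by
      simp only [dotProduct, Matrix.mulVec, Pi.star_apply, star_trivial, Matrix.of_apply,
        Finset.sum_div, Finset.mul_sum]
      exact Finset.sum_congr rfl fun i _ ↦ Finset.sum_congr rfl fun j _ ↦ by ring
    rw [e]
    positivity
  have hsum : HasSum (fun k : ℕ ↦ ∑ i, ∑ j, a i * a j * (M i j ^ k / k.factorial))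
      (∑ i, ∑ j, a i * a j * Real.exp (M i j)) := by
    refine hasSum_sum fun i _ ↦ hasSum_sum fun j _ ↦ HasSum.mul_left _ ?_
    rw [Real.exp_eq_exp_ℝ]
    exact NormedSpace.expSeries_div_hasSum_exp (M i j)
  exact hsum.nonneg hterm

/-- Schoenberg: if `d` is symmetric and conditionally negative definite, then `exp (-d)` is
positive definite. -/
lemma sum_mul_exp_neg_nonneg {X : Type*} {d : X → X → ℝ} (hsymm : ∀ x x', d x x' = d x' x)
    (hcnd : ∀ (n : ℕ) (x : Fin n → X) (a : Fin n → ℝ), (∑ i, a i) = 0 →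
      ∑ i, ∑ j, a i * a j * d (x i) (x j) ≤ 0)
    (n : ℕ) (x : Fin n → X) (b : Fin n → ℝ) :
    0 ≤ ∑ i, ∑ j, b i * b j * Real.exp (-d (x i) (x j)) := by
  rcases isEmpty_or_nonempty (Fin n) with hn | ⟨⟨i₀⟩⟩
  · simp
  set p := x i₀
  let M : Matrix (Fin n) (Fin n) ℝ :=
    .of fun i j ↦ d (x i) p + d p (x j) - d (x i) (x j) - d p p
  have hM : M.PosSemidef := by
    refine Matrix.PosSemidef.of_dotProduct_mulVec_nonneg ?_ fun a ↦ ?_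
    · ext i j
      simp only [M, Matrix.conjTranspose_apply, Matrix.of_apply, star_trivial]
      rw [hsymm (x j) p, hsymm p (x i), hsymm (x j) (x i)]
      ring
    · have h := hcnd (n + 1) (Fin.cons p x) (Fin.cons (-∑ i, a i) a) (by simp [Fin.sum_univ_succ])
      simp only [Fin.sum_univ_succ, Fin.cons_zero, Fin.cons_succ, Finset.sum_add_distrib] at h
      have e1 : ∀ r, ∑ j, -r * a j * d p (x j) = -(r * ∑ j, a j * d p (x j)) := fun r ↦ by
        rw [Finset.mul_sum, ← Finset.sum_neg_distrib]
        exact Finset.sum_congr rfl fun j _ ↦ by ring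
      have e2 : ∀ r, ∑ j, a j * -r * d (x j) p = -(r * ∑ j, a j * d (x j) p) := fun r ↦ by
        rw [Finset.mul_sum, ← Finset.sum_neg_distrib]
        exact Finset.sum_congr rfl fun j _ ↦ by ring
      have e3 : dotProduct (star a) (M.mulVec a)
          = (∑ j, a j * d (x j) p) * (∑ i, a i) + (∑ i, a i) * (∑ j, a j * d p (x j))
            - ∑ i, ∑ j, a i * a j * d (x i) (x j) - (∑ i, a i) * (∑ j, a j) * d p p := by
        rw [Finset.sum_mul_sum, Finset.sum_mul_sum, Finset.sum_mul_sum]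
        simp only [Finset.sum_mul, ← Finset.sum_add_distrib, ← Finset.sum_sub_distrib, dotProduct,
          Matrix.mulVec, Pi.star_apply, star_trivial, Finset.mul_sum, M, Matrix.of_apply]
        exact Finset.sum_congr rfl fun i _ ↦ Finset.sum_congr rfl fun j _ ↦ by ring
      rw [e1, e2] at h
      rw [e3]
      linarith
  refine (hM.sum_mul_exp_nonneg fun i ↦ b i * Real.exp (d p p / 2 - d (x i) p)).trans_eq ?_
  refine Finset.sum_congr rfl fun i _ ↦ Finset.sum_congr rfl fun j _ ↦ ?_
  have : Real.exp (-d (x i) (x j)) = Real.exp (d p p / 2 - d (x i) p)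
      * Real.exp (d p p / 2 - d (x j) p) * Real.exp (M i j) := by
    rw [← Real.exp_add, ← Real.exp_add]
    congr 1
    simp only [M, Matrix.of_apply]
    rw [hsymm p (x j)]
    ring
  rw [this]
  ring

/-- A kernel whose sums over finite samples are nonnegative has nonnegative double integral:
integrate over i.i.d. samples of size `n` and let `n` grow. -/
lemma integral_prod_self_nonneg {Z : Type*} [MetricSpace Z] [CompactSpace Z] [MeasurableSpace Z]
    [BorelSpace Z] {γ : Measure Z} [IsProbabilityMeasure γ] {g : Z → Z → ℝ}
    (hg : Continuous fun p : Z × Z ↦ g p.1 p.2)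
    (hpos : ∀ (n : ℕ) (z : Fin n → Z), 0 ≤ ∑ i, ∑ j, g (z i) (z j)) :
    0 ≤ ∫ p, g p.1 p.2 ∂(γ.prod γ) := by
  set I := ∫ p, g p.1 p.2 ∂(γ.prod γ) with hI
  set J := ∫ z, g z z ∂γ with hJ
  have key : ∀ n : ℕ, 0 ≤ J + n * I := by
    intro n
    let P : Measure (Fin (n + 1) → Z) := Measure.pi fun _ ↦ γ
    have hcont : ∀ i j, Continuous fun z : Fin (n + 1) → Z ↦ g (z i) (z j) := fun i j ↦
      hg.comp (f := fun z : Fin (n + 1) → Z ↦ (z i, z j))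
        ((continuous_apply i).prodMk (continuous_apply j))
    have heq : ∀ i j, ∫ z, g (z i) (z j) ∂P = I + if i = j then J - I else 0 := by
      intro i j
      split_ifs with hij
      · subst hij
        have hmp : MeasurePreserving (Function.eval i) P γ := measurePreserving_eval _ i
        have hd : Continuous fun z ↦ g z z := hg.comp (continuous_id.prodMk continuous_id)
        rw [hJ, ← hmp.map_eq,
          integral_map hmp.measurable.aemeasurable hd.aestronglyMeasurable]
        simp
      · have hind : ProbabilityTheory.IndepFun (fun z : Fin (n + 1) → Z ↦ z i) (fun z ↦ z j) P :=
          (ProbabilityTheory.iIndepFun_pi (X := fun _ ↦ id) fun _ ↦ aemeasurable_id).indepFun hij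
        have hmap := (ProbabilityTheory.indepFun_iff_map_prod_eq_prod_map_map
          (measurable_pi_apply i).aemeasurable (measurable_pi_apply j).aemeasurable).1 hind
        have hi : P.map (fun z ↦ z i) = γ := (measurePreserving_eval (fun _ ↦ γ) i).map_eq
        have hj : P.map (fun z ↦ z j) = γ := (measurePreserving_eval (fun _ ↦ γ) j).map_eq
        rw [hi, hj] at hmap
        rw [hI, ← hmap, integral_map
          ((measurable_pi_apply i).prodMk (measurable_pi_apply j)).aemeasurable
          hg.aestronglyMeasurable]
        simp
    have h0 : 0 ≤ ∫ z, ∑ i, ∑ j, g (z i) (z j) ∂P := integral_nonneg fun z ↦ hpos (n + 1) z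
    rw [integral_finsetSum _ fun i _ ↦ Continuous.integrable_of_compactSpace
      (continuous_finsetSum _ fun j _ ↦ hcont i j)] at h0
    have h1 : ∑ i, ∫ z, ∑ j, g (z i) (z j) ∂P = (n + 1) * (J + n * I) := by
      have : ∀ i, ∫ z, ∑ j, g (z i) (z j) ∂P = J + n * I := by
        intro i
        rw [integral_finsetSum _ fun j _ ↦ (hcont i j).integrable_of_compactSpace]
        simp only [heq, Finset.sum_add_distrib, Finset.sum_ite_eq, Finset.mem_univ, if_true]
        simp
        ring
      simp only [this, Finset.sum_const, Finset.card_univ, Fintype.card_fin, nsmul_eq_mul]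
      push_cast
      ring
    rw [h1] at h0
    exact nonneg_of_mul_nonneg_right h0 (by positivity)
  by_contra! hneg
  obtain ⟨n, hn⟩ := exists_nat_gt (J / -I)
  have := key n
  rw [div_lt_iff₀ (by linarith)] at hn
  linarith

/-- Polarised positivity of the double integral of a positive definite kernel. -/
lemma two_mul_integral_prod_le {X : Type*} [MetricSpace X] [CompactSpace X] [MeasurableSpace X]
    [BorelSpace X] {α β : Measure X} [IsProbabilityMeasure α] [IsProbabilityMeasure β]
    {k : X → X → ℝ} (hk : Continuous fun p : X × X ↦ k p.1 p.2) (hsymm : ∀ x y, k x y = k y x)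
    (hpos : ∀ (n : ℕ) (x : Fin n → X) (b : Fin n → ℝ), 0 ≤ ∑ i, ∑ j, b i * b j * k (x i) (x j))
    {φ ψ : X → ℝ} (hφ : Continuous φ) (hψ : Continuous ψ) :
    2 * ∫ p, φ p.1 * ψ p.2 * k p.1 p.2 ∂(α.prod β)
      ≤ ∫ p, φ p.1 * φ p.2 * k p.1 p.2 ∂(α.prod α)
        + ∫ p, ψ p.1 * ψ p.2 * k p.1 p.2 ∂(β.prod β) := by
  let γ := α.prod β
  have hcomp : ∀ {f : (X × X) × (X × X) → X × X} {ν : Measure (X × X)} {θ ρ : X → ℝ},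
      MeasurePreserving f (γ.prod γ) ν → Continuous θ → Continuous ρ →
      ∫ q, θ (f q).1 * ρ (f q).2 * k (f q).1 (f q).2 ∂(γ.prod γ)
        = ∫ p, θ p.1 * ρ p.2 * k p.1 p.2 ∂ν := by
    intro f ν θ ρ hf hθ hρ
    have : Continuous fun p : X × X ↦ θ p.1 * ρ p.2 * k p.1 p.2 := by fun_prop
    rw [← hf.map_eq, integral_map hf.measurable.aemeasurable this.aestronglyMeasurable]
  have h11 : MeasurePreserving (Prod.map Prod.fst Prod.fst) (γ.prod γ) (α.prod α) :=
    measurePreserving_fst.prod measurePreserving_fst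
  have h22 : MeasurePreserving (Prod.map Prod.snd Prod.snd) (γ.prod γ) (β.prod β) :=
    measurePreserving_snd.prod measurePreserving_snd
  have h12 : MeasurePreserving (Prod.map Prod.fst Prod.snd) (γ.prod γ) (α.prod β) :=
    measurePreserving_fst.prod measurePreserving_snd
  have h12' : MeasurePreserving (Prod.map Prod.fst Prod.snd ∘ Prod.swap) (γ.prod γ) (α.prod β) :=
    h12.comp Measure.measurePreserving_swap
  have e11 := hcomp h11 hφ hφ
  have e22 := hcomp h22 hψ hψ
  have e12 := hcomp h12 hφ hψ
  have e12' := hcomp h12' hφ hψ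
  simp only [Prod.map_fst, Prod.map_snd, Function.comp_apply, Prod.fst_swap, Prod.snd_swap]
    at e11 e22 e12 e12'
  have hg : ∀ {s t : (X × X) × (X × X) → X} {θ ρ : X → ℝ}, Continuous s → Continuous t →
      Continuous θ → Continuous ρ →
      Continuous fun q ↦ θ (s q) * ρ (t q) * k (s q) (t q) := fun hs ht hθ hρ ↦
    ((hθ.comp hs).mul (hρ.comp ht)).mul (hk.comp (hs.prodMk ht))
  have c11 := hg (s := fun q ↦ q.1.1) (t := fun q ↦ q.2.1) (by fun_prop) (by fun_prop) hφ hφ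
  have c22 := hg (s := fun q ↦ q.1.2) (t := fun q ↦ q.2.2) (by fun_prop) (by fun_prop) hψ hψ
  have c12 := hg (s := fun q ↦ q.1.1) (t := fun q ↦ q.2.2) (by fun_prop) (by fun_prop) hφ hψ
  have c12' := hg (s := fun q ↦ q.2.1) (t := fun q ↦ q.1.2) (by fun_prop) (by fun_prop) hφ hψ
  have hmain := integral_prod_self_nonneg (γ := γ)
    (g := fun z z' ↦ φ z.1 * φ z'.1 * k z.1 z'.1 + ψ z.2 * ψ z'.2 * k z.2 z'.2
      - φ z.1 * ψ z'.2 * k z.1 z'.2 - φ z'.1 * ψ z.2 * k z'.1 z.2)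
    (((c11.add c22).sub c12).sub c12') (by
      intro n z
      have h := hpos (n + n) (Fin.append (fun i ↦ (z i).1) fun i ↦ (z i).2)
        (Fin.append (fun i ↦ φ (z i).1) fun i ↦ -ψ (z i).2)
      simp only [Fin.sum_univ_add, Fin.append_left, Fin.append_right] at h
      refine h.trans_eq ?_
      simp only [← Finset.sum_add_distrib]
      refine Finset.sum_congr rfl fun i _ ↦ Finset.sum_congr rfl fun j _ ↦ ?_
      rw [hsymm (z i).2 (z j).1]
      ring)
  have i11 := c11.integrable_of_compactSpace (μ := γ.prod γ)
  have i22 := c22.integrable_of_compactSpace (μ := γ.prod γ)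
  have i12 := c12.integrable_of_compactSpace (μ := γ.prod γ)
  have i12' := c12'.integrable_of_compactSpace (μ := γ.prod γ)
  have i1 := i11.add i22
  have i2 := i1.sub i12
  simp only [Pi.add_def, Pi.sub_def] at i1 i2
  rw [integral_sub i2 i12', integral_sub i1 i12, integral_add i11 i22, e11, e22, e12, e12'] at hmain
  linarith

end PositiveDefinite

section SinkhornDivergence

variable {X : Type*} [MetricSpace X] [CompactSpace X] [MeasurableSpace X] [BorelSpace X]
  {c : X → X → ℝ}

lemma sinkhornE_nonneg_iff (hc : Continuous fun p : X × X ↦ c p.1 p.2) {ε : ℝ} (hε : 0 < ε)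
    (α β : Measure X) [IsProbabilityMeasure α] [IsProbabilityMeasure β] :
    0 ≤ sinkhornE c ε α β ↔ (otE c ε α α).toReal + (otE c ε β β).toReal
      ≤ 2 * (otE c ε α β).toReal := by
  have hfin : ∀ (μ ν : Measure X) [IsProbabilityMeasure μ] [IsProbabilityMeasure ν],
      ((otE c ε μ ν).toReal : EReal) = otE c ε μ ν := fun μ ν _ _ ↦
    EReal.coe_toReal (ne_top_of_le_ne_top (EReal.coe_ne_top _) (otE_le_integral_prod hc ε))
      (ne_bot_of_le_ne_bot (EReal.coe_ne_bot _)
        (le_otE hc hε (u := fun _ ↦ 0) (v := fun _ ↦ 0) continuous_const continuous_const))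
  rw [sinkhornE, ← hfin α β, ← hfin α α, ← hfin β β]
  norm_cast
  simp only [EReal.toReal_coe]
  constructor <;> intro h <;> linarith

lemma sinkhornE_nonneg_of_cnd (hc : Continuous fun p : X × X ↦ c p.1 p.2)
    (hsymm : ∀ x x', c x x' = c x' x) (hnonneg : ∀ x x', 0 ≤ c x x')
    (hcnd : ∀ (n : ℕ) (x : Fin n → X) (a : Fin n → ℝ), (∑ i, a i) = 0 →
      ∑ i, ∑ j, a i * a j * c (x i) (x j) ≤ 0)
    {ε : ℝ} (hε : 0 < ε) (α β : Measure X) [IsProbabilityMeasure α] [IsProbabilityMeasure β] :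
    0 ≤ sinkhornE c ε α β := by
  obtain ⟨u, hu, hu1, hαα⟩ := exists_otE_self_le (α := α) hc hsymm hnonneg hε
  obtain ⟨v, hv, hv1, hββ⟩ := exists_otE_self_le (α := β) hc hsymm hnonneg hε
  have hαβ := le_otE (α := α) (β := β) hc hε hu hv
  have hkpos := sum_mul_exp_neg_nonneg (d := fun x y ↦ c x y / ε) (fun x y ↦ by rw [hsymm])
    fun n x a ha ↦ by
      have := div_nonpos_of_nonpos_of_nonneg (hcnd n x a ha) hε.le
      simpa only [Finset.sum_div, mul_div_assoc] using this
  have hpd := two_mul_integral_prod_le (α := α) (β := β)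
    (k := fun x y ↦ Real.exp (-(c x y / ε))) (by fun_prop) (fun x y ↦ by rw [hsymm]) hkpos
    (Real.continuous_exp.comp hu) (Real.continuous_exp.comp hv)
  simp only [Function.comp_apply, ← Real.exp_add, ← sub_eq_add_neg] at hpd
  rw [hu1, hv1] at hpd
  have hbot : ∀ (μ : Measure X) [IsProbabilityMeasure μ], otE c ε μ μ ≠ ⊥ := fun μ _ ↦
    ne_bot_of_le_ne_bot (EReal.coe_ne_bot _)
      (le_otE hc hε (u := fun _ ↦ 0) (v := fun _ ↦ 0) continuous_const continuous_const)
  rw [sinkhornE_nonneg_iff hc hε]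
  have h1 := EReal.toReal_le_toReal hαα (hbot α) (EReal.coe_ne_top _)
  have h2 := EReal.toReal_le_toReal hββ (hbot β) (EReal.coe_ne_top _)
  have h3 := EReal.toReal_le_toReal hαβ (EReal.coe_ne_bot _)
    (ne_top_of_le_ne_top (EReal.coe_ne_top _) (otE_le_integral_prod hc ε))
  simp only [EReal.toReal_coe] at h1 h2 h3
  have hle := mul_le_mul_of_nonneg_left hpd hε.le
  linarith

/-- Letting the temperature tend to infinity, a nonnegative Sinkhorn divergence yields a
nonnegative energy distance. -/
lemma energy_nonneg_of_sinkhornE_nonneg (hc : Continuous fun p : X × X ↦ c p.1 p.2)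
    (hnonneg : ∀ x x', 0 ≤ c x x') (α β : Measure X) [IsProbabilityMeasure α]
    [IsProbabilityMeasure β] (h : ∀ ε : ℝ, 0 < ε → 0 ≤ sinkhornE c ε α β) :
    ∫ p, c p.1 p.2 ∂(α.prod α) + ∫ p, c p.1 p.2 ∂(β.prod β)
      ≤ 2 * ∫ p, c p.1 p.2 ∂(α.prod β) := by
  have hlow : ∀ (μ : Measure X) [IsProbabilityMeasure μ] {ε : ℝ}, 0 < ε →
      ∫ p, c p.1 p.2 ∂(μ.prod μ) - (∫ p, c p.1 p.2 ^ 2 ∂(μ.prod μ)) / ε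
        ≤ (otE c ε μ μ).toReal := by
    intro μ _ ε hε
    have h0 := le_otE (α := μ) (β := μ) hc hε (u := fun _ ↦ 0) (v := fun _ ↦ 0)
      continuous_const continuous_const
    have h1 := EReal.toReal_le_toReal h0 (EReal.coe_ne_bot _)
      (ne_top_of_le_ne_top (EReal.coe_ne_top _) (otE_le_integral_prod hc ε))
    rw [EReal.toReal_coe] at h1
    refine le_trans ?_ h1
    have hc1 : Integrable (fun p : X × X ↦ c p.1 p.2 / ε) (μ.prod μ) :=
      (hc.div_const ε).integrable_of_compactSpace
    have hc2 : Integrable (fun p : X × X ↦ c p.1 p.2 ^ 2 / ε ^ 2) (μ.prod μ) :=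
      ((hc.pow 2).div_const _).integrable_of_compactSpace
    have hle : ∫ p, Real.exp (0 + 0 - c p.1 p.2 / ε) ∂(μ.prod μ)
        ≤ ∫ p, (1 - c p.1 p.2 / ε + c p.1 p.2 ^ 2 / ε ^ 2) ∂(μ.prod μ) := by
      refine integral_mono (Continuous.integrable_of_compactSpace (by fun_prop))
        (((integrable_const 1).sub hc1).add hc2) fun p ↦ ?_
      have ht : 0 ≤ c p.1 p.2 / ε := div_nonneg (hnonneg _ _) hε.le
      simp only [← div_pow, add_zero, zero_sub]
      set t := c p.1 p.2 / ε
      rw [Real.exp_neg, inv_le_iff_one_le_mul₀ (Real.exp_pos t)]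
      have h2 := Real.add_one_le_exp t
      have h3 : 0 < 1 - t + t ^ 2 := by nlinarith [sq_nonneg (t - 1)]
      have h4 := mul_le_mul_of_nonneg_left h2 h3.le
      nlinarith [pow_nonneg ht 3]
    have hi : Integrable (fun p : X × X ↦ 1 - c p.1 p.2 / ε) (μ.prod μ) :=
      (integrable_const 1).sub hc1
    rw [integral_add hi hc2, integral_sub (integrable_const 1) hc1, integral_div,
      integral_div] at hle
    simp only [integral_const, probReal_univ, one_smul] at hle
    have h5 := mul_le_mul_of_nonneg_left hle hε.le
    have e : ε * (1 - (∫ p, c p.1 p.2 ∂(μ.prod μ)) / ε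
        + (∫ p, c p.1 p.2 ^ 2 ∂(μ.prod μ)) / ε ^ 2)
        = ε - ∫ p, c p.1 p.2 ∂(μ.prod μ) + (∫ p, c p.1 p.2 ^ 2 ∂(μ.prod μ)) / ε := by
      field_simp
    rw [e] at h5
    simp only [integral_zero]
    linarith
  set R := ∫ p, c p.1 p.2 ^ 2 ∂(α.prod α) + ∫ p, c p.1 p.2 ^ 2 ∂(β.prod β) with hR
  have hlim : Filter.Tendsto (fun ε : ℝ ↦ 2 * ∫ p, c p.1 p.2 ∂(α.prod β) + R / ε)
      Filter.atTop (nhds (2 * ∫ p, c p.1 p.2 ∂(α.prod β) + 0)) :=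
    tendsto_const_nhds.add (Filter.tendsto_id.const_div_atTop R)
  rw [add_zero] at hlim
  refine ge_of_tendsto hlim ?_
  filter_upwards [Filter.eventually_gt_atTop (0 : ℝ)] with ε hε
  have h1 := (sinkhornE_nonneg_iff hc hε α β).1 (h ε hε)
  have h2 := hlow α hε
  have h3 := hlow β hε
  have h4 : (otE c ε α β).toReal ≤ ∫ p, c p.1 p.2 ∂(α.prod β) := by
    have h0 := le_otE (α := α) (β := β) hc hε (u := fun _ ↦ 0) (v := fun _ ↦ 0)
      continuous_const continuous_const
    have := EReal.toReal_le_toReal (otE_le_integral_prod (α := α) (β := β) hc ε)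
      (ne_bot_of_le_ne_bot (EReal.coe_ne_bot _) h0) (EReal.coe_ne_top _)
    rwa [EReal.toReal_coe] at this
  rw [hR, add_div]
  linarith

lemma integral_prod_sum_dirac (hc : Continuous fun p : X × X ↦ c p.1 p.2) {n : ℕ}
    (x : Fin n → X) {a b : Fin n → ℝ} (ha : ∀ i, 0 ≤ a i) (hb : ∀ i, 0 ≤ b i) :
    ∫ p, c p.1 p.2 ∂((∑ i, ENNReal.ofReal (a i) • Measure.dirac (x i)).prod
        (∑ j, ENNReal.ofReal (b j) • Measure.dirac (x j)))
      = ∑ i, ∑ j, a i * b j * c (x i) (x j) := by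
  have hfin : ∀ w : Fin n → ℝ,
      IsFiniteMeasure (∑ i, ENNReal.ofReal (w i) • Measure.dirac (x i)) := fun w ↦
    ⟨by simp [Measure.finsetSum_apply, ENNReal.sum_lt_top]⟩
  have := hfin a
  have := hfin b
  have hint : ∀ {w : Fin n → ℝ} (_ : ∀ i, 0 ≤ w i) (f : X → ℝ),
      ∫ y, f y ∂(∑ i, ENNReal.ofReal (w i) • Measure.dirac (x i)) = ∑ i, w i * f (x i) := by
    intro w hw f
    rw [integral_finsetSum_measure fun i _ ↦
      (integrable_dirac (by simp)).smul_measure ENNReal.ofReal_ne_top]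
    simp [integral_smul_measure, ENNReal.toReal_ofReal, hw]
  rw [integral_prod _ hc.integrable_of_compactSpace]
  simp only [hint hb]
  rw [hint ha]
  simp only [Finset.mul_sum, mul_assoc]

lemma cnd_of_sinkhornE_nonneg (hc : Continuous fun p : X × X ↦ c p.1 p.2)
    (hsymm : ∀ x x', c x x' = c x' x) (hnonneg : ∀ x x', 0 ≤ c x x')
    (h : ∀ ε : ℝ, 0 < ε → ∀ (α β : Measure X) [IsProbabilityMeasure α] [IsProbabilityMeasure β],
      0 ≤ sinkhornE c ε α β)
    (n : ℕ) (x : Fin n → X) (a : Fin n → ℝ) (ha : ∑ i, a i = 0) :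
    ∑ i, ∑ j, a i * a j * c (x i) (x j) ≤ 0 := by
  set s := ∑ i, (a i)⁺ with hs
  have hs' : ∑ i, (a i)⁻ = s := by
    have : ∑ i, ((a i)⁺ - (a i)⁻) = 0 := by simpa only [posPart_sub_negPart] using ha
    rw [Finset.sum_sub_distrib] at this
    linarith
  have hs0 : 0 ≤ s := Finset.sum_nonneg fun i _ ↦ posPart_nonneg _
  rcases hs0.eq_or_lt with hs0 | hs0
  · have hp := (Finset.sum_eq_zero_iff_of_nonneg fun i _ ↦ posPart_nonneg (a i)).1 hs0.symm
    have hm := (Finset.sum_eq_zero_iff_of_nonneg fun i _ ↦ negPart_nonneg (a i)).1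
      (hs'.trans hs0.symm)
    have hz : ∀ i, a i = 0 := fun i ↦ by
      rw [← posPart_sub_negPart (a i), hp i (Finset.mem_univ i), hm i (Finset.mem_univ i), sub_zero]
    simp [hz]
  let p : Fin n → ℝ := fun i ↦ (a i)⁺ / s
  let m : Fin n → ℝ := fun i ↦ (a i)⁻ / s
  have hp : ∀ i, 0 ≤ p i := fun i ↦ div_nonneg (posPart_nonneg _) hs0.le
  have hm : ∀ i, 0 ≤ m i := fun i ↦ div_nonneg (negPart_nonneg _) hs0.le
  have hprob : ∀ {w : Fin n → ℝ}, (∀ i, 0 ≤ w i) → ∑ i, w i = 1 →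
      IsProbabilityMeasure (∑ i, ENNReal.ofReal (w i) • Measure.dirac (x i)) := fun hw hw1 ↦
    ⟨by simp [Measure.finsetSum_apply, ← ENNReal.ofReal_sum_of_nonneg fun i _ ↦ hw i, hw1]⟩
  have := hprob hp (by rw [← Finset.sum_div, div_self hs0.ne'])
  have := hprob hm (by rw [← Finset.sum_div, hs', div_self hs0.ne'])
  have key := energy_nonneg_of_sinkhornE_nonneg hc hnonneg
    (∑ i, ENNReal.ofReal (p i) • Measure.dirac (x i))
    (∑ i, ENNReal.ofReal (m i) • Measure.dirac (x i)) fun ε hε ↦ h ε hε _ _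
  rw [integral_prod_sum_dirac hc x hp hp, integral_prod_sum_dirac hc x hm hm,
    integral_prod_sum_dirac hc x hp hm] at key
  have hflip : ∑ i, ∑ j, p i * m j * c (x i) (x j) = ∑ i, ∑ j, m i * p j * c (x i) (x j) := by
    rw [Finset.sum_comm]
    refine Finset.sum_congr rfl fun i _ ↦ Finset.sum_congr rfl fun j _ ↦ ?_
    rw [hsymm (x j) (x i)]
    ring
  have hsum : ∑ i, ∑ j, a i * a j * c (x i) (x j) = s ^ 2 *
      (∑ i, ∑ j, p i * p j * c (x i) (x j) + ∑ i, ∑ j, m i * m j * c (x i) (x j)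
        - ∑ i, ∑ j, p i * m j * c (x i) (x j) - ∑ i, ∑ j, m i * p j * c (x i) (x j)) := by
    simp only [← Finset.sum_add_distrib, ← Finset.sum_sub_distrib, Finset.mul_sum]
    refine Finset.sum_congr rfl fun i _ ↦ Finset.sum_congr rfl fun j _ ↦ ?_
    have ei : a i = s * (p i - m i) := by
      rw [← sub_div, posPart_sub_negPart, mul_div_cancel₀ _ hs0.ne']
    have ej : a j = s * (p j - m j) := by
      rw [← sub_div, posPart_sub_negPart, mul_div_cancel₀ _ hs0.ne']
    rw [ei, ej]
    ring
  rw [hsum]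
  refine mul_nonpos_of_nonneg_of_nonpos (sq_nonneg s) ?_
  linarith

end SinkhornDivergence

/-- the Sinkhorn divergence is nonnegative for every temperature and every
pair of probability measures if and only if the cost is conditionally negative definite. -/
theorem sinkhorn_nonneg_iff_cnd
    {X : Type*} [MetricSpace X] [CompactSpace X] [MeasurableSpace X] [BorelSpace X]
    (c : X → X → ℝ) (hc : Continuous fun p : X × X => c p.1 p.2)
    (hsymm : ∀ x x', c x x' = c x' x) (hnonneg : ∀ x x', 0 ≤ c x x') :
    (∀ ε : ℝ, 0 < ε → ∀ (α β : Measure X) [IsProbabilityMeasure α] [IsProbabilityMeasure β],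
        0 ≤ sinkhornE c ε α β) ↔
      (∀ (n : ℕ) (x : Fin n → X) (a : Fin n → ℝ), (∑ i, a i) = 0 →
        ∑ i, ∑ j, a i * a j * c (x i) (x j) ≤ 0) := by
  exact ⟨fun h ↦ cnd_of_sinkhornE_nonneg hc hsymm hnonneg h,
    fun h ε hε α β _ _ ↦ sinkhornE_nonneg_of_cnd hc hsymm hnonneg h hε α β⟩
end

section
/- Let H_X and H_Y be separable real Hilbert spaces endowed with squared-norm costs, and let α, β be compactly supported Borel probability measures on H_X and H_Y. Then for every ε ≥ 0 the Sinkhorn–Gromov–Wasserstein divergence is nonnegative: SGW_ε(α,β) = GW_ε(α,β) − (1/2)·(GW_ε(α,α) + GW_ε(β,β)) ≥ 0. -/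
open MeasureTheory Classical

/-- Entropic Gromov–Wasserstein cost with squared-norm costs. -/
noncomputable def gwE {HX HY : Type*}
    [NormedAddCommGroup HX] [NormedAddCommGroup HY]
    [MeasurableSpace HX] [MeasurableSpace HY]
    (ε : ℝ) (α : Measure HX) (β : Measure HY) [SFinite β] : EReal :=
  ⨅ π ∈ {π : Measure (HX × HY) | π.map Prod.fst = α ∧ π.map Prod.snd = β},
    ((∫ p, ∫ q, (‖p.1 - q.1‖ ^ 2 - ‖p.2 - q.2‖ ^ 2) ^ 2 ∂π ∂π : ℝ) : EReal)
      + (ε : EReal) * klE π (α.prod β)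

open Filter Topology BoundedContinuousFunction in
lemma log_integral_exp_le {X : Type*} [TopologicalSpace X] [MeasurableSpace X]
    [OpensMeasurableSpace X] (ν : Measure X) [IsProbabilityMeasure ν] (f g : X →ᵇ ℝ) :
    Real.log (∫ x, Real.exp (f x) ∂ν) ≤ Real.log (∫ x, Real.exp (g x) ∂ν) + dist f g := by
  have hint : ∀ h : X →ᵇ ℝ, Integrable (fun x => Real.exp (h x)) ν := fun h => by
    refine Integrable.of_bound (h.continuous.rexp.measurable.aestronglyMeasurable) (Real.exp ‖h‖)
      (ae_of_all _ fun x => ?_)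
    rw [Real.norm_eq_abs, Real.abs_exp]
    exact Real.exp_le_exp.2 ((le_abs_self _).trans (h.norm_coe_le_norm x))
  have hle : ∫ x, Real.exp (f x) ∂ν ≤ Real.exp (dist f g) * ∫ x, Real.exp (g x) ∂ν := by
    rw [← integral_const_mul]
    refine integral_mono (hint f) ((hint g).const_mul _) fun x => ?_
    simp only
    rw [← Real.exp_add]
    refine Real.exp_le_exp.2 ?_
    have := (le_abs_self _).trans (dist_coe_le_dist (f := f) (g := g) x)
    linarith
  have h := Real.log_le_log (integral_exp_pos (hint f)) hle
  rwa [Real.log_mul (Real.exp_pos _).ne' (integral_exp_pos (hint g)).ne', Real.log_exp,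
    add_comm] at h

open Filter Topology BoundedContinuousFunction in
lemma lipschitzWith_log_integral_exp {X : Type*} [TopologicalSpace X] [MeasurableSpace X]
    [OpensMeasurableSpace X] (ν : Measure X) [IsProbabilityMeasure ν] :
    LipschitzWith 1 fun g : X →ᵇ ℝ => Real.log (∫ x, Real.exp (g x) ∂ν) := by
  refine LipschitzWith.of_dist_le_mul fun f g => ?_
  have h1 := log_integral_exp_le ν f g
  have h2 := log_integral_exp_le ν g f
  rw [dist_comm g f] at h2
  rw [Real.dist_eq, abs_le, NNReal.coe_one, one_mul]
  constructor <;> linarith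

open Filter Topology BoundedContinuousFunction in
/-- Existence of a symmetric Schrödinger potential for a continuous cost on a compact space. -/
theorem exists_schroedinger_potential {X : Type*} [TopologicalSpace X] [CompactSpace X]
    [MeasurableSpace X] [OpensMeasurableSpace X] (ν : Measure X) [IsProbabilityMeasure ν]
    (c : X → X → ℝ) (hc : Continuous fun p : X × X => c p.1 p.2) :
    ∃ f : X →ᵇ ℝ, ∀ x, f x = -Real.log (∫ y, Real.exp (f y + c x y) ∂ν) := by
  let C : X → (X →ᵇ ℝ) := fun x => mkOfCompact ((ContinuousMap.mk _ hc).curry x)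
  have hC : Continuous C :=
    (ContinuousMap.isometryEquivBoundedOfCompact X ℝ).continuous.comp
      (ContinuousMap.mk _ hc).curry.continuous
  have hCx : ∀ x y, C x y = c x y := fun _ _ => rfl
  let Λ : (X →ᵇ ℝ) → ℝ := fun g => Real.log (∫ x, Real.exp (g x) ∂ν)
  have hΛ : ∀ f g, dist (Λ f) (Λ g) ≤ dist f g := fun f g => by
    simpa using (lipschitzWith_log_integral_exp ν).dist_le_mul f g
  have hΛc : Continuous Λ := (lipschitzWith_log_integral_exp ν).continuous
  have hΛconst : ∀ k : ℝ, Λ (const X k) = k := fun k => by simp [Λ]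
  let T : (X →ᵇ ℝ) → (X →ᵇ ℝ) := fun f =>
    mkOfCompact ⟨fun x => -Λ (f + C x), (hΛc.comp (continuous_const.add hC)).neg⟩
  have hTx : ∀ f x, T f x = -Λ (f + C x) := fun _ _ => rfl
  have hT : ∀ f g, dist (T f) (T g) ≤ dist f g := fun f g => by
    refine (dist_le dist_nonneg).2 fun x => ?_
    rw [hTx, hTx, dist_neg_neg]
    exact (hΛ _ _).trans (by simp)
  have hTc : Continuous T :=
    (LipschitzWith.of_dist_le_mul (K := 1) fun f g => by simpa using hT f g).continuous
  obtain ⟨R, hR⟩ := (isCompact_range hC).isBounded.exists_norm_le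
  have hR' : ∀ x, ‖C x‖ ≤ R := fun x => hR _ ⟨x, rfl⟩
  let S : Set (X →ᵇ ℝ) :=
    {g | (∀ x, g x ∈ Set.Icc (-(2 * R)) (2 * R)) ∧ ∀ x x', dist (g x) (g x') ≤ dist (C x) (C x')}
  have hS : IsCompact S := by
    refine arzela_ascoli₂ _ (isCompact_Icc (a := -(2 * R)) (b := 2 * R)) S ?_
      (fun f x hf => hf.1 x) ?_
    · have hev : ∀ x, Continuous fun g : X →ᵇ ℝ => g x := fun x => continuous_eval_const x
      simp only [S, Set.ofPred_and, Set.ofPred_forall]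
      exact (isClosed_iInter fun x => isClosed_Icc.preimage (hev x)).inter
        (isClosed_iInter fun x => isClosed_iInter fun x' =>
          isClosed_le ((hev x).dist (hev x')) continuous_const)
    · intro x₀
      rw [Metric.equicontinuousAt_iff_right]
      intro ε hε
      filter_upwards [Metric.tendsto_nhds.1 (hC.tendsto x₀) ε hε] with x hx f
      exact (f.2.2 x₀ x).trans_lt (by rwa [dist_comm])
  have hfix : ∀ l : ℝ, 0 ≤ l → l < 1 → ∃ f ∈ S, l • T f = f := fun l hl0 hl1 => by
    have hcontr : ContractingWith l.toNNReal fun f => l • T f := by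
      refine ⟨by rwa [Real.toNNReal_lt_one], LipschitzWith.of_dist_le_mul fun f g => ?_⟩
      refine (dist_le (by positivity)).2 fun x => ?_
      rw [Real.coe_toNNReal _ hl0]
      change dist (l * T f x) (l * T g x) ≤ _
      rw [Real.dist_eq, ← mul_sub, abs_mul, abs_of_nonneg hl0, ← Real.dist_eq]
      exact mul_le_mul_of_nonneg_left ((dist_coe_le_dist x).trans (hT f g)) hl0
    obtain ⟨f, hf⟩ : ∃ f, l • T f = f := ⟨_, hcontr.fixedPoint_isFixedPt⟩
    have hfx : ∀ x, f x = -(l * Λ (f + C x)) := fun x => by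
      conv_lhs => rw [← hf]
      simp [hTx]
    refine ⟨f, ⟨?_, ?_⟩, hf⟩
    · have h1 : ∀ x, |f x - (-(l * Λ f))| ≤ R := fun x => by
        rw [hfx]
        have h2 : dist (Λ (f + C x)) (Λ f) ≤ R := (hΛ _ _).trans (by simpa using hR' x)
        rw [Real.dist_eq] at h2
        have : -(l * Λ (f + C x)) - -(l * Λ f) = -(l * (Λ (f + C x) - Λ f)) := by ring
        rw [this, abs_neg, abs_mul, abs_of_nonneg hl0]
        nlinarith [abs_nonneg (Λ (f + C x) - Λ f)]
      obtain ⟨x₀⟩ : Nonempty X := ν.nonempty_of_neZero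
      have hR0 : 0 ≤ R := (norm_nonneg _).trans (hR' x₀)
      have h2 : |Λ f - (-(l * Λ f))| ≤ R := by
        have := hΛ f (const X (-(l * Λ f)))
        rw [hΛconst, Real.dist_eq] at this
        refine this.trans ((dist_le hR0).2 fun x => ?_)
        simpa [Real.dist_eq] using h1 x
      have h3 : |l * Λ f| ≤ R := by
        have : Λ f - (-(l * Λ f)) = (1 + l) * Λ f := by ring
        rw [this, abs_mul, abs_of_nonneg (by linarith)] at h2
        rw [abs_mul, abs_of_nonneg hl0]
        nlinarith [abs_nonneg (Λ f)]
      intro x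
      have h1x := abs_le.1 (h1 x)
      have h3x := abs_le.1 h3
      constructor <;> linarith
    · intro x x'
      rw [hfx, hfx, dist_neg_neg, Real.dist_eq, ← mul_sub, abs_mul, abs_of_nonneg hl0]
      have h2 : dist (Λ (f + C x)) (Λ (f + C x')) ≤ dist (C x) (C x') :=
        (hΛ _ _).trans (by simp)
      rw [Real.dist_eq] at h2
      nlinarith [abs_nonneg (Λ (f + C x) - Λ (f + C x'))]
  have hl : ∀ n : ℕ, ∃ f ∈ S, ((n : ℝ) / (n + 1)) • T f = f := fun n =>
    hfix _ (by positivity) (by rw [div_lt_one (by positivity)]; linarith)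
  choose F hFS hF using hl
  obtain ⟨f, -, φ, hφ, hlim⟩ := hS.tendsto_subseq hFS
  refine ⟨f, fun x => ?_⟩
  have h1 : Tendsto (fun n => ((φ n : ℝ) / (φ n + 1)) • T (F (φ n))) atTop
      (𝓝 ((1 : ℝ) • T f)) :=
    ((tendsto_natCast_div_add_atTop (1 : ℝ)).comp hφ.tendsto_atTop).smul
      ((hTc.tendsto f).comp hlim)
  simp only [hF, one_smul] at h1
  have h2 : f = T f := tendsto_nhds_unique hlim h1
  conv_lhs => rw [h2]
  rfl

/-- A measure giving no mass to the complement of some compact set. -/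
def CompactlySupported {X : Type*} [TopologicalSpace X] [MeasurableSpace X] (μ : Measure X) :
    Prop :=
  ∃ K, IsCompact K ∧ μ Kᶜ = 0

lemma CompactlySupported.integrable {X E : Type*} [MetricSpace X] [MeasurableSpace X]
    [BorelSpace X] [NormedAddCommGroup E] {μ : Measure X} [IsFiniteMeasure μ]
    (hμ : CompactlySupported μ) {f : X → E} (hf : Continuous f) : Integrable f μ := by
  obtain ⟨K, hK, h0⟩ := hμ
  have h := hf.continuousOn.integrableOn_compact (μ := μ) hK
  rwa [IntegrableOn, Measure.restrict_eq_self_of_ae_mem (mem_ae_iff.2 h0)] at h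

lemma CompactlySupported.exists_bound {X : Type*} [TopologicalSpace X] [MeasurableSpace X]
    {μ : Measure X} (hμ : CompactlySupported μ) {f : X → ℝ} (hf : Continuous f) :
    ∃ R, 0 ≤ R ∧ ∀ᵐ x ∂μ, |f x| ≤ R := by
  obtain ⟨K, hK, h0⟩ := hμ
  obtain ⟨R, hR⟩ := hK.exists_bound_of_continuousOn hf.continuousOn
  refine ⟨max R 0, le_max_right _ _, ?_⟩
  filter_upwards [mem_ae_iff.2 h0] with x hx
  exact (hR x hx).trans (le_max_left _ _)

lemma CompactlySupported.of_marginals {X Y : Type*} [TopologicalSpace X] [MeasurableSpace X]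
    [TopologicalSpace Y] [MeasurableSpace Y] {π : Measure (X × Y)}
    (h₁ : CompactlySupported (π.map Prod.fst)) (h₂ : CompactlySupported (π.map Prod.snd)) :
    CompactlySupported π := by
  obtain ⟨K, hK, hK0⟩ := h₁
  obtain ⟨L, hL, hL0⟩ := h₂
  refine ⟨K ×ˢ L, hK.prod hL, ?_⟩
  have hK' : ∀ᵐ p ∂π, p.1 ∈ K := ae_of_ae_map measurable_fst.aemeasurable (mem_ae_iff.2 hK0)
  have hL' : ∀ᵐ p ∂π, p.2 ∈ L := ae_of_ae_map measurable_snd.aemeasurable (mem_ae_iff.2 hL0)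
  exact mem_ae_iff.1 (hK'.and hL')

lemma CompactlySupported.prod {X Y : Type*} [TopologicalSpace X] [MeasurableSpace X]
    [TopologicalSpace Y] [MeasurableSpace Y] {μ : Measure X} {ν : Measure Y}
    [IsProbabilityMeasure μ] [IsProbabilityMeasure ν]
    (hμ : CompactlySupported μ) (hν : CompactlySupported ν) :
    CompactlySupported (μ.prod ν) := by
  refine .of_marginals ?_ ?_
  · simpa using hμ
  · simpa using hν

section Kernel

variable {X Y ι : Type*} [Fintype ι]
  [MetricSpace X] [SecondCountableTopology X] [MeasurableSpace X] [BorelSpace X]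
  [MetricSpace Y] [SecondCountableTopology Y] [MeasurableSpace Y] [BorelSpace Y]

lemma hasSum_integral_mul_exp_sum {μ : Measure X} {ν : Measure Y}
    [IsProbabilityMeasure μ] [IsProbabilityMeasure ν]
    (hμ : CompactlySupported μ) (hν : CompactlySupported ν) {u : X → ℝ} {v : Y → ℝ}
    (hu : Continuous u) (hv : Continuous v) {Φ : ι → X → ℝ} {Ψ : ι → Y → ℝ}
    (hΦ : ∀ i, Continuous (Φ i)) (hΨ : ∀ i, Continuous (Ψ i)) :
    HasSum (fun k : ℕ => (k.factorial : ℝ)⁻¹ * ∑ p : Fin k → ι,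
        (∫ x, u x * ∏ j, Φ (p j) x ∂μ) * ∫ y, v y * ∏ j, Ψ (p j) y ∂ν)
      (∫ z, u z.1 * v z.2 * Real.exp (∑ i, Φ i z.1 * Ψ i z.2) ∂(μ.prod ν)) := by
  have hμν := hμ.prod hν
  let s : X × Y → ℝ := fun z => ∑ i, Φ i z.1 * Ψ i z.2
  have hs : Continuous s := by fun_prop
  let F : ℕ → X × Y → ℝ := fun k z => u z.1 * v z.2 * (s z ^ k / k.factorial)
  have hF : ∀ k, Integrable (F k) (μ.prod ν) := fun k => hμν.integrable (by fun_prop)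
  obtain ⟨R, hR0, hR⟩ := hμν.exists_bound hs
  have hsum : Summable fun k => ∫ z, ‖F k z‖ ∂(μ.prod ν) := by
    have hb := (Real.summable_pow_div_factorial R).mul_left (∫ z, ‖u z.1 * v z.2‖ ∂(μ.prod ν))
    refine hb.of_nonneg_of_le (fun k => integral_nonneg fun z => norm_nonneg _) fun k => ?_
    rw [← integral_mul_const]
    refine integral_mono_ae (hF k).norm ((hμν.integrable (by fun_prop)).mul_const _) ?_
    filter_upwards [hR] with z hz
    simp only [F]
    rw [norm_mul, norm_div, norm_pow, Real.norm_natCast, Real.norm_eq_abs (s z)]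
    gcongr
  have h := hasSum_integral_of_summable_integral_norm hF hsum
  have hexp : ∀ z, ∑' k, F k z = u z.1 * v z.2 * Real.exp (s z) := fun z => by
    rw [tsum_mul_left, Real.exp_eq_exp_ℝ, NormedSpace.exp_eq_tsum_div]
  simp only [hexp] at h
  refine (congrArg (HasSum · _) (funext fun k => ?_)).mpr h
  simp only [F, s]
  simp_rw [Fintype.sum_pow, Finset.prod_mul_distrib, Finset.sum_div, Finset.mul_sum]
  rw [integral_finsetSum _ fun p _ => hμν.integrable (by fun_prop)]
  refine Finset.sum_congr rfl fun p _ => ?_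
  rw [← integral_prod_mul, ← integral_const_mul]
  refine integral_congr_ae (ae_of_all _ fun z => ?_)
  simp only
  ring

lemma integral_mul_exp_sum_le {μ : Measure X} {ν : Measure Y}
    [IsProbabilityMeasure μ] [IsProbabilityMeasure ν]
    (hμ : CompactlySupported μ) (hν : CompactlySupported ν) {u : X → ℝ} {v : Y → ℝ}
    (hu : Continuous u) (hv : Continuous v) {Φ : ι → X → ℝ} {Ψ : ι → Y → ℝ}
    (hΦ : ∀ i, Continuous (Φ i)) (hΨ : ∀ i, Continuous (Ψ i)) :
    2 * ∫ z, u z.1 * v z.2 * Real.exp (∑ i, Φ i z.1 * Ψ i z.2) ∂(μ.prod ν) ≤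
      (∫ z, u z.1 * u z.2 * Real.exp (∑ i, Φ i z.1 * Φ i z.2) ∂(μ.prod μ)) +
      ∫ z, v z.1 * v z.2 * Real.exp (∑ i, Ψ i z.1 * Ψ i z.2) ∂(ν.prod ν) := by
  refine hasSum_le (fun k => ?_) ((hasSum_integral_mul_exp_sum hμ hν hu hv hΦ hΨ).mul_left 2)
    ((hasSum_integral_mul_exp_sum hμ hμ hu hu hΦ hΦ).add
      (hasSum_integral_mul_exp_sum hν hν hv hv hΨ hΨ))
  rw [← mul_add, mul_left_comm, Finset.mul_sum, ← Finset.sum_add_distrib]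
  refine mul_le_mul_of_nonneg_left (Finset.sum_le_sum fun p _ => ?_) (by positivity)
  nlinarith [sq_nonneg ((∫ x, u x * ∏ j, Φ (p j) x ∂μ) - ∫ y, v y * ∏ j, Ψ (p j) y ∂ν)]

end Kernel

/-- A symmetric potential, defined on the whole space, for a compactly supported measure. -/
lemma exists_continuous_schroedinger_potential {X : Type*} [MetricSpace X]
    [MeasurableSpace X] [BorelSpace X] {μ : Measure X} [IsProbabilityMeasure μ]
    (hμ : CompactlySupported μ) {c : X → X → ℝ} (hc : Continuous fun p : X × X => c p.1 p.2) :
    ∃ f : X → ℝ, Continuous f ∧ ∀ x, ∫ y, Real.exp (f x + f y + c x y) ∂μ = 1 := by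
  obtain ⟨K, hK, h0⟩ := id hμ
  have : CompactSpace K := isCompact_iff_compactSpace.1 hK
  have hKm := hK.measurableSet
  have hrestr : μ.restrict K = μ := Measure.restrict_eq_self_of_ae_mem (mem_ae_iff.2 h0)
  let ν : Measure K := μ.comap Subtype.val
  have hν : IsProbabilityMeasure ν := ⟨by
    simp only [ν]
    rw [Measure.comap_apply _ Subtype.val_injective
      (fun s hs => hKm.subtype_image hs) _ MeasurableSet.univ, Set.image_univ, Subtype.range_coe]
    exact (prob_compl_eq_zero_iff hKm).1 h0⟩
  obtain ⟨f, hf⟩ := exists_schroedinger_potential ν (fun x y : K => c x y) (by fun_prop)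
  let I : X → ℝ := fun x => ∫ y : K, Real.exp (f y + c x y) ∂ν
  have hint : ∀ x, Integrable (fun y : K => Real.exp (f y + c x y)) ν := fun x => by
    have hcs : CompactlySupported ν := ⟨Set.univ, isCompact_univ, by simp⟩
    exact hcs.integrable (by fun_prop)
  have hI0 : ∀ x, 0 < I x := fun x => integral_exp_pos (hint x)
  have hI : Continuous fun x => Real.log (I x) := by
    let cK : C(X × K, ℝ) := ⟨fun p => c p.1 p.2, by fun_prop⟩
    exact (lipschitzWith_log_integral_exp ν).continuous.comp (continuous_const.add
      ((ContinuousMap.isometryEquivBoundedOfCompact K ℝ).continuous.comp cK.curry.continuous))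
  refine ⟨fun x => -Real.log (I x), hI.neg, fun x => ?_⟩
  have h1 : ∫ y, Real.exp (-Real.log (I y) + c x y) ∂μ = I x := by
    rw [← hrestr, ← integral_subtype_comap hKm]
    refine integral_congr_ae (ae_of_all _ fun y => ?_)
    simp only [hf y, I, ν]
  simp_rw [add_assoc, Real.exp_add (-Real.log (I x))]
  rw [integral_const_mul, h1, Real.exp_neg, Real.exp_log (hI0 x), inv_mul_cancel₀ (hI0 x).ne']

lemma integral_llr_nonneg {Z : Type*} [MeasurableSpace Z] {π ρ : Measure Z}
    [IsProbabilityMeasure π] [IsProbabilityMeasure ρ] (hπρ : π ≪ ρ) :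
    0 ≤ ∫ z, llr π ρ z ∂π := by
  rw [← InformationTheory.toReal_klDiv_of_measure_eq hπρ (by simp)]
  exact ENNReal.toReal_nonneg

/-- The easy half of the Donsker–Varadhan variational formula. -/
lemma integral_sub_log_integral_exp_le {Z : Type*} [MeasurableSpace Z] {π ρ : Measure Z}
    [IsProbabilityMeasure π] [IsProbabilityMeasure ρ] (hπρ : π ≪ ρ)
    (hint : Integrable (llr π ρ) π) {h : Z → ℝ} (hh : Integrable h π)
    (hexp : Integrable (fun z => Real.exp (h z)) ρ) :
    ∫ z, h z ∂π - Real.log (∫ z, Real.exp (h z) ∂ρ) ≤ ∫ z, llr π ρ z ∂π := by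
  have := isProbabilityMeasure_tilted hexp
  have h1 := integral_llr_nonneg (hπρ.trans (absolutelyContinuous_tilted hexp))
  rw [integral_llr_tilted_right hπρ hh hexp hint] at h1
  linarith

lemma isProbabilityMeasure_of_map {X Y : Type*} [MeasurableSpace X] [MeasurableSpace Y]
    {π : Measure (X × Y)} {μ : Measure X} [IsProbabilityMeasure μ] (h : π.map Prod.fst = μ) :
    IsProbabilityMeasure π :=
  ⟨by rw [← Set.preimage_univ (f := Prod.fst), ← Measure.map_apply measurable_fst .univ, h,
    measure_univ]⟩

lemma integral_comp_fst {X Y : Type*} [MetricSpace X] [MeasurableSpace X] [BorelSpace X]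
    [MeasurableSpace Y] {π : Measure (X × Y)} {μ : Measure X} (h : π.map Prod.fst = μ)
    {f : X → ℝ} (hf : Continuous f) : ∫ p, f p.1 ∂π = ∫ x, f x ∂μ := by
  rw [← h, integral_map measurable_fst.aemeasurable hf.aestronglyMeasurable]

lemma integral_comp_snd {X Y : Type*} [MeasurableSpace X] [MetricSpace Y] [MeasurableSpace Y]
    [BorelSpace Y] {π : Measure (X × Y)} {ν : Measure Y} (h : π.map Prod.snd = ν)
    {f : Y → ℝ} (hf : Continuous f) : ∫ p, f p.2 ∂π = ∫ y, f y ∂ν := by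
  rw [← h, integral_map measurable_snd.aemeasurable hf.aestronglyMeasurable]

section Sinkhorn

variable {X Y ι : Type*} [Fintype ι]
  [MetricSpace X] [SecondCountableTopology X] [MeasurableSpace X] [BorelSpace X]
  [MetricSpace Y] [SecondCountableTopology Y] [MeasurableSpace Y] [BorelSpace Y]

/-- The coupling of a measure with itself built from a symmetric Schrödinger potential. -/
lemma exists_coupling_of_potential {μ : Measure X} [IsProbabilityMeasure μ]
    (hμ : CompactlySupported μ) {c : X → X → ℝ} (hc : Continuous fun p : X × X => c p.1 p.2)
    (hsymm : ∀ x y, c x y = c y x) {f : X → ℝ} (hf : Continuous f)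
    (hf1 : ∀ x, ∫ y, Real.exp (f x + f y + c x y) ∂μ = 1) :
    ∃ γ : Measure (X × X), γ.map Prod.fst = μ ∧ γ.map Prod.snd = μ ∧ γ ≪ μ.prod μ ∧
      Integrable (llr γ (μ.prod μ)) γ ∧
      ∫ z, llr γ (μ.prod μ) z ∂γ = 2 * ∫ x, f x ∂μ + ∫ z, c z.1 z.2 ∂γ := by
  have hμμ := hμ.prod hμ
  let h : X × X → ℝ := fun z => f z.1 + f z.2 + c z.1 z.2
  have hh : Continuous h := by fun_prop
  have hexp : Integrable (fun z => Real.exp (h z)) (μ.prod μ) := hμμ.integrable (by fun_prop)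
  have h1 : ∫ z, Real.exp (h z) ∂(μ.prod μ) = 1 := by
    rw [integral_prod _ hexp]
    simp [h, hf1]
  have hl : ∀ x, ∫⁻ y, ENNReal.ofReal (Real.exp (h (x, y))) ∂μ = 1 := fun x => by
    rw [← ofReal_integral_eq_lintegral_ofReal (hμ.integrable (by fun_prop))
      (ae_of_all _ fun y => (Real.exp_pos _).le), hf1, ENNReal.ofReal_one]
  have hswap : ∀ x y, h (x, y) = h (y, x) := fun x y => by
    simp only [h]; rw [hsymm x y]; ring
  have hm : Measurable fun z => ENNReal.ofReal (Real.exp (h z)) := by fun_prop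
  let γ := (μ.prod μ).tilted h
  have hγ : γ = (μ.prod μ).withDensity fun z => ENNReal.ofReal (Real.exp (h z)) := by
    simp only [γ, Measure.tilted, h1, div_one]
  have hfst : γ.map Prod.fst = μ := by
    ext s hs
    rw [Measure.map_apply measurable_fst hs, hγ, withDensity_apply _ (measurable_fst hs),
      ← Set.prod_univ, ← Measure.prod_restrict, lintegral_prod _ hm.aemeasurable]
    simp [hl]
  have hsnd : γ.map Prod.snd = μ := by
    ext s hs
    rw [Measure.map_apply measurable_snd hs, hγ, withDensity_apply _ (measurable_snd hs),
      ← Set.univ_prod, ← Measure.prod_restrict, lintegral_prod_symm _ hm.aemeasurable]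
    simp only [hswap _ _, Measure.restrict_univ]
    simp only [hl]
    simp
  have hac : γ ≪ μ.prod μ := tilted_absolutelyContinuous _ _
  have := isProbabilityMeasure_of_map hfst
  have hγc : CompactlySupported γ := .of_marginals (hfst ▸ hμ) (hsnd ▸ hμ)
  have hllr : llr γ (μ.prod μ) =ᵐ[γ] h := by
    refine hac.ae_le ?_
    filter_upwards [log_rnDeriv_tilted_left_self hexp] with z hz
    rw [llr, hz, h1, Real.log_one, sub_zero]
  refine ⟨γ, hfst, hsnd, hac, (integrable_congr hllr).2 (hγc.integrable hh), ?_⟩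
  rw [integral_congr_ae hllr]
  simp only [h]
  rw [integral_add (hγc.integrable (by fun_prop)) (hγc.integrable hc),
    integral_add (hγc.integrable (by fun_prop)) (hγc.integrable (by fun_prop)),
    integral_comp_fst hfst hf, integral_comp_snd hsnd hf]
  ring

/-- Nonnegativity of the Sinkhorn divergence for a positive definite kernel of finite rank. -/
theorem exists_couplings_entropic_le {μ : Measure X} {ν : Measure Y}
    [IsProbabilityMeasure μ] [IsProbabilityMeasure ν]
    (hμ : CompactlySupported μ) (hν : CompactlySupported ν) {Φ : ι → X → ℝ} {Ψ : ι → Y → ℝ}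
    (hΦ : ∀ i, Continuous (Φ i)) (hΨ : ∀ i, Continuous (Ψ i)) {π : Measure (X × Y)}
    (hπ₁ : π.map Prod.fst = μ) (hπ₂ : π.map Prod.snd = ν) (hac : π ≪ μ.prod ν)
    (hint : Integrable (llr π (μ.prod ν)) π) :
    ∃ (γ : Measure (X × X)) (γ' : Measure (Y × Y)),
      (γ.map Prod.fst = μ ∧ γ.map Prod.snd = μ ∧ γ ≪ μ.prod μ ∧
        Integrable (llr γ (μ.prod μ)) γ) ∧
      (γ'.map Prod.fst = ν ∧ γ'.map Prod.snd = ν ∧ γ' ≪ ν.prod ν ∧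
        Integrable (llr γ' (ν.prod ν)) γ') ∧
      (∫ z, llr γ (μ.prod μ) z ∂γ - ∫ z, ∑ i, Φ i z.1 * Φ i z.2 ∂γ) +
        (∫ z, llr γ' (ν.prod ν) z ∂γ' - ∫ z, ∑ i, Ψ i z.1 * Ψ i z.2 ∂γ') ≤
      2 * (∫ z, llr π (μ.prod ν) z ∂π - ∫ z, ∑ i, Φ i z.1 * Ψ i z.2 ∂π) := by
  obtain ⟨f, hf, hf1⟩ := exists_continuous_schroedinger_potential hμ
    (c := fun x y => ∑ i, Φ i x * Φ i y) (by fun_prop)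
  obtain ⟨g, hg, hg1⟩ := exists_continuous_schroedinger_potential hν
    (c := fun x y => ∑ i, Ψ i x * Ψ i y) (by fun_prop)
  obtain ⟨γ, h₁, h₂, h₃, h₄, h₅⟩ := exists_coupling_of_potential hμ
    (c := fun x y => ∑ i, Φ i x * Φ i y) (by fun_prop) (fun x y => by simp only [mul_comm]) hf hf1
  obtain ⟨γ', h₁', h₂', h₃', h₄', h₅'⟩ := exists_coupling_of_potential hν
    (c := fun x y => ∑ i, Ψ i x * Ψ i y) (by fun_prop) (fun x y => by simp only [mul_comm]) hg hg1
  refine ⟨γ, γ', ⟨h₁, h₂, h₃, h₄⟩, ⟨h₁', h₂', h₃', h₄'⟩, ?_⟩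
  rw [h₅, h₅']
  have := isProbabilityMeasure_of_map hπ₁
  have hπ : CompactlySupported π := .of_marginals (hπ₁ ▸ hμ) (hπ₂ ▸ hν)
  have hdual := integral_sub_log_integral_exp_le hac hint
    (h := fun z => f z.1 + g z.2 + ∑ i, Φ i z.1 * Ψ i z.2)
    (hπ.integrable (by fun_prop)) ((hμ.prod hν).integrable (by fun_prop))
  rw [integral_add (hπ.integrable (by fun_prop)) (hπ.integrable (by fun_prop)),
    integral_add (hπ.integrable (by fun_prop)) (hπ.integrable (by fun_prop)),
    integral_comp_fst hπ₁ hf, integral_comp_snd hπ₂ hg] at hdual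
  have hle : ∫ z, Real.exp (f z.1 + g z.2 + ∑ i, Φ i z.1 * Ψ i z.2) ∂(μ.prod ν) ≤ 1 := by
    have h := integral_mul_exp_sum_le hμ hν hf.rexp hg.rexp hΦ hΨ
    simp only [← Real.exp_add] at h
    rw [integral_prod (fun z : X × X => Real.exp (f z.1 + f z.2 + ∑ i, Φ i z.1 * Φ i z.2))
        ((hμ.prod hμ).integrable (by fun_prop)),
      integral_prod (fun z : Y × Y => Real.exp (g z.1 + g z.2 + ∑ i, Ψ i z.1 * Ψ i z.2))
        ((hν.prod hν).integrable (by fun_prop))] at h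
    simp only [hf1, hg1, integral_const, probReal_univ, smul_eq_mul, mul_one] at h
    linarith
  have hlog := Real.log_nonpos (integral_nonneg fun z => (Real.exp_pos _).le) hle
  linarith

end Sinkhorn

section Factorization

variable {ι κ : Type*} [Fintype ι] [Fintype κ]

lemma sum_sq_sum_mul_comm (A : κ → ι → ℝ) :
    ∑ i, ∑ i', (∑ k, A k i * A k i') ^ 2 = ∑ k, ∑ l, (∑ i, A k i * A l i) ^ 2 := by
  simp only [sq, Finset.sum_mul_sum]
  have h1 : ∀ i : ι, ∑ i', ∑ k, ∑ l, A k i * A k i' * (A l i * A l i') =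
      ∑ k, ∑ l, ∑ i', A k i * A k i' * (A l i * A l i') := fun i => by
    rw [Finset.sum_comm]
    exact Finset.sum_congr rfl fun k _ => Finset.sum_comm
  simp only [h1]
  rw [Finset.sum_comm]
  refine Finset.sum_congr rfl fun k _ => ?_
  rw [Finset.sum_comm]
  refine Finset.sum_congr rfl fun l _ => Finset.sum_congr rfl fun i _ =>
    Finset.sum_congr rfl fun i' _ => ?_
  ring

/-- A balanced factorization `M = Aᵀ B` coming from the singular value decomposition. -/
lemma exists_balanced_factorization (M : Matrix ι κ ℝ) :
    ∃ (A : κ → ι → ℝ) (B : κ → κ → ℝ), (∀ i j, ∑ k, A k i * B k j = M i j) ∧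
      ∑ i, ∑ i', (∑ k, A k i * A k i') ^ 2 = ∑ i, ∑ j, M i j ^ 2 ∧
      ∑ j, ∑ j', (∑ k, B k j * B k j') ^ 2 = ∑ i, ∑ j, M i j ^ 2 := by
  have hS : (M.transpose * M).IsHermitian := by
    simpa using Matrix.isHermitian_conjTranspose_mul_self M
  have hpos : (M.transpose * M).PosSemidef := by
    simpa using Matrix.posSemidef_conjTranspose_mul_self M
  let U : Matrix κ κ ℝ := hS.eigenvectorUnitary
  let lam : κ → ℝ := hS.eigenvalues
  have hlam : ∀ k, 0 ≤ lam k := fun k => hpos.eigenvalues_nonneg k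
  have hUU : U.transpose * U = 1 := by
    simpa [Matrix.star_eq_conjTranspose] using Unitary.coe_star_mul_self hS.eigenvectorUnitary
  have hUU' : U * U.transpose = 1 := mul_eq_one_comm.1 hUU
  have hspec : M.transpose * M = U * Matrix.diagonal lam * U.transpose := by
    have h := hS.spectral_theorem
    rw [Unitary.conjStarAlgAut_apply] at h
    simpa [Matrix.star_eq_conjTranspose, Function.comp_def] using h
  let W : Matrix ι κ ℝ := M * U
  have hW : W.transpose * W = Matrix.diagonal lam := by
    simp only [W, Matrix.transpose_mul]
    calc U.transpose * M.transpose * (M * U) = U.transpose * (M.transpose * M) * U := by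
          simp only [Matrix.mul_assoc]
      _ = (U.transpose * U) * Matrix.diagonal lam * (U.transpose * U) := by
          rw [hspec]; simp only [Matrix.mul_assoc]
      _ = _ := by rw [hUU, Matrix.one_mul, Matrix.mul_one]
  have hM : M = W * U.transpose := by simp only [W, Matrix.mul_assoc, hUU', Matrix.mul_one]
  have hWe : ∀ k l, ∑ i, W i k * W i l = if k = l then lam k else 0 := fun k l => by
    have := congrFun₂ hW k l
    simpa [Matrix.mul_apply, Matrix.diagonal_apply] using this
  have hUe : ∀ k l, ∑ i, U i k * U i l = if k = l then 1 else 0 := fun k l => by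
    have := congrFun₂ hUU k l
    simpa [Matrix.mul_apply, Matrix.one_apply] using this
  have hMe : ∀ i j, M i j = ∑ k, W i k * U j k := fun i j => by
    conv_lhs => rw [hM]
    simp [Matrix.mul_apply]
  have hMsq : ∑ i, ∑ j, M i j ^ 2 = ∑ k, lam k := by
    have h1 : ∑ i, ∑ j, M i j ^ 2 = (M.transpose * M).trace := by
      simp only [Matrix.trace, Matrix.diag, Matrix.mul_apply, Matrix.transpose_apply, ← sq]
      exact Finset.sum_comm
    rw [h1, hspec, Matrix.mul_assoc, Matrix.trace_mul_comm, Matrix.mul_assoc, hUU, Matrix.mul_one,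
      Matrix.trace_diagonal]
  let s : κ → ℝ := fun k => √√(lam k)
  have hs4 : ∀ k, s k ^ 4 = lam k := fun k => by
    simp only [s]
    rw [show (4 : ℕ) = 2 * 2 from rfl, pow_mul, Real.sq_sqrt (Real.sqrt_nonneg _),
      Real.sq_sqrt (hlam k)]
  refine ⟨fun k i => W i k / s k, fun k j => U j k * s k, fun i j => ?_, ?_, ?_⟩
  · rw [hMe]
    refine Finset.sum_congr rfl fun k _ => ?_
    by_cases h : s k = 0
    · have h0 : ∑ i, W i k * W i k = 0 := by rw [hWe, if_pos rfl, ← hs4, h]; norm_num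
      have hi := (Finset.sum_eq_zero_iff_of_nonneg fun i _ => mul_self_nonneg (W i k)).1 h0 i
        (Finset.mem_univ i)
      simp [mul_self_eq_zero.1 hi]
    · field_simp
  · rw [sum_sq_sum_mul_comm, hMsq]
    refine Finset.sum_congr rfl fun k _ => ?_
    have h1 : ∀ l, ∑ i, W i k / s k * (W i l / s l) = if k = l then s k ^ 2 else 0 := fun l => by
      simp only [div_mul_div_comm, ← Finset.sum_div, hWe]
      split_ifs with h
      · subst h
        by_cases h : s k = 0
        · simp [h]
        · rw [← hs4]; field_simp
      · simp
    simp only [h1]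
    simp [ite_pow, ← pow_mul, hs4]
  · rw [sum_sq_sum_mul_comm, hMsq]
    refine Finset.sum_congr rfl fun k _ => ?_
    have h1 : ∀ l, ∑ i, U i k * s k * (U i l * s l) = if k = l then s k ^ 2 else 0 := fun l => by
      have hcomm : ∀ i, U i k * s k * (U i l * s l) = U i k * U i l * (s k * s l) :=
        fun i => by ring
      simp only [hcomm, ← Finset.sum_mul, hUe]
      split_ifs with h
      · subst h; ring
      · simp
    simp only [h1]
    simp [ite_pow, ← pow_mul, hs4]

end Factorization

lemma two_mul_sum_sum_mul_le {ι : Type*} [Fintype ι] (C G : ι → ι → ℝ) :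
    2 * ∑ i, ∑ j, C i j * G i j ≤ ∑ i, ∑ j, C i j ^ 2 + ∑ i, ∑ j, G i j ^ 2 := by
  simp only [Finset.mul_sum, ← Finset.sum_add_distrib]
  exact Finset.sum_le_sum fun i _ => Finset.sum_le_sum fun j _ => by
    nlinarith [sq_nonneg (C i j - G i j)]

lemma integral_sum_sum_mul {X Y ι κ : Type*} [Fintype ι] [Fintype κ]
    [MetricSpace X] [MeasurableSpace X] [BorelSpace X]
    [MetricSpace Y] [SecondCountableTopology Y] [MeasurableSpace Y] [BorelSpace Y]
    {π : Measure (X × Y)} [IsFiniteMeasure π] (hπ : CompactlySupported π)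
    {φ : ι → X → ℝ} {ψ : κ → Y → ℝ} (hφ : ∀ i, Continuous (φ i)) (hψ : ∀ j, Continuous (ψ j))
    (c : ι → κ → ℝ) :
    ∫ z, ∑ i, ∑ j, c i j * (φ i z.1 * ψ j z.2) ∂π =
      ∑ i, ∑ j, c i j * ∫ z, φ i z.1 * ψ j z.2 ∂π := by
  rw [integral_finsetSum _ fun i _ => hπ.integrable (by fun_prop)]
  refine Finset.sum_congr rfl fun i _ => ?_
  rw [integral_finsetSum _ fun j _ => hπ.integrable (by fun_prop)]
  exact Finset.sum_congr rfl fun j _ => integral_const_mul _ _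

/-- Integral of a finite rank kernel indexed by an option type, split into its parts. -/
lemma integral_option_sum_mul {X Y ι κ : Type*} [Fintype ι] [Fintype κ]
    [MetricSpace X] [MeasurableSpace X] [BorelSpace X]
    [MetricSpace Y] [SecondCountableTopology Y] [MeasurableSpace Y] [BorelSpace Y] {π : Measure (X × Y)} [IsFiniteMeasure π]
    (hπ : CompactlySupported π) {σ : Type*} [Fintype σ] {a : X → ℝ} {b : Y → ℝ}
    {φ : ι → X → ℝ} {ψ : κ → Y → ℝ} (ha : Continuous a) (hb : Continuous b)
    (hφ : ∀ i, Continuous (φ i)) (hψ : ∀ j, Continuous (ψ j))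
    (A : σ → ι → ℝ) (B : σ → κ → ℝ) (r t : ℝ) :
    ∫ z, ∑ k : Option σ, (k.elim (r * a z.1) fun k => t * ∑ i, A k i * φ i z.1) *
        (k.elim (r * b z.2) fun k => t * ∑ j, B k j * ψ j z.2) ∂π =
      r ^ 2 * ∫ z, a z.1 * b z.2 ∂π +
        t ^ 2 * ∑ i, ∑ j, (∑ k, A k i * B k j) * ∫ z, φ i z.1 * ψ j z.2 ∂π := by
  rw [← integral_sum_sum_mul hπ hφ hψ, ← integral_const_mul, ← integral_const_mul,
    ← integral_add (hπ.integrable (by fun_prop)) (hπ.integrable (by fun_prop))]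
  refine integral_congr_ae (ae_of_all _ fun z => ?_)
  simp only [Fintype.sum_option, Option.elim]
  have h : ∀ k, t * (∑ i, A k i * φ i z.1) * (t * ∑ j, B k j * ψ j z.2) =
      ∑ i, ∑ j, t ^ 2 * (A k i * B k j * (φ i z.1 * ψ j z.2)) := fun k => by
    rw [mul_mul_mul_comm, Finset.sum_mul_sum, Finset.mul_sum]
    refine Finset.sum_congr rfl fun i _ => ?_
    rw [Finset.mul_sum]
    exact Finset.sum_congr rfl fun j _ => by ring
  simp only [h]
  rw [Finset.sum_comm, Finset.mul_sum]
  congr 1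
  · ring
  refine Finset.sum_congr rfl fun i _ => ?_
  rw [Finset.sum_comm, Finset.mul_sum]
  refine Finset.sum_congr rfl fun j _ => ?_
  rw [Finset.sum_mul, Finset.mul_sum]

section Quadratic

variable {X Y ι κ : Type*} [Fintype ι] [Fintype κ]
  [MetricSpace X] [SecondCountableTopology X] [MeasurableSpace X] [BorelSpace X]
  [MetricSpace Y] [SecondCountableTopology Y] [MeasurableSpace Y] [BorelSpace Y]

/-- The quadratic part of the Gromov–Wasserstein objective, for kernels of finite rank. -/
theorem exists_couplings_quadratic_le {μ : Measure X} {ν : Measure Y}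
    [IsProbabilityMeasure μ] [IsProbabilityMeasure ν]
    (hμ : CompactlySupported μ) (hν : CompactlySupported ν) {ε : ℝ} (hε : 0 < ε)
    {a : X → ℝ} {b : Y → ℝ} {φ : ι → X → ℝ} {ψ : κ → Y → ℝ}
    (ha : Continuous a) (hb : Continuous b)
    (hφ : ∀ i, Continuous (φ i)) (hψ : ∀ j, Continuous (ψ j)) {π : Measure (X × Y)}
    (hπ₁ : π.map Prod.fst = μ) (hπ₂ : π.map Prod.snd = ν) (hac : π ≪ μ.prod ν)
    (hint : Integrable (llr π (μ.prod ν)) π) :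
    ∃ (γ : Measure (X × X)) (γ' : Measure (Y × Y)),
      (γ.map Prod.fst = μ ∧ γ.map Prod.snd = μ ∧ γ ≪ μ.prod μ ∧
        Integrable (llr γ (μ.prod μ)) γ) ∧
      (γ'.map Prod.fst = ν ∧ γ'.map Prod.snd = ν ∧ γ' ≪ ν.prod ν ∧
        Integrable (llr γ' (ν.prod ν)) γ') ∧
      (ε * ∫ z, llr γ (μ.prod μ) z ∂γ - 4 * ∫ z, a z.1 * a z.2 ∂γ
          - 8 * ∑ i, ∑ i', (∫ z, φ i z.1 * φ i' z.2 ∂γ) ^ 2) +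
        (ε * ∫ z, llr γ' (ν.prod ν) z ∂γ' - 4 * ∫ z, b z.1 * b z.2 ∂γ'
          - 8 * ∑ j, ∑ j', (∫ z, ψ j z.1 * ψ j' z.2 ∂γ') ^ 2) ≤
      2 * (ε * ∫ z, llr π (μ.prod ν) z ∂π - 4 * ∫ z, a z.1 * b z.2 ∂π
          - 8 * ∑ i, ∑ j, (∫ z, φ i z.1 * ψ j z.2 ∂π) ^ 2) := by
  have := isProbabilityMeasure_of_map hπ₁
  have hπ : CompactlySupported π := .of_marginals (hπ₁ ▸ hμ) (hπ₂ ▸ hν)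
  obtain ⟨A, B, hAB, hA, hB⟩ :=
    exists_balanced_factorization fun i j => ∫ z, φ i z.1 * ψ j z.2 ∂π
  obtain ⟨r, hr⟩ : ∃ r : ℝ, ε * r ^ 2 = 4 :=
    ⟨2 / √ε, by rw [div_pow, Real.sq_sqrt hε.le]; field_simp; norm_num⟩
  obtain ⟨t, ht⟩ : ∃ t : ℝ, ε * t ^ 2 = 16 :=
    ⟨4 / √ε, by rw [div_pow, Real.sq_sqrt hε.le]; field_simp; norm_num⟩
  obtain ⟨γ, γ', hγ, hγ', h⟩ := exists_couplings_entropic_le hμ hν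
    (Φ := fun (k : Option κ) x => k.elim (r * a x) fun k => t * ∑ i, A k i * φ i x)
    (Ψ := fun (k : Option κ) y => k.elim (r * b y) fun k => t * ∑ j, B k j * ψ j y)
    (by rintro (_ | k) <;> simp only [Option.elim] <;> fun_prop)
    (by rintro (_ | k) <;> simp only [Option.elim] <;> fun_prop) hπ₁ hπ₂ hac hint
  refine ⟨γ, γ', hγ, hγ', ?_⟩
  have := isProbabilityMeasure_of_map hγ.1
  have := isProbabilityMeasure_of_map hγ'.1
  have hγc : CompactlySupported γ := .of_marginals (hγ.1 ▸ hμ) (hγ.2.1 ▸ hμ)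
  have hγc' : CompactlySupported γ' := .of_marginals (hγ'.1 ▸ hν) (hγ'.2.1 ▸ hν)
  rw [integral_option_sum_mul hπ ha hb hφ hψ, integral_option_sum_mul hγc ha ha hφ hφ,
    integral_option_sum_mul hγc' hb hb hψ hψ] at h
  simp only [hAB, ← sq] at h
  have h1 := two_mul_sum_sum_mul_le (fun i i' => ∑ k, A k i * A k i')
    fun i i' => ∫ z, φ i z.1 * φ i' z.2 ∂γ
  have h2 := two_mul_sum_sum_mul_le (fun j j' => ∑ k, B k j * B k j')
    fun j j' => ∫ z, ψ j z.1 * ψ j' z.2 ∂γ'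
  simp only [hA, hB] at h1 h2
  have h3 := mul_le_mul_of_nonneg_left h hε.le
  linear_combination h3 + 8 * h1 + 8 * h2 +
    (∫ z, a z.1 * a z.2 ∂γ + ∫ z, b z.1 * b z.2 ∂γ' - 2 * ∫ z, a z.1 * b z.2 ∂π) * hr +
    (∑ i, ∑ i', (∑ k, A k i * A k i') * ∫ z, φ i z.1 * φ i' z.2 ∂γ +
      ∑ j, ∑ j', (∑ k, B k j * B k j') * ∫ z, ψ j z.1 * ψ j' z.2 ∂γ' -
      2 * ∑ i, ∑ j, (∫ z, φ i z.1 * ψ j z.2 ∂π) ^ 2) * ht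

end Quadratic

/-- On a compact set, the inner product is uniformly a limit of kernels of finite rank. -/
lemma IsCompact.exists_inner_approx {H : Type*} [NormedAddCommGroup H] [InnerProductSpace ℝ H]
    {K : Set H} (hK : IsCompact K) {δ : ℝ} (hδ : 0 < δ) (m : H) :
    ∃ (n : ℕ) (φ : Fin n → H → ℝ), (∀ i, Continuous (φ i)) ∧ ∀ x ∈ K, ∀ x' ∈ K,
      |inner ℝ (x - m) (x' - m) - ∑ i, φ i x * φ i x'| ≤ δ := by
  have hsqrt : 0 < √δ := Real.sqrt_pos.2 hδ
  obtain ⟨t, -, htf, ht⟩ := (hK.image (continuous_sub_right m)).finite_cover_balls hsqrt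
  let V := Submodule.span ℝ t
  have : FiniteDimensional ℝ V := FiniteDimensional.span_of_finite ℝ htf
  let e := stdOrthonormalBasis ℝ V
  refine ⟨_, fun i x => inner ℝ (e i : H) (x - m), fun i => by fun_prop, ?_⟩
  have hdist : ∀ x ∈ K, ‖(x - m) - V.starProjection (x - m)‖ ≤ √δ := fun x hx => by
    obtain ⟨y, hy, hxy⟩ := Set.mem_iUnion₂.1 (ht ⟨x, hx, rfl⟩)
    rw [V.starProjection_minimal]
    refine (ciInf_le ⟨0, ?_⟩ (⟨y, Submodule.subset_span hy⟩ : V)).trans ?_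
    · rintro _ ⟨w, rfl⟩
      exact norm_nonneg _
    · rw [← dist_eq_norm]
      exact (Metric.mem_ball.1 hxy).le
  have hproj : ∀ u v : H, inner ℝ u v - ∑ i, inner ℝ (e i : H) u * inner ℝ (e i : H) v =
      inner ℝ (u - V.starProjection u) (v - V.starProjection v) := fun u v => by
    have h := e.sum_inner_mul_inner (V.orthogonalProjectionOnto u) (V.orthogonalProjectionOnto v)
    have hc : ∀ i w, inner ℝ (e i) (V.orthogonalProjectionOnto w) = inner ℝ (e i : H) w :=
      fun i w => V.inner_orthogonalProjectionOnto_eq_of_mem_left (e i) w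
    have hc' : ∀ i w, inner ℝ (V.orthogonalProjectionOnto w) (e i) = inner ℝ (e i : H) w :=
      fun i w => by rw [real_inner_comm, hc]
    simp only [hc, hc'] at h
    have h0 : inner ℝ (V.starProjection u) (v - V.starProjection v) = 0 :=
      V.sub_starProjection_mem_orthogonal v _ (V.starProjection_apply_mem u)
    rw [h, inner_sub_left, h0, sub_zero, inner_sub_right]
    congr 1
    exact V.inner_orthogonalProjectionOnto_eq_of_mem_right (V.orthogonalProjectionOnto v) u
  intro x hx x' hx'
  rw [hproj, ← Real.norm_eq_abs]
  calc _ ≤ ‖(x - m) - V.starProjection (x - m)‖ * ‖(x' - m) - V.starProjection (x' - m)‖ :=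
        norm_inner_le_norm _ _
    _ ≤ √δ * √δ := by gcongr <;> apply hdist <;> assumption
    _ = δ := Real.mul_self_sqrt hδ.le

lemma abs_integral_mul_sub_sum_sq_le {X Y ι κ : Type*} [Fintype ι] [Fintype κ]
    [MetricSpace X] [SecondCountableTopology X] [MeasurableSpace X] [BorelSpace X]
    [MetricSpace Y] [SecondCountableTopology Y] [MeasurableSpace Y] [BorelSpace Y]
    {γ : Measure (X × Y)} [IsProbabilityMeasure γ] (hγ : CompactlySupported γ)
    {s : X → X → ℝ} {t : Y → Y → ℝ} {φ : ι → X → ℝ} {ψ : κ → Y → ℝ}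
    (hs : Continuous fun p : X × X => s p.1 p.2) (ht : Continuous fun p : Y × Y => t p.1 p.2)
    (hφ : ∀ i, Continuous (φ i)) (hψ : ∀ j, Continuous (ψ j)) {K : Set X} {L : Set Y}
    (hK : ∀ᵐ p ∂γ, p.1 ∈ K) (hL : ∀ᵐ p ∂γ, p.2 ∈ L) {R δ : ℝ} (hδ : δ ≤ 1)
    (hsR : ∀ x ∈ K, ∀ x' ∈ K, |s x x'| ≤ R) (htR : ∀ y ∈ L, ∀ y' ∈ L, |t y y'| ≤ R)
    (hsφ : ∀ x ∈ K, ∀ x' ∈ K, |s x x' - ∑ i, φ i x * φ i x'| ≤ δ)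
    (htψ : ∀ y ∈ L, ∀ y' ∈ L, |t y y' - ∑ j, ψ j y * ψ j y'| ≤ δ) :
    |∫ z, s z.1.1 z.2.1 * t z.1.2 z.2.2 ∂(γ.prod γ) -
      ∑ i, ∑ j, (∫ z, φ i z.1 * ψ j z.2 ∂γ) ^ 2| ≤ δ * (2 * R + 1) := by
  have hγγ := hγ.prod hγ
  have hsum : ∑ i, ∑ j, (∫ z, φ i z.1 * ψ j z.2 ∂γ) ^ 2 =
      ∫ z, (∑ i, φ i z.1.1 * φ i z.2.1) * ∑ j, ψ j z.1.2 * ψ j z.2.2 ∂(γ.prod γ) := by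
    simp only [Finset.sum_mul_sum]
    rw [integral_finsetSum _ fun i _ => hγγ.integrable (by fun_prop)]
    refine Finset.sum_congr rfl fun i _ => ?_
    rw [integral_finsetSum _ fun j _ => hγγ.integrable (by fun_prop)]
    refine Finset.sum_congr rfl fun j _ => ?_
    rw [sq, ← integral_prod_mul]
    exact integral_congr_ae (ae_of_all _ fun z => by simp only; ring)
  have hs' : Continuous fun z : (X × Y) × (X × Y) => s z.1.1 z.2.1 :=
    hs.comp (f := fun z : (X × Y) × (X × Y) => (z.1.1, z.2.1)) (by fun_prop)
  have ht' : Continuous fun z : (X × Y) × (X × Y) => t z.1.2 z.2.2 :=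
    ht.comp (f := fun z : (X × Y) × (X × Y) => (z.1.2, z.2.2)) (by fun_prop)
  rw [hsum, ← integral_sub (hγγ.integrable (by fun_prop)) (hγγ.integrable (by fun_prop)),
    ← Real.norm_eq_abs]
  have hKL : ∀ᵐ z ∂(γ.prod γ), (z.1.1 ∈ K ∧ z.1.2 ∈ L) ∧ z.2.1 ∈ K ∧ z.2.2 ∈ L :=
    (Measure.quasiMeasurePreserving_fst.ae (hK.and hL)).and
      (Measure.quasiMeasurePreserving_snd.ae (hK.and hL))
  refine (norm_integral_le_of_norm_le_const (C := δ * (2 * R + 1)) ?_).trans (by simp)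
  filter_upwards [hKL] with z ⟨⟨h1, h2⟩, h3, h4⟩
  have e1 := hsφ _ h1 _ h3
  have e2 := htψ _ h2 _ h4
  have e3 := hsR _ h1 _ h3
  have e4 := htR _ h2 _ h4
  generalize s z.1.1 z.2.1 = S at *
  generalize t z.1.2 z.2.2 = T at *
  generalize ∑ i, φ i z.1.1 * φ i z.2.1 = S' at *
  generalize ∑ j, ψ j z.1.2 * ψ j z.2.2 = T' at *
  have hT' : |T'| ≤ R + 1 := by
    have := abs_sub_abs_le_abs_sub T' T
    rw [abs_sub_comm] at this
    linarith
  have hR : 0 ≤ R := (abs_nonneg _).trans e3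
  calc ‖S * T - S' * T'‖ = |S * (T - T') + (S - S') * T'| := by
        rw [Real.norm_eq_abs]; ring_nf
    _ ≤ |S| * |T - T'| + |S - S'| * |T'| := by
        rw [← abs_mul, ← abs_mul]; exact abs_add_le _ _
    _ ≤ R * δ + δ * (R + 1) := by gcongr; exact (abs_nonneg _).trans e1
    _ = _ := by ring

lemma integral_mul_inner_sub_integral {Z E : Type*} [MetricSpace Z]
    [SecondCountableTopology Z] [MeasurableSpace Z] [BorelSpace Z]
    [NormedAddCommGroup E] [InnerProductSpace ℝ E] [CompleteSpace E]
    {γ : Measure Z} [IsProbabilityMeasure γ]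
    (hγ : CompactlySupported γ) {f : Z → E} (hf : Continuous f) {g : Z → ℝ} (hg : Continuous g)
    {m : E} (hm : ∫ z, f z ∂γ = m) :
    ∫ z, g z.1 * inner ℝ (f z.1 - m) (f z.2 - m) ∂(γ.prod γ) = 0 := by
  rw [integral_prod _ ((hγ.prod hγ).integrable (by fun_prop))]
  have h : ∀ z, ∫ z', g z * inner ℝ (f z - m) (f z' - m) ∂γ = 0 := fun z => by
    rw [integral_const_mul, integral_inner (hγ.integrable (by fun_prop)),
      integral_sub (hγ.integrable hf) (integrable_const _), hm]
    simp
  simp [h]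

section Loss

variable {E F : Type*}
  [NormedAddCommGroup E] [InnerProductSpace ℝ E] [CompleteSpace E]
  [SecondCountableTopology E] [MeasurableSpace E] [BorelSpace E]
  [NormedAddCommGroup F] [InnerProductSpace ℝ F] [CompleteSpace F]
  [SecondCountableTopology F] [MeasurableSpace F] [BorelSpace F]

/-- Expansion of the Gromov–Wasserstein loss of a coupling. -/
lemma integral_sq_norm_sub_eq {α : Measure E} {β : Measure F}
    [IsProbabilityMeasure α] [IsProbabilityMeasure β]
    (hα : CompactlySupported α) (hβ : CompactlySupported β) {γ : Measure (E × F)}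
    (hγ₁ : γ.map Prod.fst = α) (hγ₂ : γ.map Prod.snd = β) {m : E} {n : F}
    (hm : ∫ x, x ∂α = m) (hn : ∫ y, y ∂β = n) :
    ∫ p, ∫ q, (‖p.1 - q.1‖ ^ 2 - ‖p.2 - q.2‖ ^ 2) ^ 2 ∂γ ∂γ =
      ∫ z, ‖z.1 - z.2‖ ^ 4 ∂(α.prod α) + ∫ z, ‖z.1 - z.2‖ ^ 4 ∂(β.prod β)
        - 4 * ∫ z, ‖z.1 - m‖ ^ 2 * ‖z.2 - n‖ ^ 2 ∂γ
        - 4 * ((∫ x, ‖x - m‖ ^ 2 ∂α) * ∫ y, ‖y - n‖ ^ 2 ∂β)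
        - 8 * ∫ z, inner ℝ (z.1.1 - m) (z.2.1 - m) * inner ℝ (z.1.2 - n) (z.2.2 - n)
          ∂(γ.prod γ) := by
  have := isProbabilityMeasure_of_map hγ₁
  have hγ : CompactlySupported γ := .of_marginals (hγ₁ ▸ hα) (hγ₂ ▸ hβ)
  have hγγ := hγ.prod hγ
  have hm' : ∫ z, z.1 ∂γ = m := by
    rw [← hm, ← hγ₁]
    exact (integral_map measurable_fst.aemeasurable continuous_id.aestronglyMeasurable).symm
  have hn' : ∫ z, z.2 ∂γ = n := by
    rw [← hn, ← hγ₂]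
    exact (integral_map measurable_snd.aemeasurable continuous_id.aestronglyMeasurable).symm
  have hC₁ : ∫ z, ‖z.1 - z.2‖ ^ 4 ∂(α.prod α) = ∫ z, ‖z.1.1 - z.2.1‖ ^ 4 ∂(γ.prod γ) := by
    rw [← hγ₁, Measure.map_prod_map _ _ measurable_fst measurable_fst, integral_map
      (by fun_prop) (Continuous.aestronglyMeasurable (by fun_prop))]
    rfl
  have hC₂ : ∫ z, ‖z.1 - z.2‖ ^ 4 ∂(β.prod β) = ∫ z, ‖z.1.2 - z.2.2‖ ^ 4 ∂(γ.prod γ) := by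
    rw [← hγ₂, Measure.map_prod_map _ _ measurable_snd measurable_snd, integral_map
      (by fun_prop) (Continuous.aestronglyMeasurable (by fun_prop))]
    rfl
  rw [← integral_prod (fun z : (E × F) × (E × F) =>
    (‖z.1.1 - z.2.1‖ ^ 2 - ‖z.1.2 - z.2.2‖ ^ 2) ^ 2) (hγγ.integrable (by fun_prop)), hC₁, hC₂]
  let a : E × F → ℝ := fun z => ‖z.1 - m‖ ^ 2
  let b : E × F → ℝ := fun z => ‖z.2 - n‖ ^ 2
  have ha : Continuous a := by fun_prop
  have hb : Continuous b := by fun_prop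
  let S : (E × F) × (E × F) → ℝ := fun z => inner ℝ (z.1.1 - m) (z.2.1 - m)
  let T : (E × F) × (E × F) → ℝ := fun z => inner ℝ (z.1.2 - n) (z.2.2 - n)
  have hS : Continuous S := by fun_prop
  have hT : Continuous T := by fun_prop
  have hab : ∫ z, a z.1 * b z.2 ∂(γ.prod γ) =
      (∫ x, ‖x - m‖ ^ 2 ∂α) * ∫ y, ‖y - n‖ ^ 2 ∂β := by
    rw [integral_prod_mul, ← integral_comp_fst hγ₁ (f := fun x => ‖x - m‖ ^ 2) (by fun_prop),
      ← integral_comp_snd hγ₂ (f := fun y => ‖y - n‖ ^ 2) (by fun_prop)]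
  have hab' : ∫ z, a z.1 * b z.1 ∂(γ.prod γ) = ∫ z, ‖z.1 - m‖ ^ 2 * ‖z.2 - n‖ ^ 2 ∂γ := by
    rw [integral_prod _ (hγγ.integrable (by fun_prop))]
    simp [a, b]
  have hbS : ∫ z, b z.1 * S z ∂(γ.prod γ) = 0 :=
    integral_mul_inner_sub_integral hγ continuous_fst hb hm'
  have haT : ∫ z, a z.1 * T z ∂(γ.prod γ) = 0 :=
    integral_mul_inner_sub_integral hγ continuous_snd ha hn'
  have hswap : ∀ f : (E × F) × (E × F) → ℝ,
      ∫ z, f z.swap ∂(γ.prod γ) = ∫ z, f z ∂(γ.prod γ) := fun f => integral_prod_swap f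
  rw [← hab, ← hab']
  have hpt : ∀ z : (E × F) × (E × F), (‖z.1.1 - z.2.1‖ ^ 2 - ‖z.1.2 - z.2.2‖ ^ 2) ^ 2 =
      (‖z.1.1 - z.2.1‖ ^ 4 + ‖z.1.2 - z.2.2‖ ^ 4) -
      ((2 * (a z.1 * b z.1) + 2 * (a z.1 * b z.2) + 4 * (S z * T z) - 4 * (b z.1 * S z)
         - 4 * (a z.1 * T z)) +
       (2 * (a z.2 * b z.2) + 2 * (a z.2 * b z.1) + 4 * (S z * T z) - 4 * (b z.2 * S z)
         - 4 * (a z.2 * T z))) := fun z => by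
    have h1 : ‖z.1.1 - z.2.1‖ ^ 2 = a z.1 + a z.2 - 2 * S z := by
      rw [← sub_sub_sub_cancel_right _ _ m, norm_sub_sq_real]; simp only [a, S]; ring
    have h2 : ‖z.1.2 - z.2.2‖ ^ 2 = b z.1 + b z.2 - 2 * T z := by
      rw [← sub_sub_sub_cancel_right _ _ n, norm_sub_sq_real]; simp only [b, T]; ring
    rw [show (4 : ℕ) = 2 * 2 from rfl, pow_mul, pow_mul, h1, h2]
    ring
  let G : (E × F) × (E × F) → ℝ := fun z => 2 * (a z.1 * b z.1) + 2 * (a z.1 * b z.2)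
    + 4 * (S z * T z) - 4 * (b z.1 * S z) - 4 * (a z.1 * T z)
  have hG : Continuous G := by fun_prop
  have hGG : ∀ z, (2 * (a z.2 * b z.2) + 2 * (a z.2 * b z.1) + 4 * (S z * T z) - 4 * (b z.2 * S z)
         - 4 * (a z.2 * T z)) = G z.swap := fun z => by
    simp only [G, S, T, Prod.fst_swap, Prod.snd_swap, real_inner_comm]
  have hGi : ∫ z, G z ∂(γ.prod γ) = 2 * ∫ z, a z.1 * b z.1 ∂(γ.prod γ) +
      2 * ∫ z, a z.1 * b z.2 ∂(γ.prod γ) + 4 * ∫ z, S z * T z ∂(γ.prod γ) := by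
    simp only [G]
    rw [integral_sub (hγγ.integrable (by fun_prop)) (hγγ.integrable (by fun_prop)),
      integral_sub (hγγ.integrable (by fun_prop)) (hγγ.integrable (by fun_prop)),
      integral_add (hγγ.integrable (by fun_prop)) (hγγ.integrable (by fun_prop)),
      integral_add (hγγ.integrable (by fun_prop)) (hγγ.integrable (by fun_prop))]
    simp only [integral_const_mul, hbS, haT]
    ring
  simp only [hpt, hGG]
  rw [integral_sub (hγγ.integrable (by fun_prop)) (hγγ.integrable (by fun_prop)),
    integral_add (hγγ.integrable (by fun_prop)) (hγγ.integrable (by fun_prop)),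
    integral_add (hγγ.integrable (by fun_prop)) (hγγ.integrable (by fun_prop)), hswap]
  simp only [G] at hGi
  rw [hGi]
  ring

end Loss

lemma klE_nonneg {Z : Type*} [MeasurableSpace Z] {π μ : Measure Z} [IsProbabilityMeasure π]
    [IsProbabilityMeasure μ] : 0 ≤ klE π μ := by
  unfold klE
  split_ifs with h
  · exact EReal.coe_nonneg.2 (integral_llr_nonneg h.1)
  · exact le_top

lemma gwE_nonneg {HX HY : Type*}
    [NormedAddCommGroup HX] [SecondCountableTopology HX] [MeasurableSpace HX] [BorelSpace HX]
    [NormedAddCommGroup HY] [SecondCountableTopology HY] [MeasurableSpace HY] [BorelSpace HY]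
    {α : Measure HX} {β : Measure HY} [IsProbabilityMeasure α] [IsProbabilityMeasure β]
    {ε : ℝ} (hε : 0 ≤ ε) : 0 ≤ gwE ε α β := by
  refine le_iInf₂ fun π hπ => ?_
  have := isProbabilityMeasure_of_map hπ.1
  exact add_nonneg (EReal.coe_nonneg.2 (integral_nonneg fun p => integral_nonneg fun q =>
    sq_nonneg _)) (mul_nonneg (EReal.coe_nonneg.2 hε) klE_nonneg)

lemma gwE_le_coe {HX HY : Type*} [NormedAddCommGroup HX] [MeasurableSpace HX]
    [NormedAddCommGroup HY] [MeasurableSpace HY]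
    {α : Measure HX} {β : Measure HY} [SFinite β] {ε : ℝ} {π : Measure (HX × HY)}
    (hπ₁ : π.map Prod.fst = α) (hπ₂ : π.map Prod.snd = β) (hac : π ≪ α.prod β)
    (hint : Integrable (llr π (α.prod β)) π) :
    gwE ε α β ≤ ((∫ p, ∫ q, (‖p.1 - q.1‖ ^ 2 - ‖p.2 - q.2‖ ^ 2) ^ 2 ∂π ∂π)
          + ε * ∫ z, llr π (α.prod β) z ∂π : ℝ) := by
  refine (iInf₂_le π ⟨hπ₁, hπ₂⟩).trans (le_of_eq ?_)
  rw [klE, if_pos ⟨hac, hint⟩]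
  push_cast
  rfl

lemma gwE_ne_top {HX HY : Type*} [NormedAddCommGroup HX] [MeasurableSpace HX]
    [NormedAddCommGroup HY] [MeasurableSpace HY]
    {α : Measure HX} {β : Measure HY} [IsProbabilityMeasure α] [IsProbabilityMeasure β] {ε : ℝ} : gwE ε α β ≠ ⊤ := by
  refine ne_top_of_le_ne_top (EReal.coe_ne_top _) (gwE_le_coe (π := α.prod β) (by simp) (by simp)
    Measure.AbsolutelyContinuous.rfl ?_)
  exact (integrable_zero _ _ _).congr (llr_self _).symm

lemma gwE_zero_self {H : Type*} [NormedAddCommGroup H] [SecondCountableTopology H]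
    [MeasurableSpace H] [BorelSpace H] {α : Measure H} [IsProbabilityMeasure α] : gwE 0 α α = 0 := by
  refine le_antisymm ?_ (gwE_nonneg le_rfl)
  have hd : Measurable fun x : H => (x, x) := by fun_prop
  have h₁ : (α.map fun x => (x, x)).map Prod.fst = α := by
    rw [Measure.map_map measurable_fst hd]; exact Measure.map_id
  have h₂ : (α.map fun x => (x, x)).map Prod.snd = α := by
    rw [Measure.map_map measurable_snd hd]; exact Measure.map_id
  refine (iInf₂_le (α.map fun x => (x, x)) ⟨h₁, h₂⟩).trans (le_of_eq ?_)
  have h : ∀ᵐ p ∂(α.map fun x => (x, x)), p.1 = p.2 :=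
    (ae_map_iff hd.aemeasurable (measurableSet_eq_fun measurable_fst measurable_snd)).2
      (ae_of_all _ fun _ => rfl)
  rw [EReal.coe_zero, zero_mul, add_zero, EReal.coe_eq_zero]
  refine integral_eq_zero_of_ae ?_
  filter_upwards [h] with p hp
  refine integral_eq_zero_of_ae ?_
  filter_upwards [h] with q hq
  simp [hp, hq]

section GromovWasserstein

variable {HX HY : Type*}
  [NormedAddCommGroup HX] [InnerProductSpace ℝ HX] [CompleteSpace HX]
  [SecondCountableTopology HX] [MeasurableSpace HX] [BorelSpace HX]
  [NormedAddCommGroup HY] [InnerProductSpace ℝ HY] [CompleteSpace HY]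
  [SecondCountableTopology HY] [MeasurableSpace HY] [BorelSpace HY]
  {α : Measure HX} {β : Measure HY} [IsProbabilityMeasure α] [IsProbabilityMeasure β]

theorem exists_couplings_gromovWasserstein_le (hα : CompactlySupported α)
    (hβ : CompactlySupported β) {ε η : ℝ} (hε : 0 < ε) (hη : 0 < η) {π : Measure (HX × HY)}
    (hπ₁ : π.map Prod.fst = α) (hπ₂ : π.map Prod.snd = β) (hac : π ≪ α.prod β)
    (hint : Integrable (llr π (α.prod β)) π) :
    ∃ (γ : Measure (HX × HX)) (γ' : Measure (HY × HY)),
      (γ.map Prod.fst = α ∧ γ.map Prod.snd = α ∧ γ ≪ α.prod α ∧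
        Integrable (llr γ (α.prod α)) γ) ∧
      (γ'.map Prod.fst = β ∧ γ'.map Prod.snd = β ∧ γ' ≪ β.prod β ∧
        Integrable (llr γ' (β.prod β)) γ') ∧
      ((∫ p, ∫ q, (‖p.1 - q.1‖ ^ 2 - ‖p.2 - q.2‖ ^ 2) ^ 2 ∂γ ∂γ)
          + ε * ∫ z, llr γ (α.prod α) z ∂γ) +
        ((∫ p, ∫ q, (‖p.1 - q.1‖ ^ 2 - ‖p.2 - q.2‖ ^ 2) ^ 2 ∂γ' ∂γ')
          + ε * ∫ z, llr γ' (β.prod β) z ∂γ') ≤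
      2 * ((∫ p, ∫ q, (‖p.1 - q.1‖ ^ 2 - ‖p.2 - q.2‖ ^ 2) ^ 2 ∂π ∂π)
          + ε * ∫ z, llr π (α.prod β) z ∂π) + η := by
  obtain ⟨K, hK, hK0⟩ := id hα
  obtain ⟨L, hL, hL0⟩ := id hβ
  obtain ⟨m, hm⟩ : ∃ m, ∫ x, x ∂α = m := ⟨_, rfl⟩
  obtain ⟨n, hn⟩ : ∃ n, ∫ y, y ∂β = n := ⟨_, rfl⟩
  let s : HX → HX → ℝ := fun x x' => inner ℝ (x - m) (x' - m)
  let t : HY → HY → ℝ := fun y y' => inner ℝ (y - n) (y' - n)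
  have hs : Continuous fun p : HX × HX => s p.1 p.2 := by fun_prop
  have ht : Continuous fun p : HY × HY => t p.1 p.2 := by fun_prop
  obtain ⟨R₁, hR₁⟩ := (hK.prod hK).exists_bound_of_continuousOn hs.continuousOn
  obtain ⟨R₂, hR₂⟩ := (hL.prod hL).exists_bound_of_continuousOn ht.continuousOn
  let R := max (max R₁ R₂) 0
  have hR : 0 ≤ R := le_max_right _ _
  have hsR : ∀ x ∈ K, ∀ x' ∈ K, |s x x'| ≤ R := fun x hx x' hx' =>
    (hR₁ (x, x') ⟨hx, hx'⟩).trans ((le_max_left _ _).trans (le_max_left _ _))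
  have htR : ∀ y ∈ L, ∀ y' ∈ L, |t y y'| ≤ R := fun y hy y' hy' =>
    (hR₂ (y, y') ⟨hy, hy'⟩).trans ((le_max_right _ _).trans (le_max_left _ _))
  let δ := min 1 (η / (32 * (2 * R + 1)))
  have hδ : 0 < δ := lt_min one_pos (by positivity)
  have hδ1 : δ ≤ 1 := min_le_left _ _
  have hδη : 32 * (δ * (2 * R + 1)) ≤ η := by
    have h := min_le_right 1 (η / (32 * (2 * R + 1)))
    rw [le_div_iff₀ (by positivity)] at h
    calc _ = δ * (32 * (2 * R + 1)) := by ring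
      _ ≤ η := h
  obtain ⟨k, φ, hφ, hsφ⟩ := hK.exists_inner_approx hδ m
  obtain ⟨l, ψ, hψ, htψ⟩ := hL.exists_inner_approx hδ n
  obtain ⟨γ, γ', hγ, hγ', h⟩ := exists_couplings_quadratic_le hα hβ hε
    (a := fun x => ‖x - m‖ ^ 2) (b := fun y => ‖y - n‖ ^ 2) (by fun_prop) (by fun_prop) hφ hψ
    hπ₁ hπ₂ hac hint
  refine ⟨γ, γ', hγ, hγ', ?_⟩
  have := isProbabilityMeasure_of_map hπ₁
  have := isProbabilityMeasure_of_map hγ.1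
  have := isProbabilityMeasure_of_map hγ'.1
  have e₁ := abs_le.1 (abs_integral_mul_sub_sum_sq_le (γ := π)
    (.of_marginals (hπ₁ ▸ hα) (hπ₂ ▸ hβ)) hs ht hφ hψ
    (ae_of_ae_map measurable_fst.aemeasurable (hπ₁ ▸ mem_ae_iff.2 hK0))
    (ae_of_ae_map measurable_snd.aemeasurable (hπ₂ ▸ mem_ae_iff.2 hL0)) hδ1 hsR htR hsφ htψ)
  have e₂ := abs_le.1 (abs_integral_mul_sub_sum_sq_le (γ := γ)
    (.of_marginals (hγ.1 ▸ hα) (hγ.2.1 ▸ hα)) hs hs hφ hφ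
    (ae_of_ae_map measurable_fst.aemeasurable (hγ.1 ▸ mem_ae_iff.2 hK0))
    (ae_of_ae_map measurable_snd.aemeasurable (hγ.2.1 ▸ mem_ae_iff.2 hK0)) hδ1 hsR hsR hsφ hsφ)
  have e₃ := abs_le.1 (abs_integral_mul_sub_sum_sq_le (γ := γ')
    (.of_marginals (hγ'.1 ▸ hβ) (hγ'.2.1 ▸ hβ)) ht ht hψ hψ
    (ae_of_ae_map measurable_fst.aemeasurable (hγ'.1 ▸ mem_ae_iff.2 hL0))
    (ae_of_ae_map measurable_snd.aemeasurable (hγ'.2.1 ▸ mem_ae_iff.2 hL0)) hδ1 htR htR htψ htψ)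
  rw [integral_sq_norm_sub_eq hα hβ hπ₁ hπ₂ hm hn,
    integral_sq_norm_sub_eq hα hα hγ.1 hγ.2.1 hm hm,
    integral_sq_norm_sub_eq hβ hβ hγ'.1 hγ'.2.1 hn hn]
  have hsq := sq_nonneg (∫ x, ‖x - m‖ ^ 2 ∂α - ∫ y, ‖y - n‖ ^ 2 ∂β)
  simp only [s, t] at e₁ e₂ e₃
  nlinarith [e₁.1, e₁.2, e₂.1, e₂.2, e₃.1, e₃.2]

end GromovWasserstein

/-- nonnegativity of the Sinkhorn–Gromov–Wasserstein divergence for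
compactly supported probability measures on separable Hilbert spaces. -/
theorem sgw_nonneg
    {HX HY : Type*}
    [NormedAddCommGroup HX] [InnerProductSpace ℝ HX] [CompleteSpace HX]
    [SecondCountableTopology HX] [MeasurableSpace HX] [BorelSpace HX]
    [NormedAddCommGroup HY] [InnerProductSpace ℝ HY] [CompleteSpace HY]
    [SecondCountableTopology HY] [MeasurableSpace HY] [BorelSpace HY]
    (α : Measure HX) (β : Measure HY)
    [IsProbabilityMeasure α] [IsProbabilityMeasure β]
    (KX : Set HX) (KY : Set HY) (hKX : IsCompact KX) (hKY : IsCompact KY)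
    (hαK : α KXᶜ = 0) (hβK : β KYᶜ = 0)
    (ε : ℝ) (hε : 0 ≤ ε) :
    0 ≤ gwE ε α β - (((1 : ℝ) / 2 : ℝ) : EReal) * (gwE ε α α + gwE ε β β) := by
  rcases hε.eq_or_lt with rfl | hε'
  · rw [gwE_zero_self, gwE_zero_self, add_zero, mul_zero, sub_zero]
    exact gwE_nonneg le_rfl
  have hbot : ∀ {x : EReal}, 0 ≤ x → x ≠ ⊥ := fun h => ne_bot_of_le_ne_bot EReal.zero_ne_bot h
  obtain ⟨a, ha⟩ : ∃ a : ℝ, (a : EReal) = gwE ε α α :=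
    ⟨_, EReal.coe_toReal gwE_ne_top (hbot (gwE_nonneg hε))⟩
  obtain ⟨b, hb⟩ : ∃ b : ℝ, (b : EReal) = gwE ε β β :=
    ⟨_, EReal.coe_toReal gwE_ne_top (hbot (gwE_nonneg hε))⟩
  rw [← ha, ← hb, ← EReal.coe_add, ← EReal.coe_mul,
    EReal.sub_nonneg (.inr (EReal.coe_ne_top _)) (.inr (EReal.coe_ne_bot _))]
  refine le_iInf₂ fun π hπ => ?_
  unfold klE
  split_ifs with h
  · rw [← EReal.coe_mul, ← EReal.coe_add, EReal.coe_le_coe_iff]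
    refine le_of_forall_pos_le_add fun η hη => ?_
    obtain ⟨γ, γ', hγ, hγ', hle⟩ := exists_couplings_gromovWasserstein_le ⟨KX, hKX, hαK⟩
      ⟨KY, hKY, hβK⟩ hε' hη hπ.1 hπ.2 h.1 h.2
    have h₁ := gwE_le_coe (ε := ε) hγ.1 hγ.2.1 hγ.2.2.1 hγ.2.2.2
    have h₂ := gwE_le_coe (ε := ε) hγ'.1 hγ'.2.1 hγ'.2.2.1 hγ'.2.2.2
    rw [← ha, EReal.coe_le_coe_iff] at h₁
    rw [← hb, EReal.coe_le_coe_iff] at h₂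
    linarith
  · rw [EReal.coe_mul_top_of_pos hε', EReal.coe_add_top]
    exact le_top
end

section
/- Let K_X and K_Y be compact subsets of separable real Hilbert spaces H_X and H_Y, endowed with squared-norm costs, and fix ε ≥ 0. If (α_n) are Borel probability measures supported in K_X converging weakly to α, and (β_n) are Borel probability measures supported in K_Y converging weakly to β, then GW_ε(α_n, β_n) → GW_ε(α, β); that is, (α,β) ↦ GW_ε(α,β) is jointly sequentially continuous for weak convergence. -/
open MeasureTheory Classical Filter BoundedContinuousFunction

section Entropy

open InformationTheory
open scoped ENNReal NNReal Topology

variable {Z : Type*} [MeasurableSpace Z] {π μ : Measure Z}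

lemma klE_eq_klDiv [IsProbabilityMeasure π] [IsProbabilityMeasure μ] :
    klE π μ = (klDiv π μ : EReal) := by
  unfold klE
  split_ifs with h
  · have h0 := integral_llr_add_sub_measure_univ_nonneg h.1 h.2
    rw [klDiv_of_ac_of_integrable h.1 h.2]
    simp only [probReal_univ, add_sub_cancel_right] at h0 ⊢
    rw [EReal.coe_ennreal_ofReal, max_eq_left h0]
  · rw [← klDiv_ne_top_iff, not_not] at h
    simp [h]

variable [TopologicalSpace Z] [BorelSpace Z]

/-- The Gibbs variational inequality. -/
lemma integral_sub_integral_exp_le_toReal_klDiv [IsProbabilityMeasure π] [IsProbabilityMeasure μ]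
    (h : klDiv π μ ≠ ∞) (f : Z →ᵇ ℝ) :
    ∫ z, f z ∂π - ∫ z, Real.exp (f z) ∂μ + 1 ≤ (klDiv π μ).toReal := by
  obtain ⟨hac, hint⟩ := klDiv_ne_top_iff.1 h
  have hexp : Integrable (fun z ↦ Real.exp (f z)) μ := by
    refine Integrable.of_bound (C := Real.exp ‖f‖) (by fun_prop) (ae_of_all _ fun z ↦ ?_)
    rw [Real.norm_eq_abs, Real.abs_exp]
    exact Real.exp_le_exp.2 ((le_abs_self _).trans (f.norm_coe_le_norm z))
  have hf : Integrable f π := f.integrable π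
  have : IsProbabilityMeasure (μ.tilted f) := isProbabilityMeasure_tilted hexp
  have h0 := integral_llr_add_sub_measure_univ_nonneg
    (hac.trans (absolutelyContinuous_tilted hexp)) (integrable_llr_tilted_right hac hf hint hexp)
  rw [integral_llr_tilted_right hac hf hexp hint] at h0
  rw [toReal_klDiv_of_measure_eq hac (by simp)]
  have hlog := Real.log_le_sub_one_of_pos (integral_exp_pos hexp)
  simp only [probReal_univ] at h0
  linarith

lemma integral_sub_integral_exp_le_of_forall_boundedContinuous [NormalSpace Z]
    [IsProbabilityMeasure π] [IsProbabilityMeasure μ] [(π + μ).WeaklyRegular] {r : ℝ}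
    (h : ∀ f : Z →ᵇ ℝ, ∫ z, f z ∂π - ∫ z, Real.exp (f z) ∂μ + 1 ≤ r)
    {g : Z → ℝ} (hg : Measurable g) {M : ℝ} (hM : ∀ z, |g z| ≤ M) :
    ∫ z, g z ∂π - ∫ z, Real.exp (g z) ∂μ + 1 ≤ r := by
  refine le_of_forall_pos_le_add fun η hη ↦ ?_
  have hgi (ρ : Measure Z) [IsFiniteMeasure ρ] : Integrable g ρ :=
    Integrable.of_bound (C := M) hg.aestronglyMeasurable (ae_of_all _ hM)
  obtain ⟨G, hG, -⟩ := (hgi (π + μ)).exists_boundedContinuous_integral_sub_le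
    (ε := η / (1 + Real.exp M)) (by positivity)
  have hbd (z : Z) : |max (-M) (min M (G z))| ≤ M := by
    have := (abs_nonneg _).trans (hM z)
    rw [abs_le]
    exact ⟨le_max_left _ _, max_le (by linarith) (min_le_left _ _)⟩
  let T : Z →ᵇ ℝ := BoundedContinuousFunction.ofNormedAddCommGroup
    (fun z ↦ max (-M) (min M (G z))) (by fun_prop) M hbd
  have hT (z : Z) : T z = max (-M) (min M (G z)) := rfl
  have hTM (z : Z) : |T z| ≤ M := hbd z
  have hTG (z : Z) : |g z - T z| ≤ ‖g z - G z‖ := by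
    have h1 := abs_le.1 (hM z)
    rw [hT, Real.norm_eq_abs]
    calc |g z - max (-M) (min M (G z))|
        = |max (-M) (min M (g z)) - max (-M) (min M (G z))| := by
          rw [min_eq_right h1.2, max_eq_right h1.1]
      _ ≤ |min M (g z) - min M (G z)| := by
          simpa only [max_comm (-M)] using abs_max_sub_max_le_abs (min M (g z)) (min M (G z)) (-M)
      _ ≤ |g z - G z| := by
          simpa only [min_comm M] using abs_inf_sub_inf_le_abs (g z) (G z) M
  have hdiff (ρ : Measure Z) [IsFiniteMeasure ρ] : Integrable (fun z ↦ |g z - T z|) ρ :=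
    ((hgi ρ).sub (T.integrable ρ)).abs
  have hsum : ∫ z, |g z - T z| ∂π + ∫ z, |g z - T z| ∂μ ≤ η / (1 + Real.exp M) := by
    rw [← integral_add_measure (hdiff π) (hdiff μ)]
    exact (integral_mono (hdiff _) ((hgi _).sub (G.integrable _)).norm hTG).trans hG
  have hexp {f : Z → ℝ} (hf : Measurable f) (hfM : ∀ z, |f z| ≤ M) :
      Integrable (fun z ↦ Real.exp (f z)) μ := by
    refine Integrable.of_bound (C := Real.exp M) (by fun_prop) (ae_of_all _ fun z ↦ ?_)
    rw [Real.norm_eq_abs, Real.abs_exp]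
    exact Real.exp_le_exp.2 ((le_abs_self _).trans (hfM z))
  have hTm : Measurable T := T.continuous.measurable
  have h1 : ∫ z, g z ∂π ≤ ∫ z, T z ∂π + ∫ z, |g z - T z| ∂π := by
    rw [← integral_add (T.integrable π) (hdiff π)]
    refine integral_mono (hgi π) ((T.integrable π).add (hdiff π)) fun z ↦ ?_
    linarith [le_abs_self (g z - T z)]
  have h2 : ∫ z, Real.exp (T z) ∂μ ≤
      ∫ z, Real.exp (g z) ∂μ + Real.exp M * ∫ z, |g z - T z| ∂μ := by
    rw [← integral_const_mul, ← integral_add (hexp hg hM) ((hdiff μ).const_mul _)]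
    refine integral_mono (hexp hTm hTM) ((hexp hg hM).add ((hdiff μ).const_mul _)) fun z ↦ ?_
    have e1 := Real.add_one_le_exp (g z - T z)
    have e2 : Real.exp (g z) = Real.exp (T z) * Real.exp (g z - T z) := by
      rw [← Real.exp_add]; ring_nf
    have e3 : Real.exp (T z) ≤ Real.exp M := Real.exp_le_exp.2 ((le_abs_self _).trans (hTM z))
    have e4 := mul_le_mul_of_nonneg_left e1 (Real.exp_pos (T z)).le
    have e5 := mul_le_mul_of_nonneg_right e3 (abs_nonneg (g z - T z))
    have e6 := mul_le_mul_of_nonneg_left (neg_abs_le (g z - T z)) (Real.exp_pos (T z)).le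
    simp only
    linarith
  have h3 := h T
  have hp : 0 ≤ ∫ z, |g z - T z| ∂π := integral_nonneg fun _ ↦ abs_nonneg _
  have hm : 0 ≤ ∫ z, |g z - T z| ∂μ := integral_nonneg fun _ ↦ abs_nonneg _
  have hE := Real.exp_pos M
  rw [le_div_iff₀ (by positivity)] at hsum
  nlinarith [mul_nonneg hE.le hp]

/-- The integrands in the variational formula, evaluated at truncations of the log-likelihood
ratio, are nonnegative. -/
lemma nonneg_mul_log_clamp {n ρ : ℝ} (hn : 1 ≤ n) :
    0 ≤ ρ * Real.log (max n⁻¹ (min n ρ)) - max n⁻¹ (min n ρ) + 1 := by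
  have hn0 : 0 < n := by linarith
  have hinv : n⁻¹ ≤ 1 := inv_le_one_of_one_le₀ hn
  have key : ∀ c : ℝ, 0 < c → 0 ≤ (ρ - c) * Real.log c → 0 ≤ ρ * Real.log c - c + 1 := by
    intro c hc h
    have := klFun_nonneg hc.le
    rw [klFun_apply] at this
    linarith
  apply key
  · exact lt_max_of_lt_left (by positivity)
  rcases le_total ρ n with h1 | h1
  · rw [min_eq_right h1]
    rcases le_total ρ n⁻¹ with h2 | h2
    · rw [max_eq_left h2]
      exact mul_nonneg_of_nonpos_of_nonpos (by linarith)
        (Real.log_nonpos (by positivity) hinv)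
    · rw [max_eq_right h2]; simp
  · rw [min_eq_left h1, max_eq_right (hinv.trans hn)]
    exact mul_nonneg (by linarith) (Real.log_nonneg hn)

lemma tendsto_mul_log_clamp {ρ : ℝ} (hρ : 0 ≤ ρ) :
    Tendsto (fun n : ℕ ↦ ρ * Real.log (max ((n : ℝ) + 1)⁻¹ (min ((n : ℝ) + 1) ρ))
      - max ((n : ℝ) + 1)⁻¹ (min ((n : ℝ) + 1) ρ) + 1) atTop (𝓝 (klFun ρ)) := by
  have hinv : Tendsto (fun n : ℕ ↦ ((n : ℝ) + 1)⁻¹) atTop (𝓝 0) := by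
    simpa using tendsto_one_div_add_atTop_nhds_zero_nat (𝕜 := ℝ)
  rcases hρ.eq_or_lt with rfl | hpos
  · have : ∀ n : ℕ, max ((n : ℝ) + 1)⁻¹ (min ((n : ℝ) + 1) 0) = ((n : ℝ) + 1)⁻¹ := fun n ↦ by
      rw [min_eq_right (by positivity), max_eq_left (by positivity)]
    simp only [this, zero_mul, zero_sub, klFun_zero]
    simpa using hinv.neg.add_const 1
  · refine tendsto_const_nhds.congr' ?_
    filter_upwards [hinv.eventually_lt_const hpos, eventually_ge_atTop ⌈ρ⌉₊] with n h1 h2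
    have h3 : ρ ≤ (n : ℝ) + 1 := (Nat.ceil_le.1 h2).trans (by linarith)
    rw [min_eq_right h3, max_eq_right h1.le, klFun_apply]
    ring

/-- The Donsker–Varadhan type bound: the divergence is controlled by the dual functional on
bounded continuous functions. -/
lemma klDiv_le_of_forall_boundedContinuous [NormalSpace Z]
    [IsProbabilityMeasure π] [IsProbabilityMeasure μ] [(π + μ).WeaklyRegular] {r : ℝ≥0}
    (h : ∀ f : Z →ᵇ ℝ, ∫ z, f z ∂π - ∫ z, Real.exp (f z) ∂μ + 1 ≤ r) :
    klDiv π μ ≤ r := by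
  have h' {g : Z → ℝ} (hg : Measurable g) {M : ℝ} (hM : ∀ z, |g z| ≤ M) :=
    integral_sub_integral_exp_le_of_forall_boundedContinuous h hg hM
  have hac : π ≪ μ := by
    refine Measure.AbsolutelyContinuous.mk fun A hA hA0 ↦ ?_
    have key (n : ℕ) : n * π.real A ≤ r := by
      have := h' (g := A.indicator fun _ ↦ (n : ℝ)) (measurable_const.indicator hA) (M := n)
        fun z ↦ by by_cases hz : z ∈ A <;> simp [hz]
      have h1 : ∫ z, Real.exp (A.indicator (fun _ ↦ (n : ℝ)) z) ∂μ = 1 := by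
        rw [integral_congr_ae (g := fun _ ↦ (1 : ℝ))]
        · simp
        · filter_upwards [measure_eq_zero_iff_ae_notMem.1 hA0] with z hz
          simp [hz]
      rw [h1, integral_indicator_const _ hA, smul_eq_mul] at this
      linarith
    by_contra hne
    have hpos : 0 < π.real A := by
      rw [measureReal_def]; exact ENNReal.toReal_pos hne (measure_ne_top _ _)
    obtain ⟨n, hn⟩ := exists_nat_gt (r / π.real A)
    rw [div_lt_iff₀ hpos] at hn
    exact absurd (key n) (not_le.2 hn)
  rw [klDiv_eq_lintegral_klFun_of_ac hac]
  let ρ : Z → ℝ := fun z ↦ (π.rnDeriv μ z).toReal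
  have hρm : Measurable ρ := by fun_prop
  have hρi : Integrable ρ μ := Measure.integrable_toReal_rnDeriv
  let c : ℕ → Z → ℝ := fun n z ↦ max ((n : ℝ) + 1)⁻¹ (min ((n : ℝ) + 1) (ρ z))
  have hcm (n : ℕ) : Measurable (c n) := by fun_prop
  have hc1 (n : ℕ) (z : Z) : ((n : ℝ) + 1)⁻¹ ≤ c n z := le_max_left _ _
  have hinv (n : ℕ) : ((n : ℝ) + 1)⁻¹ ≤ (n : ℝ) + 1 :=
    (inv_le_one_of_one_le₀ (by simp)).trans (by simp)
  have hc2 (n : ℕ) (z : Z) : c n z ≤ (n : ℝ) + 1 := max_le (hinv n) (min_le_left _ _)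
  have hc0 (n : ℕ) (z : Z) : 0 < c n z := (by positivity : 0 < ((n : ℝ) + 1)⁻¹).trans_le (hc1 n z)
  have hlog (n : ℕ) (z : Z) : |Real.log (c n z)| ≤ Real.log ((n : ℝ) + 1) := by
    rw [abs_le, ← Real.log_inv]
    exact ⟨Real.log_le_log (by positivity) (hc1 n z), Real.log_le_log (hc0 n z) (hc2 n z)⟩
  let F : ℕ → Z → ℝ := fun n z ↦ ρ z * Real.log (c n z) - c n z + 1
  have hFm (n : ℕ) : Measurable (F n) := by fun_prop
  have hF0 (n : ℕ) (z : Z) : 0 ≤ F n z := nonneg_mul_log_clamp (by simp)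
  have hlogm (n : ℕ) : Measurable fun z ↦ Real.log (c n z) := by fun_prop
  have hi1 (n : ℕ) : Integrable (fun z ↦ ρ z * Real.log (c n z)) μ :=
    hρi.mul_bdd (hlogm n).aestronglyMeasurable (ae_of_all _ (hlog n))
  have hi2 (n : ℕ) : Integrable (c n) μ :=
    Integrable.of_bound (C := n + 1) (hcm n).aestronglyMeasurable
      (ae_of_all _ fun z ↦ by rw [Real.norm_eq_abs, abs_of_pos (hc0 n z)]; exact hc2 n z)
  have hbound (n : ℕ) : ∫⁻ z, ENNReal.ofReal (F n z) ∂μ ≤ r := by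
    have hFi : Integrable (F n) μ := ((hi1 n).sub (hi2 n)).add (integrable_const _)
    rw [← ofReal_integral_eq_lintegral_ofReal hFi (ae_of_all _ (hF0 n)),
      ENNReal.ofReal_le_iff_le_toReal ENNReal.coe_ne_top, ENNReal.coe_toReal]
    have hsplit : ∫ z, F n z ∂μ = ∫ z, Real.log (c n z) ∂π - ∫ z, c n z ∂μ + 1 := by
      have e1 : ∫ z, F n z ∂μ = ∫ z, (ρ z * Real.log (c n z) - c n z) ∂μ + ∫ _, (1 : ℝ) ∂μ :=
        integral_add ((hi1 n).sub (hi2 n)) (integrable_const _)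
      rw [e1, integral_sub (hi1 n) (hi2 n), integral_toReal_rnDeriv_mul hac]
      simp
    have := h' (hlogm n) (hlog n)
    simp only [Real.exp_log (hc0 n _)] at this
    rwa [hsplit]
  calc ∫⁻ z, ENNReal.ofReal (klFun (ρ z)) ∂μ
      = ∫⁻ z, liminf (fun n ↦ ENNReal.ofReal (F n z)) atTop ∂μ := by
        refine lintegral_congr fun z ↦ (Tendsto.liminf_eq ?_).symm
        exact ENNReal.tendsto_ofReal (tendsto_mul_log_clamp ENNReal.toReal_nonneg)
    _ ≤ liminf (fun n ↦ ∫⁻ z, ENNReal.ofReal (F n z) ∂μ) atTop :=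
        lintegral_liminf_le fun n ↦ (hFm n).ennreal_ofReal
    _ ≤ r := liminf_le_of_le (by isBoundedDefault) fun b hb ↦ by
        obtain ⟨n, hn⟩ := hb.exists
        exact hn.trans (hbound n)

/-- Joint weak lower semicontinuity of the Kullback–Leibler divergence. -/
lemma klDiv_le_of_tendsto {Z : Type*} [MeasurableSpace Z] [PseudoEMetricSpace Z] [BorelSpace Z]
    {ι : Type*} {l : Filter ι} [l.NeBot] {πs μs : ι → ProbabilityMeasure Z}
    {π μ : ProbabilityMeasure Z} (hπ : Tendsto πs l (𝓝 π)) (hμ : Tendsto μs l (𝓝 μ)) {r : ℝ≥0}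
    (h : ∀ᶠ i in l, klDiv (πs i : Measure Z) (μs i) ≤ r) :
    klDiv (π : Measure Z) μ ≤ r := by
  refine klDiv_le_of_forall_boundedContinuous fun f ↦ ?_
  have hexp (z : Z) : ‖Real.exp (f z)‖ ≤ Real.exp ‖f‖ := by
    rw [Real.norm_eq_abs, Real.abs_exp]
    exact Real.exp_le_exp.2 ((le_abs_self _).trans (f.norm_coe_le_norm z))
  let e : Z →ᵇ ℝ := BoundedContinuousFunction.ofNormedAddCommGroup
    (fun z ↦ Real.exp (f z)) (by fun_prop) _ hexp
  have h1 := ProbabilityMeasure.tendsto_iff_forall_integral_tendsto.1 hπ f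
  have h2 := ProbabilityMeasure.tendsto_iff_forall_integral_tendsto.1 hμ e
  refine le_of_tendsto ((h1.sub h2).add_const 1) ?_
  filter_upwards [h] with i hi
  refine (integral_sub_integral_exp_le_toReal_klDiv (ne_top_of_le_ne_top (by simp) hi) f).trans ?_
  exact ENNReal.toReal_le_of_le_ofReal r.2 (by simpa using hi)

end Entropy

section Transport

open ProbabilityTheory
open scoped ENNReal NNReal Topology

/-- A finite continuous partition of unity whose members which are charged by `α` have small
support. -/
lemma exists_partitionOfUnity_small_support {X : Type*} [MeasurableSpace X] [MetricSpace X]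
    [BorelSpace X] {K : Set X} (hK : IsCompact K) {α : Measure X} (hα : α Kᶜ = 0)
    {δ : ℝ} (hδ : 0 < δ) :
    ∃ (N : ℕ) (φ : Option (Fin N) → X →ᵇ ℝ), (∀ i x, 0 ≤ φ i x) ∧ (∀ x, ∑ i, φ i x = 1) ∧
      ∀ i, ∫ x, φ i x ∂α = 0 ∨ ∀ x y, φ i x ≠ 0 → φ i y ≠ 0 → dist x y < δ := by
  obtain ⟨t, -, htK⟩ := hK.elim_finite_subcover_image (b := K) (c := fun x ↦ Metric.ball x (δ / 2))
    (fun _ _ ↦ Metric.isOpen_ball)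
    (fun x hx ↦ Set.mem_iUnion₂.2 ⟨x, hx, Metric.mem_ball_self (by positivity)⟩)
  obtain ⟨htf, htK⟩ := htK
  obtain ⟨N, c, -, hc⟩ := htf.fin_param
  obtain ⟨f, hf⟩ := PartitionOfUnity.exists_isSubordinate hK.isClosed
    (fun i : Fin N ↦ Metric.ball (c i) (δ / 2)) (fun _ ↦ Metric.isOpen_ball) (fun x hx ↦ by
      obtain ⟨y, hy, hxy⟩ := Set.mem_iUnion₂.1 (htK hx)
      rw [← hc] at hy
      obtain ⟨i, rfl⟩ := hy
      exact Set.mem_iUnion.2 ⟨i, hxy⟩)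
  have hsum1 (x : X) (hx : x ∈ K) : ∑ i, f i x = 1 := by
    rw [← finsum_eq_sum_of_fintype]; exact f.sum_eq_one hx
  have hsum_le (x : X) : ∑ i, f i x ≤ 1 := by
    rw [← finsum_eq_sum_of_fintype]; exact f.sum_le_one x
  let φ : Option (Fin N) → X →ᵇ ℝ := fun o ↦ match o with
    | none => BoundedContinuousFunction.ofNormedAddCommGroup (fun x ↦ 1 - ∑ i, f i x)
        (by fun_prop) 1 (fun x ↦ by
          rw [Real.norm_eq_abs, abs_le]
          have := hsum_le x
          have := Finset.sum_nonneg (s := Finset.univ) (fun i _ ↦ f.nonneg i x)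
          constructor <;> linarith)
    | some i => BoundedContinuousFunction.ofNormedAddCommGroup (f i) (f i).continuous 1 (fun x ↦ by
          rw [Real.norm_eq_abs, abs_of_nonneg (f.nonneg i x)]
          exact f.le_one i x)
  have hnone (x : X) : φ none x = 1 - ∑ i, f i x := rfl
  have hsome (i : Fin N) (x : X) : φ (some i) x = f i x := rfl
  refine ⟨N, φ, fun i x ↦ ?_, fun x ↦ ?_, fun i ↦ ?_⟩
  · cases i with
    | none => rw [hnone]; linarith [hsum_le x]
    | some i => exact f.nonneg i x
  · simp [Fintype.sum_option, hnone, hsome]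
  · cases i with
    | none =>
      left
      refine integral_eq_zero_of_ae ?_
      have : ∀ᵐ x ∂α, x ∈ K := hα
      filter_upwards [this] with x hx
      simp [hnone, hsum1 x hx]
    | some i =>
      right
      intro x y hx hy
      have hx' := Metric.mem_ball.1 (hf i (subset_tsupport _ hx))
      have hy' := Metric.mem_ball.1 (hf i (subset_tsupport _ hy))
      have := dist_triangle_right x y (c i)
      linarith

set_option maxHeartbeats 800000 in
/-- Weakly close measures are related by a Markov kernel moving little mass far away. -/
lemma eventually_exists_kernel_near_id {X : Type*} [MeasurableSpace X] [MetricSpace X]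
    [BorelSpace X] {K : Set X} (hK : IsCompact K) {α : Measure X} [IsProbabilityMeasure α]
    (hα : α Kᶜ = 0) {ι : Type*} {l : Filter ι} {αs : ι → Measure X}
    [∀ n, IsProbabilityMeasure (αs n)]
    (hweak : ∀ f : X →ᵇ ℝ, Tendsto (fun n ↦ ∫ x, f x ∂(αs n)) l (𝓝 (∫ x, f x ∂α)))
    {δ : ℝ} (hδ : 0 < δ) :
    ∀ᶠ n in l, ∃ κ : Kernel X X, IsMarkovKernel κ ∧ κ ∘ₘ α = αs n ∧
      ∀ᵐ x ∂α, κ x {y | δ ≤ dist x y} ≤ ENNReal.ofReal δ := by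
  obtain ⟨N, φ, hφ0, hφ1, hφ⟩ := exists_partitionOfUnity_small_support hK hα hδ
  have hφm (i) : Measurable (φ i) := (φ i).continuous.measurable
  set a : Option (Fin N) → ℝ := fun i ↦ ∫ x, φ i x ∂α with ha
  have ha0 (i) : 0 ≤ a i := integral_nonneg (hφ0 i)
  have hasum : ∑ i, a i = 1 := by
    rw [← integral_finsetSum _ fun i _ ↦ (φ i).integrable α]; simp [hφ1]
  set t : ℝ := 1 / (1 + δ) with ht
  have ht0 : 0 < t := by positivity
  have ht1 : t < 1 := by rw [ht, div_lt_one (by positivity)]; linarith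
  have htδ : 1 - t ≤ δ := by
    have : 1 - t = δ / (1 + δ) := by rw [ht]; field_simp; ring
    rw [this]; exact div_le_self hδ.le (by linarith)
  have hev : ∀ᶠ n in l, ∀ i, t * a i ≤ ∫ x, φ i x ∂(αs n) := by
    refine eventually_all.2 fun i ↦ ?_
    rcases (ha0 i).eq_or_lt with h | h
    · exact Eventually.of_forall fun n ↦ by
        rw [← h, mul_zero]; exact integral_nonneg (hφ0 i)
    · have : t * a i < a i := by nlinarith
      exact ((hweak (φ i)).eventually_const_lt this).mono fun n hn ↦ hn.le
  filter_upwards [hev] with n hn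
  set b : Option (Fin N) → ℝ := fun i ↦ ∫ x, φ i x ∂(αs n) with hb
  have hb0 (i) : 0 ≤ b i := integral_nonneg (hφ0 i)
  have hbsum : ∑ i, b i = 1 := by
    rw [← integral_finsetSum _ fun i _ ↦ (φ i).integrable (αs n)]; simp [hφ1]
  set s : Option (Fin N) → ℝ := fun i ↦ t * a i / b i with hs
  have hs0 (i) : 0 ≤ s i := div_nonneg (mul_nonneg ht0.le (ha0 i)) (hb0 i)
  have hs1 (i) : s i ≤ 1 := div_le_one_of_le₀ (hn i) (hb0 i)
  have hsb (i) : s i * b i = t * a i := by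
    rcases (hb0 i).eq_or_lt with h | h
    · have h1 := hn i
      have h2 := mul_nonneg ht0.le (ha0 i)
      rw [← h, mul_zero]; linarith
    · exact div_mul_cancel₀ _ h.ne'
  have hsa (i) (h : a i = 0) : s i = 0 := by simp [hs, h]
  let R : X → ℝ := fun x ↦ ∑ j, (1 - s j) * φ j x
  have hR0 (x) : 0 ≤ R x :=
    Finset.sum_nonneg fun j _ ↦ mul_nonneg (by linarith [hs1 j]) (hφ0 j x)
  have hRi : Integrable R (αs n) :=
    integrable_finsetSum _ fun j _ ↦ ((φ j).integrable _).const_mul _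
  have hRint : ∫ x, R x ∂(αs n) = 1 - t := by
    have : ∫ x, R x ∂(αs n) = ∑ j, (1 - s j) * b j := by
      simp only [R]
      rw [integral_finsetSum _ fun j _ ↦ ((φ j).integrable _).const_mul _]
      simp only [integral_const_mul, hb]
    rw [this]
    simp only [sub_mul, one_mul, hsb, Finset.sum_sub_distrib, hbsum, ← Finset.mul_sum, hasum,
      mul_one]
  let h : Option (Fin N) → X → ℝ := fun i x ↦ if a i = 0 then 1 else s i / a i * φ i x + R x
  have hhm (i) : Measurable (h i) := by
    by_cases hi : a i = 0 <;> simp only [h, hi, if_true, if_false] <;> fun_prop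
  have hh0 (i x) : 0 ≤ h i x := by
    simp only [h]
    split_ifs
    · exact zero_le_one
    · exact add_nonneg (mul_nonneg (div_nonneg (hs0 i) (ha0 i)) (hφ0 i x)) (hR0 x)
  have hhi (i) : Integrable (h i) (αs n) := by
    by_cases hi : a i = 0
    · simp only [h, hi, if_true]; exact integrable_const _
    · simp only [h, hi, if_false]; exact (((φ i).integrable _).const_mul _).add hRi
  have hhint (i) : ∫ x, h i x ∂(αs n) = 1 := by
    by_cases hi : a i = 0
    · simp [h, hi]
    · simp only [h, hi, if_false]
      rw [integral_add (((φ i).integrable _).const_mul _) hRi, integral_const_mul, hRint]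
      have : s i / a i * b i = t := by rw [div_mul_eq_mul_div, hsb, mul_div_cancel_right₀ _ hi]
      rw [this]; ring
  have hhsum (x) : ∑ i, a i * h i x = 1 := by
    have hterm (i) : a i * h i x = s i * φ i x + a i * R x := by
      by_cases hi : a i = 0
      · simp [h, hi, hsa i hi]
      · simp only [h, hi, if_false]; field_simp
    simp only [hterm, Finset.sum_add_distrib, ← Finset.sum_mul, hasum, R]
    rw [one_mul, ← Finset.sum_add_distrib]
    exact (Finset.sum_congr rfl fun i _ ↦ by ring).trans (hφ1 x)
  let ν : Option (Fin N) → Measure X := fun i ↦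
    (αs n).withDensity fun x ↦ ENNReal.ofReal (h i x)
  have hν (i) : IsProbabilityMeasure (ν i) := by
    constructor
    rw [withDensity_apply _ MeasurableSet.univ, setLIntegral_univ,
      ← ofReal_integral_eq_lintegral_ofReal (hhi i) (ae_of_all _ (hh0 i)), hhint,
      ENNReal.ofReal_one]
  have happ (x : X) (S : Set X) : (∑ i, ENNReal.ofReal (φ i x) • ν i) S =
      ∑ i, ENNReal.ofReal (φ i x) * ν i S := by
    simp
  let κ : Kernel X X := ⟨fun x ↦ ∑ i, ENNReal.ofReal (φ i x) • ν i, by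
    refine Measure.measurable_of_measurable_coe _ fun S _ ↦ ?_
    simp only [happ]
    fun_prop⟩
  have hκ (x : X) (S : Set X) : κ x S = ∑ i, ENNReal.ofReal (φ i x) * ν i S := happ x S
  have hone (x : X) : ∑ i, ENNReal.ofReal (φ i x) = 1 := by
    rw [← ENNReal.ofReal_sum_of_nonneg fun i _ ↦ hφ0 i x, hφ1, ENNReal.ofReal_one]
  refine ⟨κ, ⟨fun x ↦ ⟨?_⟩⟩, ?_, ?_⟩
  · rw [hκ]; simp [hone]
  · ext S hS
    rw [Measure.bind_apply hS κ.measurable.aemeasurable]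
    simp only [hκ]
    rw [lintegral_finsetSum _ fun i _ ↦ by fun_prop]
    have hterm (i) : ∫⁻ x, ENNReal.ofReal (φ i x) * ν i S ∂α =
        ∫⁻ x in S, ENNReal.ofReal (a i * h i x) ∂(αs n) := by
      rw [lintegral_mul_const _ (by fun_prop),
        ← ofReal_integral_eq_lintegral_ofReal ((φ i).integrable α) (ae_of_all _ (hφ0 i)),
        withDensity_apply _ hS, ← lintegral_const_mul _ (by fun_prop)]
      exact lintegral_congr fun x ↦ (ENNReal.ofReal_mul (ha0 i)).symm
    simp only [hterm]
    rw [← lintegral_finsetSum _ fun i _ ↦ by fun_prop]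
    simp only [← ENNReal.ofReal_sum_of_nonneg fun i _ ↦ mul_nonneg (ha0 i) (hh0 i _), hhsum]
    simp
  · have hae : ∀ᵐ x ∂α, ∀ i, a i = 0 → φ i x = 0 := by
      refine ae_all_iff.2 fun i ↦ ?_
      by_cases hi : a i = 0
      · filter_upwards [(integral_eq_zero_iff_of_nonneg (hφ0 i) ((φ i).integrable α)).1 hi]
          with x hx _ using hx
      · exact ae_of_all _ fun x hx ↦ absurd hx hi
    filter_upwards [hae] with x hx
    have hterm (i) : ENNReal.ofReal (φ i x) * ν i {y | δ ≤ dist x y} ≤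
        ENNReal.ofReal (φ i x) * ENNReal.ofReal δ := by
      by_cases hxi : φ i x = 0
      · simp [hxi]
      have hai : a i ≠ 0 := fun h0 ↦ hxi (hx i h0)
      gcongr
      have hS : MeasurableSet {y | δ ≤ dist x y} := by measurability
      rw [withDensity_apply _ hS]
      calc ∫⁻ y in {y | δ ≤ dist x y}, ENNReal.ofReal (h i y) ∂(αs n)
          = ∫⁻ y in {y | δ ≤ dist x y}, ENNReal.ofReal (R y) ∂(αs n) := by
            refine setLIntegral_congr_fun hS fun y hy ↦ ?_
            have : φ i y = 0 := by
              by_contra hne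
              exact absurd (((hφ i).resolve_left hai) x y hxi hne) (not_lt.2 hy)
            have hhR : h i y = R y := by simp only [h, if_neg hai, this, mul_zero, zero_add]
            simp only [hhR]
        _ ≤ ∫⁻ y, ENNReal.ofReal (R y) ∂(αs n) := setLIntegral_le_lintegral _ _
        _ = ENNReal.ofReal (1 - t) := by
            rw [← ofReal_integral_eq_lintegral_ofReal hRi (ae_of_all _ hR0), hRint]
        _ ≤ ENNReal.ofReal δ := ENNReal.ofReal_le_ofReal htδ
    rw [hκ]
    refine (Finset.sum_le_sum fun i _ ↦ hterm i).trans ?_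
    rw [← Finset.sum_mul, hone, one_mul]

end Transport

section Recovery

open ProbabilityTheory InformationTheory
open scoped ENNReal NNReal Topology

lemma integral_prod_self_le_of_coupling {Z : Type*} [MeasurableSpace Z] [PseudoMetricSpace Z]
    [SecondCountableTopology Z] [BorelSpace Z] {K : Set Z} {γ : Measure (Z × Z)}
    [IsProbabilityMeasure γ] (hγ : ∀ᵐ p ∂γ, p.1 ∈ K ∧ p.2 ∈ K) {C : Z × Z →ᵇ ℝ} {δ η r : ℝ}
    (hη : 0 ≤ η) (hr : 0 ≤ r) (hfar : γ {p | δ ≤ dist p.1 p.2} ≤ ENNReal.ofReal r)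
    (hC : ∀ p ∈ K, ∀ p' ∈ K, ∀ q ∈ K, ∀ q' ∈ K, dist p p' < δ → dist q q' < δ →
      C (p', q') ≤ C (p, q) + η) :
    ∫ z, C z ∂((γ.map Prod.snd).prod (γ.map Prod.snd)) ≤
      ∫ z, C z ∂((γ.map Prod.fst).prod (γ.map Prod.fst)) + η + 4 * ‖C‖ * r := by
  set B : Set (Z × Z) := {p | δ ≤ dist p.1 p.2}
  have hBm : MeasurableSet B :=
    measurableSet_le measurable_const (measurable_fst.dist measurable_snd)
  have hBr : γ.real B ≤ r := ENNReal.toReal_le_of_le_ofReal hr hfar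
  have hCm : Measurable C := C.continuous.measurable
  rw [Measure.map_prod_map _ _ measurable_snd measurable_snd,
    Measure.map_prod_map _ _ measurable_fst measurable_fst,
    integral_map (by fun_prop) hCm.aestronglyMeasurable,
    integral_map (by fun_prop) hCm.aestronglyMeasurable]
  set g : Z × Z → ℝ := B.indicator 1 with hg
  have hgi : Integrable g γ := (integrable_const (1 : ℝ)).indicator hBm
  have hint (f : (Z × Z) × (Z × Z) → Z × Z) (hf : Measurable f) :
      Integrable (fun P ↦ C (f P)) (γ.prod γ) :=
    Integrable.of_bound (hCm.comp hf).aestronglyMeasurable ‖C‖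
      (ae_of_all _ fun P ↦ C.norm_coe_le_norm _)
  have hγ1 : ∀ᵐ P ∂(γ.prod γ), P.1.1 ∈ K ∧ P.1.2 ∈ K := Measure.quasiMeasurePreserving_fst.ae hγ
  have hγ2 : ∀ᵐ P ∂(γ.prod γ), P.2.1 ∈ K ∧ P.2.2 ∈ K := Measure.quasiMeasurePreserving_snd.ae hγ
  have hg1 : Integrable (fun P ↦ g P.1) (γ.prod γ) := hgi.comp_fst γ
  have hg2 : Integrable (fun P ↦ g P.2) (γ.prod γ) := hgi.comp_snd γ
  have hi1 := hint (Prod.map Prod.fst Prod.fst) (by fun_prop)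
  have hi2 := hint (Prod.map Prod.snd Prod.snd) (by fun_prop)
  have hi3 : Integrable (fun P ↦ C (Prod.map Prod.fst Prod.fst P) + η) (γ.prod γ) :=
    hi1.add (integrable_const η)
  have hi4 : Integrable (fun P : (Z × Z) × (Z × Z) ↦ 2 * ‖C‖ * (g P.1 + g P.2)) (γ.prod γ) :=
    (hg1.add hg2).const_mul _
  have hgint : ∫ p, g p ∂γ = γ.real B := by
    rw [hg, integral_indicator_one hBm]
  calc ∫ P, C (Prod.map Prod.snd Prod.snd P) ∂(γ.prod γ)
      ≤ ∫ P, (C (Prod.map Prod.fst Prod.fst P) + η +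
          (2 * ‖C‖) * (g P.1 + g P.2)) ∂(γ.prod γ) := by
        refine integral_mono_ae hi2 (hi3.add hi4) ?_
        filter_upwards [hγ1, hγ2] with P h1 h2
        have hb1 := abs_le.1 (C.norm_coe_le_norm (P.1.2, P.2.2))
        have hb2 := abs_le.1 (C.norm_coe_le_norm (P.1.1, P.2.1))
        have hg0 (p) : 0 ≤ g p := Set.indicator_nonneg (fun _ _ ↦ zero_le_one) p
        have hgB (p) (hp : p ∈ B) : g p = 1 := Set.indicator_of_mem hp _
        have hN := norm_nonneg C
        simp only [Prod.map]
        by_cases hP1 : P.1 ∈ B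
        · rw [hgB _ hP1]
          nlinarith [mul_nonneg hN (hg0 P.2)]
        by_cases hP2 : P.2 ∈ B
        · rw [hgB _ hP2]
          nlinarith [mul_nonneg hN (hg0 P.1)]
        have := hC _ h1.1 _ h1.2 _ h2.1 _ h2.2 (not_le.1 hP1) (not_le.1 hP2)
        nlinarith [mul_nonneg hN (hg0 P.1), mul_nonneg hN (hg0 P.2)]
    _ = ∫ P, C (Prod.map Prod.fst Prod.fst P) ∂(γ.prod γ) + η + 4 * ‖C‖ * γ.real B := by
        rw [integral_add hi3 hi4,
          integral_add hi1 (integrable_const η), integral_const_mul, integral_add hg1 hg2,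
          integral_fun_fst, integral_fun_snd, hgint]
        simp
        ring
    _ ≤ _ := by gcongr

lemma exists_recovery_coupling {X Y : Type*} [MeasurableSpace X] [PseudoMetricSpace X]
    [SecondCountableTopology X] [BorelSpace X] [MeasurableSpace Y] [PseudoMetricSpace Y]
    [SecondCountableTopology Y] [BorelSpace Y] (π : Measure (X × Y)) [IsProbabilityMeasure π]
    (κ₁ : Kernel X X) [IsMarkovKernel κ₁] (κ₂ : Kernel Y Y) [IsMarkovKernel κ₂] {δ : ℝ}
    (hδ : 0 ≤ δ)
    (h₁ : ∀ᵐ x ∂(π.map Prod.fst), κ₁ x {y | δ ≤ dist x y} ≤ ENNReal.ofReal δ)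
    (h₂ : ∀ᵐ x ∂(π.map Prod.snd), κ₂ x {y | δ ≤ dist x y} ≤ ENNReal.ofReal δ) :
    ∃ γ : Measure ((X × Y) × (X × Y)), IsProbabilityMeasure γ ∧ γ.map Prod.fst = π ∧
      (γ.map Prod.snd).map Prod.fst = κ₁ ∘ₘ π.map Prod.fst ∧
      (γ.map Prod.snd).map Prod.snd = κ₂ ∘ₘ π.map Prod.snd ∧
      γ {p | δ ≤ dist p.1 p.2} ≤ ENNReal.ofReal (2 * δ) ∧
      klDiv (γ.map Prod.snd) ((κ₁ ∘ₘ π.map Prod.fst).prod (κ₂ ∘ₘ π.map Prod.snd)) ≤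
        klDiv π ((π.map Prod.fst).prod (π.map Prod.snd)) := by
  have : IsProbabilityMeasure (π.map Prod.fst) := Measure.isProbabilityMeasure_map (by fun_prop)
  have : IsProbabilityMeasure (π.map Prod.snd) := Measure.isProbabilityMeasure_map (by fun_prop)
  have hfst : (π ⊗ₘ (κ₁ ∥ₖ κ₂)).map Prod.fst = π := Measure.fst_compProd π _
  have hsnd : (π ⊗ₘ (κ₁ ∥ₖ κ₂)).map Prod.snd = (κ₁ ∥ₖ κ₂) ∘ₘ π := Measure.snd_compProd π _
  refine ⟨π ⊗ₘ (κ₁ ∥ₖ κ₂), inferInstance, hfst, ?_, ?_, ?_, ?_⟩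
  · rw [hsnd]
    ext S hS
    rw [Measure.map_apply measurable_fst hS,
      Measure.bind_apply (measurable_fst hS) (Kernel.aemeasurable _),
      Measure.bind_apply hS (Kernel.aemeasurable _),
      lintegral_map (κ₁.measurable_coe hS) measurable_fst]
    refine lintegral_congr fun z ↦ ?_
    rw [← Set.prod_univ, Kernel.parallelComp_apply_prod, measure_univ, mul_one]
  · rw [hsnd]
    ext S hS
    rw [Measure.map_apply measurable_snd hS,
      Measure.bind_apply (measurable_snd hS) (Kernel.aemeasurable _),
      Measure.bind_apply hS (Kernel.aemeasurable _),
      lintegral_map (κ₂.measurable_coe hS) measurable_snd]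
    refine lintegral_congr fun z ↦ ?_
    rw [← Set.univ_prod, Kernel.parallelComp_apply_prod, measure_univ, one_mul]
  · have hm : MeasurableSet {p : (X × Y) × (X × Y) | δ ≤ dist p.1 p.2} :=
      measurableSet_le measurable_const (measurable_fst.dist measurable_snd)
    rw [Measure.compProd_apply hm]
    calc ∫⁻ z, (κ₁ ∥ₖ κ₂) z (Prod.mk z ⁻¹' {p | δ ≤ dist p.1 p.2}) ∂π
        ≤ ∫⁻ _, ENNReal.ofReal (2 * δ) ∂π := by
          refine lintegral_mono_ae ?_
          filter_upwards [ae_of_ae_map (by fun_prop) h₁, ae_of_ae_map (by fun_prop) h₂]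
            with z hz₁ hz₂
          have hsub : Prod.mk z ⁻¹' {p : (X × Y) × (X × Y) | δ ≤ dist p.1 p.2} ⊆
              {y | δ ≤ dist z.1 y} ×ˢ Set.univ ∪ Set.univ ×ˢ {y | δ ≤ dist z.2 y} := by
            intro w hw
            have hw' : δ ≤ max (dist z.1 w.1) (dist z.2 w.2) := hw
            rcases le_max_iff.1 hw' with h | h
            · exact Or.inl ⟨h, trivial⟩
            · exact Or.inr ⟨trivial, h⟩
          refine (measure_mono hsub).trans ((measure_union_le _ _).trans ?_)
          rw [Kernel.parallelComp_apply_prod, Kernel.parallelComp_apply_prod, measure_univ,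
            measure_univ, mul_one, one_mul, two_mul, ENNReal.ofReal_add hδ hδ]
          exact add_le_add hz₁ hz₂
      _ = ENNReal.ofReal (2 * δ) := by simp
  · have hprod : (κ₁ ∥ₖ κ₂) ∘ₘ ((π.map Prod.fst).prod (π.map Prod.snd)) =
        (κ₁ ∘ₘ π.map Prod.fst).prod (κ₂ ∘ₘ π.map Prod.snd) := by
      refine (Measure.prod_eq fun S T hS hT ↦ ?_).symm
      rw [Measure.bind_apply (hS.prod hT) (Kernel.aemeasurable _),
        Measure.bind_apply hS (Kernel.aemeasurable _),
        Measure.bind_apply hT (Kernel.aemeasurable _)]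
      simp only [Kernel.parallelComp_apply_prod]
      exact lintegral_prod_mul (κ₁.measurable_coe hS).aemeasurable
        (κ₂.measurable_coe hT).aemeasurable
    rw [hsnd, ← hprod]
    exact klDiv_comp_right_le _ _ _

end Recovery

section Limits

open ProbabilityTheory InformationTheory
open scoped ENNReal NNReal Topology

lemma le_toNNReal_of_add_mul_le {J ε a : ℝ} (hε : 0 < ε) {k : ℝ≥0∞}
    (h : (J : EReal) + (ε : EReal) * (k : EReal) ≤ a) : k ≤ ((a - J) / ε).toNNReal := by
  induction k with
  | top =>
    rw [EReal.coe_ennreal_top, EReal.coe_mul_top_of_pos hε, EReal.coe_add_top] at h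
    exact absurd h (not_le.2 (EReal.coe_lt_top a))
  | coe k =>
    have h' : J + ε * k ≤ a := by
      rw [EReal.coe_nnreal_eq_coe_real] at h
      exact_mod_cast h
    rw [ENNReal.coe_le_coe]
    refine NNReal.le_toNNReal_of_coe_le ?_
    rw [le_div_iff₀ hε]
    linarith

lemma add_mul_le_of_le_toNNReal {J ε a : ℝ} (hε : 0 < ε) (hJ : J ≤ a) {k : ℝ≥0∞}
    (h : k ≤ ((a - J) / ε).toNNReal) : (J : EReal) + (ε : EReal) * (k : EReal) ≤ a := by
  lift k to ℝ≥0 using ne_top_of_le_ne_top ENNReal.coe_ne_top h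
  have h' : (k : ℝ) ≤ (a - J) / ε := by
    rw [ENNReal.coe_le_coe] at h
    exact (NNReal.coe_le_coe.2 h).trans_eq (Real.coe_toNNReal _ (div_nonneg (by linarith) hε.le))
  rw [le_div_iff₀ hε] at h'
  rw [EReal.coe_nnreal_eq_coe_real]
  have : J + ε * k ≤ a := by linarith
  exact_mod_cast this

lemma ae_mem_prod_of_marginals {X Y : Type*} [MeasurableSpace X] [MeasurableSpace Y]
    {π : Measure (X × Y)} {KX : Set X} {KY : Set Y}
    (hX : π.map Prod.fst KXᶜ = 0) (hY : π.map Prod.snd KYᶜ = 0) : ∀ᵐ z ∂π, z ∈ KX ×ˢ KY := by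
  have hX' : ∀ᵐ x ∂(π.map Prod.fst), x ∈ KX := hX
  have hY' : ∀ᵐ x ∂(π.map Prod.snd), x ∈ KY := hY
  filter_upwards [ae_of_ae_map (by fun_prop) hX', ae_of_ae_map (by fun_prop) hY'] with z h₁ h₂
    using ⟨h₁, h₂⟩

lemma isProbabilityMeasure_of_map_fst {X Y : Type*} [MeasurableSpace X] [MeasurableSpace Y]
    {π : Measure (X × Y)} {α : Measure X}
    [IsProbabilityMeasure α] (h : π.map Prod.fst = α) : IsProbabilityMeasure π := by
  constructor
  rw [← measure_univ (μ := α), ← h, Measure.map_apply measurable_fst MeasurableSet.univ,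
    Set.preimage_univ]

variable {X Y : Type*} [MeasurableSpace X] [MetricSpace X]
    [SecondCountableTopology X] [BorelSpace X] [MeasurableSpace Y] [MetricSpace Y]
    [SecondCountableTopology Y] [BorelSpace Y]

lemma eventually_exists_coupling_le {KX : Set X} {KY : Set Y} (hKX : IsCompact KX)
    (hKY : IsCompact KY) {ι : Type*} {l : Filter ι} {αs : ι → Measure X} {βs : ι → Measure Y}
    [∀ n, IsProbabilityMeasure (αs n)] [∀ n, IsProbabilityMeasure (βs n)]
    (hαsK : ∀ n, αs n KXᶜ = 0) (hβsK : ∀ n, βs n KYᶜ = 0)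
    {π : Measure (X × Y)} [IsProbabilityMeasure π]
    (hαK : π.map Prod.fst KXᶜ = 0) (hβK : π.map Prod.snd KYᶜ = 0)
    (hα : ∀ f : X →ᵇ ℝ, Tendsto (fun n ↦ ∫ x, f x ∂(αs n)) l (𝓝 (∫ x, f x ∂(π.map Prod.fst))))
    (hβ : ∀ f : Y →ᵇ ℝ, Tendsto (fun n ↦ ∫ x, f x ∂(βs n)) l (𝓝 (∫ x, f x ∂(π.map Prod.snd))))
    (C : (X × Y) × (X × Y) →ᵇ ℝ) {η : ℝ} (hη : 0 < η) :
    ∀ᶠ n in l, ∃ π' : Measure (X × Y), π'.map Prod.fst = αs n ∧ π'.map Prod.snd = βs n ∧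
      ∫ z, C z ∂(π'.prod π') ≤ ∫ z, C z ∂(π.prod π) + η ∧
      klDiv π' ((αs n).prod (βs n)) ≤ klDiv π ((π.map Prod.fst).prod (π.map Prod.snd)) := by
  have : IsProbabilityMeasure (π.map Prod.fst) := Measure.isProbabilityMeasure_map (by fun_prop)
  have : IsProbabilityMeasure (π.map Prod.snd) := Measure.isProbabilityMeasure_map (by fun_prop)
  set K := KX ×ˢ KY
  have hK : IsCompact K := hKX.prod hKY
  have huc := (hK.prod hK).uniformContinuousOn_of_continuous C.continuous.continuousOn
  obtain ⟨δ₀, hδ₀, hC⟩ := Metric.uniformContinuousOn_iff.1 huc (η / 2) (by positivity)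
  set δ := min δ₀ (η / (16 * (‖C‖ + 1)))
  have hN := norm_nonneg C
  have hδ : 0 < δ := lt_min hδ₀ (by positivity)
  have hδη : 4 * ‖C‖ * (2 * δ) ≤ η / 2 := by
    have h1 : δ ≤ η / (16 * (‖C‖ + 1)) := min_le_right _ _
    rw [le_div_iff₀ (by positivity)] at h1
    nlinarith
  filter_upwards [eventually_exists_kernel_near_id hKX hαK hα hδ,
    eventually_exists_kernel_near_id hKY hβK hβ hδ] with n ⟨κ₁, hκ₁, hκα, hκ₁δ⟩ ⟨κ₂, hκ₂, hκβ, hκ₂δ⟩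
  obtain ⟨γ, hγ, hγ1, hγα, hγβ, hγδ, hkl⟩ := exists_recovery_coupling π κ₁ κ₂ hδ.le hκ₁δ hκ₂δ
  rw [hκα, hκβ] at hkl
  rw [hκα] at hγα
  rw [hκβ] at hγβ
  refine ⟨γ.map Prod.snd, hγα, hγβ, ?_, hkl⟩
  have h1 : ∀ᵐ p ∂γ, p.1 ∈ K := by
    have h := ae_mem_prod_of_marginals hαK hβK
    rw [← hγ1] at h
    exact ae_of_ae_map (by fun_prop) h
  have h2 : ∀ᵐ p ∂γ, p.2 ∈ K := by
    have h := ae_mem_prod_of_marginals (π := γ.map Prod.snd) (KX := KX) (KY := KY)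
      (by rw [hγα]; exact hαsK n) (by rw [hγβ]; exact hβsK n)
    exact ae_of_ae_map (by fun_prop) h
  have key := integral_prod_self_le_of_coupling (h1.and h2) (C := C) (η := η / 2)
    (by positivity) (by positivity) hγδ fun p hp p' hp' q hq q' hq' hpp hqq ↦ by
      have hd : dist (p', q') (p, q) < δ₀ := by
        rw [Prod.dist_eq, max_lt_iff, dist_comm p', dist_comm q']
        exact ⟨hpp.trans_le (min_le_left _ _), hqq.trans_le (min_le_left _ _)⟩
      have := hC _ ⟨hp', hq'⟩ _ ⟨hp, hq⟩ hd
      rw [Real.dist_eq] at this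
      linarith [(abs_lt.1 this).2]
  rw [hγ1] at key
  linarith

lemma exists_coupling_le_of_frequently {KX : Set X} {KY : Set Y} (hKX : IsCompact KX)
    (hKY : IsCompact KY) {ι : Type*} {l : Filter ι} {αs : ι → Measure X} {βs : ι → Measure Y}
    [∀ n, IsProbabilityMeasure (αs n)] [∀ n, IsProbabilityMeasure (βs n)]
    (hαsK : ∀ n, αs n KXᶜ = 0) (hβsK : ∀ n, βs n KYᶜ = 0)
    {α : Measure X} {β : Measure Y} [IsProbabilityMeasure α] [IsProbabilityMeasure β]
    (hα : ∀ f : X →ᵇ ℝ, Tendsto (fun n ↦ ∫ x, f x ∂(αs n)) l (𝓝 (∫ x, f x ∂α)))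
    (hβ : ∀ f : Y →ᵇ ℝ, Tendsto (fun n ↦ ∫ x, f x ∂(βs n)) l (𝓝 (∫ x, f x ∂β)))
    (C : (X × Y) × (X × Y) →ᵇ ℝ) {ε a b : ℝ} (hε : 0 ≤ ε) (hab : a < b)
    (hfr : ∃ᶠ n in l, ∃ π : Measure (X × Y), π.map Prod.fst = αs n ∧ π.map Prod.snd = βs n ∧
      ((∫ z, C z ∂(π.prod π) : ℝ) : EReal) +
        (ε : EReal) * (klDiv π ((αs n).prod (βs n)) : EReal) ≤ a) :
    ∃ π : Measure (X × Y), π.map Prod.fst = α ∧ π.map Prod.snd = β ∧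
      ((∫ z, C z ∂(π.prod π) : ℝ) : EReal) +
        (ε : EReal) * (klDiv π (α.prod β) : EReal) ≤ b := by
  let αP : ProbabilityMeasure X := ⟨α, inferInstance⟩
  let βP : ProbabilityMeasure Y := ⟨β, inferInstance⟩
  let αsP : ι → ProbabilityMeasure X := fun n ↦ ⟨αs n, inferInstance⟩
  let βsP : ι → ProbabilityMeasure Y := fun n ↦ ⟨βs n, inferInstance⟩
  have hαP : Tendsto αsP l (𝓝 αP) :=
    ProbabilityMeasure.tendsto_iff_forall_integral_tendsto.2 hα
  have hβP : Tendsto βsP l (𝓝 βP) :=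
    ProbabilityMeasure.tendsto_iff_forall_integral_tendsto.2 hβ
  let S : Set ι := {n | ∃ π : Measure (X × Y), π.map Prod.fst = αs n ∧ π.map Prod.snd = βs n ∧
      ((∫ z, C z ∂(π.prod π) : ℝ) : EReal) +
        (ε : EReal) * (klDiv π ((αs n).prod (βs n)) : EReal) ≤ a}
  have hne : (l ⊓ 𝓟 S).NeBot := frequently_iff_neBot.1 hfr
  let U : Ultrafilter ι := Ultrafilter.of (l ⊓ 𝓟 S)
  have hUle : (U : Filter ι) ≤ l ⊓ 𝓟 S := Ultrafilter.of_le _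
  have hUl : (U : Filter ι) ≤ l := hUle.trans inf_le_left
  have hUS : ∀ᶠ n in (U : Filter ι), n ∈ S := le_principal_iff.1 (hUle.trans inf_le_right)
  have hex (n : ι) : ∃ P : ProbabilityMeasure (X × Y), n ∈ S →
      (P : Measure (X × Y)).map Prod.fst = αs n ∧ (P : Measure (X × Y)).map Prod.snd = βs n ∧
      ((∫ z, C z ∂((P : Measure (X × Y)).prod P) : ℝ) : EReal) +
        (ε : EReal) * (klDiv (P : Measure (X × Y)) ((αs n).prod (βs n)) : EReal) ≤ a := by
    by_cases hn : n ∈ S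
    · obtain ⟨π, h1, h2, h3⟩ := hn
      exact ⟨⟨π, isProbabilityMeasure_of_map_fst h1⟩, fun _ ↦ ⟨h1, h2, h3⟩⟩
    · exact ⟨αP.prod βP, fun h ↦ absurd h hn⟩
  choose πs hπs using hex
  have hcomp : IsCompact {μ : ProbabilityMeasure (X × Y) | ∀ _ : ℕ, μ (KX ×ˢ KY)ᶜ ≤ 0} :=
    isCompact_setOfPred_probabilityMeasure_mass_eq_compl_isCompact_le (u := fun _ ↦ 0)
      (K := fun _ ↦ KX ×ˢ KY) tendsto_const_nhds (fun _ ↦ hKX.prod hKY) (Or.inl inferInstance)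
  obtain ⟨π, -, hπ⟩ := hcomp.ultrafilter_le_nhds' (U.map πs) (by
    rw [Ultrafilter.mem_map]
    filter_upwards [hUS] with n hn _
    obtain ⟨h1, h2, -⟩ := hπs n hn
    have h := ae_mem_prod_of_marginals (π := (πs n : Measure (X × Y))) (KX := KX) (KY := KY)
      (by rw [h1]; exact hαsK n) (by rw [h2]; exact hβsK n)
    rw [nonpos_iff_eq_zero, ProbabilityMeasure.null_iff_toMeasure_null]
    exact h)
  have hπt : Tendsto πs U (𝓝 π) := hπ
  have hfst : (π : Measure (X × Y)).map Prod.fst = α := by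
    have h1 := ProbabilityMeasure.tendsto_map_of_tendsto_of_continuous _ _ hπt continuous_fst
    have h2 : Tendsto αsP U (𝓝 (π.map continuous_fst.measurable.aemeasurable)) :=
      h1.congr' (hUS.mono fun n hn ↦ Subtype.ext (hπs n hn).1)
    exact congrArg Subtype.val (tendsto_nhds_unique (X := ProbabilityMeasure X) h2 (hαP.mono_left hUl))
  have hsnd : (π : Measure (X × Y)).map Prod.snd = β := by
    have h1 := ProbabilityMeasure.tendsto_map_of_tendsto_of_continuous _ _ hπt continuous_snd
    have h2 : Tendsto βsP U (𝓝 (π.map continuous_snd.measurable.aemeasurable)) :=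
      h1.congr' (hUS.mono fun n hn ↦ Subtype.ext (hπs n hn).2.1)
    exact congrArg Subtype.val (tendsto_nhds_unique (X := ProbabilityMeasure Y) h2 (hβP.mono_left hUl))
  have hprod : Tendsto (fun n ↦ (αsP n).prod (βsP n)) U (𝓝 (αP.prod βP)) :=
    (ProbabilityMeasure.continuous_prod.tendsto (αP, βP)).comp
      ((hαP.mono_left hUl).prodMk_nhds (hβP.mono_left hUl))
  have hππ : Tendsto (fun n ↦ (πs n).prod (πs n)) U (𝓝 (π.prod π)) :=
    (ProbabilityMeasure.continuous_prod.tendsto (π, π)).comp (hπt.prodMk_nhds hπt)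
  have hJ : Tendsto (fun n ↦ ∫ z, C z ∂((πs n : Measure (X × Y)).prod (πs n))) U
      (𝓝 (∫ z, C z ∂((π : Measure (X × Y)).prod π))) :=
    ProbabilityMeasure.tendsto_iff_forall_integral_tendsto.1 hππ C
  set J := ∫ z, C z ∂((π : Measure (X × Y)).prod π)
  refine ⟨π, hfst, hsnd, ?_⟩
  rcases hε.eq_or_lt with rfl | hε
  · simp only [EReal.coe_zero, zero_mul, add_zero, EReal.coe_le_coe_iff] at hπs ⊢
    exact (le_of_tendsto hJ (hUS.mono fun n hn ↦ (hπs n hn).2.2)).trans hab.le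
  · have hJa : ∀ᶠ n in (U : Filter ι),
        ∫ z, C z ∂((πs n : Measure (X × Y)).prod (πs n)) ≤ a := by
      filter_upwards [hUS] with n hn
      have h0 : (0 : EReal) ≤ (ε : EReal) *
          (klDiv (πs n : Measure (X × Y)) ((αs n).prod (βs n)) : EReal) :=
        mul_nonneg (by exact_mod_cast hε.le) (EReal.coe_ennreal_nonneg _)
      exact EReal.coe_le_coe_iff.1 ((le_add_of_nonneg_right h0).trans (hπs n hn).2.2)
    have hJb : J ≤ b := (le_of_tendsto hJ hJa).trans hab.le
    refine add_mul_le_of_le_toNNReal hε hJb ?_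
    refine klDiv_le_of_tendsto hπt hprod ?_
    filter_upwards [hUS, hJ.eventually_const_lt (show J - (b - a) < J by linarith)] with n hn hnJ
    refine (le_toNNReal_of_add_mul_le hε (hπs n hn).2.2).trans (ENNReal.coe_le_coe.2 ?_)
    refine Real.toNNReal_le_toNNReal ?_
    exact div_le_div_of_nonneg_right (by linarith) hε.le

end Limits

section GromovWasserstein

open InformationTheory
open scoped ENNReal NNReal Topology

lemma exists_boundedContinuous_eqOn {W : Type*} [TopologicalSpace W] {K : Set W}
    (hK : IsCompact K) {c : W → ℝ} (hc : Continuous c) :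
    ∃ C : W →ᵇ ℝ, ∀ w ∈ K, C w = c w := by
  obtain ⟨M, hM⟩ := hK.exists_bound_of_continuousOn hc.continuousOn
  refine ⟨BoundedContinuousFunction.ofNormedAddCommGroup (fun w ↦ max (-|M|) (min |M| (c w)))
    (by fun_prop) |M| fun w ↦ ?_, fun w hw ↦ ?_⟩
  · rw [Real.norm_eq_abs, abs_le]
    exact ⟨le_max_left _ _, max_le (by linarith [abs_nonneg M]) (min_le_left _ _)⟩
  · have h := abs_le.1 ((hM w hw).trans (le_abs_self M))
    change max (-|M|) (min |M| (c w)) = c w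
    rw [min_eq_right h.2, max_eq_right h.1]

lemma integral_integral_eq_integral_prod_of_eqOn {Z : Type*} [MeasurableSpace Z]
    [TopologicalSpace Z] [SecondCountableTopology Z] [BorelSpace Z] {K : Set Z} {π : Measure Z}
    [IsProbabilityMeasure π] (hπ : ∀ᵐ z ∂π, z ∈ K) {c : Z × Z → ℝ} {C : Z × Z →ᵇ ℝ}
    (hC : ∀ w ∈ K ×ˢ K, C w = c w) :
    ∫ p, ∫ q, c (p, q) ∂π ∂π = ∫ w, C w ∂(π.prod π) := by
  rw [integral_prod _ (C.integrable _)]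
  refine integral_congr_ae ?_
  filter_upwards [hπ] with p hp
  refine integral_congr_ae ?_
  filter_upwards [hπ] with q hq
  exact (hC (p, q) ⟨hp, hq⟩).symm

end GromovWasserstein

/-- on measures supported in fixed compact subsets of separable Hilbert
spaces, the entropic GW cost is (sequentially) continuous for weak convergence. -/
theorem gwE_weakly_continuous
    {HX HY : Type*}
    [NormedAddCommGroup HX] [InnerProductSpace ℝ HX] [CompleteSpace HX]
    [SecondCountableTopology HX] [MeasurableSpace HX] [BorelSpace HX]
    [NormedAddCommGroup HY] [InnerProductSpace ℝ HY] [CompleteSpace HY]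
    [SecondCountableTopology HY] [MeasurableSpace HY] [BorelSpace HY]
    (KX : Set HX) (KY : Set HY) (hKX : IsCompact KX) (hKY : IsCompact KY)
    (ε : ℝ) (hε : 0 ≤ ε)
    (αs : ℕ → Measure HX) (βs : ℕ → Measure HY)
    (α : Measure HX) (β : Measure HY)
    [∀ n, IsProbabilityMeasure (αs n)] [∀ n, IsProbabilityMeasure (βs n)]
    [IsProbabilityMeasure α] [IsProbabilityMeasure β]
    (hαsK : ∀ n, (αs n) KXᶜ = 0) (hβsK : ∀ n, (βs n) KYᶜ = 0)
    (hαK : α KXᶜ = 0) (hβK : β KYᶜ = 0)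
    (hαweak : ∀ f : HX →ᵇ ℝ,
      Tendsto (fun n => ∫ x, f x ∂(αs n)) atTop (nhds (∫ x, f x ∂α)))
    (hβweak : ∀ g : HY →ᵇ ℝ,
      Tendsto (fun n => ∫ y, g y ∂(βs n)) atTop (nhds (∫ y, g y ∂β))) :
    Tendsto (fun n => gwE ε (αs n) (βs n)) atTop (nhds (gwE ε α β)) := by
  obtain ⟨C, hC⟩ := exists_boundedContinuous_eqOn ((hKX.prod hKY).prod (hKX.prod hKY))
    (c := fun w : (HX × HY) × (HX × HY) ↦ (‖w.1.1 - w.2.1‖ ^ 2 - ‖w.1.2 - w.2.2‖ ^ 2) ^ 2)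
    (by fun_prop)
  have hcost {μ : Measure HX} {ν : Measure HY} [IsProbabilityMeasure μ] [IsProbabilityMeasure ν]
      (hμ : μ KXᶜ = 0) (hν : ν KYᶜ = 0) {π : Measure (HX × HY)} (h1 : π.map Prod.fst = μ)
      (h2 : π.map Prod.snd = ν) :
      ((∫ p, ∫ q, (‖p.1 - q.1‖ ^ 2 - ‖p.2 - q.2‖ ^ 2) ^ 2 ∂π ∂π : ℝ) : EReal)
        + (ε : EReal) * klE π (μ.prod ν) =
      ((∫ z, C z ∂(π.prod π) : ℝ) : EReal) +
        (ε : EReal) * (InformationTheory.klDiv π (μ.prod ν) : EReal) := by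
    have := isProbabilityMeasure_of_map_fst h1
    rw [klE_eq_klDiv, ← integral_integral_eq_integral_prod_of_eqOn
      (ae_mem_prod_of_marginals (h1 ▸ hμ) (h2 ▸ hν)) hC]
  have hlt {μ : Measure HX} {ν : Measure HY} [IsProbabilityMeasure μ] [IsProbabilityMeasure ν]
      (hμ : μ KXᶜ = 0) (hν : ν KYᶜ = 0) {c : EReal} : gwE ε μ ν < c ↔
      ∃ π : Measure (HX × HY), π.map Prod.fst = μ ∧ π.map Prod.snd = ν ∧
        ((∫ z, C z ∂(π.prod π) : ℝ) : EReal) +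
          (ε : EReal) * (InformationTheory.klDiv π (μ.prod ν) : EReal) < c := by
    simp only [gwE, iInf_lt_iff, Set.mem_ofPred_eq, exists_prop, and_assoc]
    refine exists_congr fun π ↦ and_congr_right fun h1 ↦ and_congr_right fun h2 ↦ ?_
    rw [hcost hμ hν h1 h2]
  refine tendsto_order.2 ⟨fun c hc ↦ ?_, fun c hc ↦ ?_⟩
  · obtain ⟨b, hcb, hb⟩ := EReal.lt_iff_exists_real_btwn.1 hc
    obtain ⟨a, hca, hab⟩ := EReal.lt_iff_exists_real_btwn.1 hcb
    by_contra hnot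
    have hfr : ∃ᶠ n in atTop, gwE ε (αs n) (βs n) < a :=
      (not_eventually.1 hnot).mono fun n hn ↦ (not_lt.1 hn).trans_lt hca
    obtain ⟨π, h1, h2, h3⟩ := exists_coupling_le_of_frequently hKX hKY hαsK hβsK hαweak hβweak C hε
      (EReal.coe_lt_coe_iff.1 hab) (hfr.mono fun n hn ↦ by
        obtain ⟨π, h1, h2, h3⟩ := (hlt (hαsK n) (hβsK n)).1 hn
        exact ⟨π, h1, h2, h3.le⟩)
    exact lt_irrefl _ ((hlt hαK hβK).2 ⟨π, h1, h2, h3.trans_lt hb⟩)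
  · obtain ⟨π, h1, h2, h3⟩ := (hlt hαK hβK).1 hc
    obtain ⟨b, hb, hbc⟩ := EReal.lt_iff_exists_real_btwn.1 h3
    obtain ⟨b', hbb, hbc'⟩ := EReal.lt_iff_exists_real_btwn.1 hbc
    have hπ := isProbabilityMeasure_of_map_fst h1
    have hpos : 0 < b' - b := sub_pos.2 (EReal.coe_lt_coe_iff.1 hbb)
    subst h1 h2
    filter_upwards [eventually_exists_coupling_le hKX hKY hαsK hβsK hαK hβK hαweak hβweak C hpos]
      with n ⟨π', h1', h2', hJ, hkl⟩
    refine (hlt (hαsK n) (hβsK n)).2 ⟨π', h1', h2', lt_of_le_of_lt ?_ hbc'⟩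
    calc _ ≤ ((∫ z, C z ∂(π.prod π) + (b' - b) : ℝ) : EReal) + (ε : EReal) *
          (InformationTheory.klDiv π ((π.map Prod.fst).prod (π.map Prod.snd)) : EReal) := by
          refine add_le_add (EReal.coe_le_coe_iff.2 hJ) (mul_le_mul_of_nonneg_left ?_ ?_)
          · exact EReal.coe_ennreal_le_coe_ennreal_iff.2 hkl
          · exact_mod_cast hε
      _ = (((∫ z, C z ∂(π.prod π) : ℝ) : EReal) + (ε : EReal) *
          (InformationTheory.klDiv π ((π.map Prod.fst).prod (π.map Prod.snd)) : EReal)) +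
            ((b' - b : ℝ) : EReal) := by
          rw [EReal.coe_add, add_right_comm]
      _ ≤ (b : EReal) + ((b' - b : ℝ) : EReal) := by gcongr
      _ = b' := by rw [← EReal.coe_add]; congr 1; ring
end
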